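/- Let c₁ = 1.978993 and c₂ = 2.035802. There exist polynomials P₁, P₂ such that for every set S of N points in the plane in general position: (i) either pg(S,1) ≤ P₁(N) · 186.46^N or ĥv_{x,c₁N}(S,1) > N/186.46 (or both); and (ii) either pg(S,2) ≤ P₂(N) · 180.20^N or ĥv_{x,c₂N}(S,2) > N/180.20 (or both). -/

import Mathlib

open scoped Classical

noncomputable section

/-- A point in the plane. -/
abbrev Pt : Type := ℝ × ℝ

/-- `S` is in general position: no three distinct points of `S` are collinear. -/
def GenPos (S : Finset Pt) : Prop :=
  ∀ p ∈ S, ∀ q ∈ S, ∀ r ∈ S, p ≠ q → p ≠ r → q ≠ r →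
    ¬ Collinear ℝ ({p, q, r} : Set Pt)

/-- Two straight edges cross if their relative interiors (open segments) meet. -/
def EdgesCross (e f : Sym2 Pt) : Prop :=
  ∃ a b c d : Pt, e = s(a, b) ∧ f = s(c, d) ∧
    (openSegment ℝ a b ∩ openSegment ℝ c d).Nonempty

/-- `G` is a crossing-free straight-edge (plane) graph on the point set `S`:
its edges are nondegenerate straight segments between points of `S`,
and no two distinct edges cross. -/
def IsPlaneGraph (S : Finset Pt) (G : Finset (Sym2 Pt)) : Prop :=
  (∀ e ∈ G, ¬ e.IsDiag ∧ ∀ p ∈ e, p ∈ S) ∧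
    ∀ e ∈ G, ∀ f ∈ G, e ≠ f → ¬ EdgesCross e f

/-- The (finite) collection of all plane graphs on `S`. -/
def planeGraphs (S : Finset Pt) : Finset (Finset (Sym2 Pt)) :=
  S.sym2.powerset.filter (IsPlaneGraph S)

/-- The degree of the point `p` in the graph `G`. -/
def vingDeg (G : Finset (Sym2 Pt)) (p : Pt) : ℕ :=
  (G.filter fun e => p ∈ e).card

/-- The ving `(p, G)` is an x-ving: no straight edge from `p` to another point
of `S` can be added to `G` while keeping the graph plane. -/
def IsXVing (S : Finset Pt) (G : Finset (Sym2 Pt)) (p : Pt) : Prop :=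
  ∀ q ∈ S, q ≠ p → s(p, q) ∉ G → ¬ IsPlaneGraph S (insert s(p, q) G)

/-- `v_x(G)`: the number of x-vings of `G`. -/
def vx (S : Finset Pt) (G : Finset (Sym2 Pt)) : ℕ :=
  (S.filter (IsXVing S G)).card

/-- `v_i(G)`: the number of vertices of degree exactly `i` in `G`. -/
def vdeg (S : Finset Pt) (G : Finset (Sym2 Pt)) (i : ℕ) : ℕ :=
  (S.filter fun p => vingDeg G p = i).card

/-- `ĥv_x(S)`: the average of `v_x(G)` over a uniformly random plane graph on `S`. -/
def hvx (S : Finset Pt) : ℝ :=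
  (∑ G ∈ planeGraphs S, (vx S G : ℝ)) / (planeGraphs S).card

/-- `ĥv_i(S)`: the average of `v_i(G)` over a uniformly random plane graph on `S`. -/
def hvdeg (S : Finset Pt) (i : ℕ) : ℝ :=
  (∑ G ∈ planeGraphs S, (vdeg S G i : ℝ)) / (planeGraphs S).card

/-- `pg(N)`: the maximum number of plane graphs over all sets of `N` points in
general position. -/
def pgMax (N : ℕ) : ℕ :=
  sSup {n : ℕ | ∃ S : Finset Pt, S.card = N ∧ GenPos S ∧ (planeGraphs S).card = n}

/-- The plane graphs on `S` with at most `m` edges. -/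
def planeGraphsLE (S : Finset Pt) (m : ℝ) : Finset (Finset (Sym2 Pt)) :=
  (planeGraphs S).filter fun G => (G.card : ℝ) ≤ m

/-- `ĥv_{x,m}(S)`: the average of `v_x(G)` over a uniformly random plane graph
on `S` with at most `m` edges. -/
def hvxLE (S : Finset Pt) (m : ℝ) : ℝ :=
  (∑ G ∈ planeGraphsLE S m, (vx S G : ℝ)) / (planeGraphsLE S m).card

/-- `G` has no vertex (point of `S`) of degree smaller than `i`. -/
def MinDegGe (S : Finset Pt) (G : Finset (Sym2 Pt)) (i : ℕ) : Prop :=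
  ∀ p ∈ S, i ≤ vingDeg G p

/-- The plane graphs on `S` with no vertex of degree smaller than `i`. -/
def planeGraphsDeg (S : Finset Pt) (i : ℕ) : Finset (Finset (Sym2 Pt)) :=
  (planeGraphs S).filter fun G => MinDegGe S G i

/-- The plane graphs on `S` with at most `m` edges and no vertex of degree
smaller than `i`. -/
def planeGraphsLEDeg (S : Finset Pt) (m : ℝ) (i : ℕ) : Finset (Finset (Sym2 Pt)) :=
  (planeGraphs S).filter fun G => (G.card : ℝ) ≤ m ∧ MinDegGe S G i

/-- `ĥv_{x,m}(S,i)`: the average of `v_x(G)` over a uniformly random plane graph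
on `S` with at most `m` edges and no vertex of degree smaller than `i`. -/
def hvxLEDeg (S : Finset Pt) (m : ℝ) (i : ℕ) : ℝ :=
  (∑ G ∈ planeGraphsLEDeg S m i, (vx S G : ℝ)) / (planeGraphsLEDeg S m i).card

/-- `pg(N, i)`: the maximum, over sets `S` of `N` points in general position, of
the number of plane graphs on `S` with no vertex of degree smaller than `i`. -/
def pgMaxDeg (N i : ℕ) : ℕ :=
  sSup {n : ℕ | ∃ S : Finset Pt, S.card = N ∧ GenPos S ∧ (planeGraphsDeg S i).card = n}

/-- The underlying abstract graph of `G` on the vertex set `S`. -/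
def abstractGraph (S : Finset Pt) (G : Finset (Sym2 Pt)) :
    SimpleGraph (S : Set Pt) :=
  SimpleGraph.induce (S : Set Pt) (SimpleGraph.fromEdgeSet (G : Set (Sym2 Pt)))

/-- The connected plane graphs on `S`. -/
def connPlaneGraphs (S : Finset Pt) : Finset (Finset (Sym2 Pt)) :=
  (planeGraphs S).filter fun G => (abstractGraph S G).Connected

/-- The underlying abstract graph of `G` is bi-connected (2-vertex-connected):
it is connected and remains connected after deletion of any single vertex. -/
def Biconnected (S : Finset Pt) (G : Finset (Sym2 Pt)) : Prop :=
  (abstractGraph S G).Connected ∧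
    ∀ v ∈ S, (SimpleGraph.induce ((S : Set Pt) \ {v})
      (SimpleGraph.fromEdgeSet (G : Set (Sym2 Pt)))).Connected

/-- The bi-connected plane graphs on `S`. -/
def biconnPlaneGraphs (S : Finset Pt) : Finset (Finset (Sym2 Pt)) :=
  (planeGraphs S).filter (Biconnected S)

/-- `G` is a `k`-quasi-plane graph on `S`: a straight-edge graph on `S`
(crossings allowed) with no `k` pairwise crossing edges. -/
def IsQuasiPlane (k : ℕ) (S : Finset Pt) (G : Finset (Sym2 Pt)) : Prop :=
  (∀ e ∈ G, ¬ e.IsDiag ∧ ∀ p ∈ e, p ∈ S) ∧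
    ¬ ∃ T ⊆ G, T.card = k ∧ ∀ e ∈ T, ∀ f ∈ T, e ≠ f → EdgesCross e f

/-- The (finite) collection of all `k`-quasi-plane graphs on `S`. -/
def qpGraphs (k : ℕ) (S : Finset Pt) : Finset (Finset (Sym2 Pt)) :=
  S.sym2.powerset.filter (IsQuasiPlane k S)

/-- The ving `(p, G)` is an x-ving of the `k`-quasi-plane graph `G`: no straight
edge from `p` to another point of `S` can be added to `G` without violating
`k`-quasi-planarity. -/
def IsXVingQP (k : ℕ) (S : Finset Pt) (G : Finset (Sym2 Pt)) (p : Pt) : Prop :=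
  ∀ q ∈ S, q ≠ p → s(p, q) ∉ G → ¬ IsQuasiPlane k S (insert s(p, q) G)

/-- `v_x(G)` for a `k`-quasi-plane graph `G`. -/
def vxQP (k : ℕ) (S : Finset Pt) (G : Finset (Sym2 Pt)) : ℕ :=
  (S.filter (IsXVingQP k S G)).card

/-- `ĥv_x^k(S)`: the average of `v_x(G)` over a uniformly random `k`-quasi-plane
graph on `S`. -/
def hvxQP (k : ℕ) (S : Finset Pt) : ℝ :=
  (∑ G ∈ qpGraphs k S, (vxQP k S G : ℝ)) / (qpGraphs k S).card

/-- `qp_k(N)`: the maximum number of `k`-quasi-plane graphs over all sets of `N`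
points in general position. -/
def qpMax (k N : ℕ) : ℕ :=
  sSup {n : ℕ | ∃ S : Finset Pt, S.card = N ∧ GenPos S ∧ (qpGraphs k S).card = n}

/-- Twice the signed area of the triangle `a b c`. -/
def ori (a b c : Pt) : ℝ := (b.1 - a.1) * (c.2 - a.2) - (b.2 - a.2) * (c.1 - a.1)

/-- The segments `a b` and `c d` cross properly. -/
def Cross (a b c d : Pt) : Prop :=
  ori a b c * ori a b d < 0 ∧ ori c d a * ori c d b < 0

/-- `r` lies in the interior of the triangle `a b c`, of either orientation. -/
def InTri (r a b c : Pt) : Prop :=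
  (0 < ori a b r ∧ 0 < ori b c r ∧ 0 < ori c a r) ∨
    (ori a b r < 0 ∧ ori b c r < 0 ∧ ori c a r < 0)

/-- No edge of `H` properly crosses the segment `a b`. -/
def Clear (H : Finset (Sym2 Pt)) (a b : Pt) : Prop :=
  ∀ c d, s(c, d) ∈ H → ¬ Cross a b c d

/-- No point of `R` lies in the interior of the triangle `a b c`. -/
def EmptyTri (R : Finset Pt) (a b c : Pt) : Prop := ∀ r ∈ R, ¬ InTri r a b c

theorem ori_rot (a b c : Pt) : ori b c a = ori a b c := by unfold ori; ring
theorem ori_rot' (a b c : Pt) : ori c a b = ori a b c := by unfold ori; ring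
theorem ori_swap (a b c : Pt) : ori b a c = - ori a b c := by unfold ori; ring
theorem ori_swap' (a b c : Pt) : ori a c b = - ori a b c := by unfold ori; ring
@[simp] theorem ori_self_left (a b : Pt) : ori a a b = 0 := by unfold ori; ring
@[simp] theorem ori_self_right (a b : Pt) : ori a b b = 0 := by unfold ori; ring
@[simp] theorem ori_self_mid (a b : Pt) : ori a b a = 0 := by unfold ori; ring

theorem ori_add (a b c d : Pt) : ori a b d + ori b c d + ori c a d = ori a b c := by
  unfold ori; ring

theorem ori_pluecker (p a b c d : Pt) :
    ori p a b * ori p c d - ori p a c * ori p b d + ori p a d * ori p b c = 0 := by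
  unfold ori; ring

theorem Cross.symm {a b c d : Pt} (h : Cross a b c d) : Cross c d a b := ⟨h.2, h.1⟩

theorem Cross.swap_left {a b c d : Pt} (h : Cross a b c d) : Cross b a c d := by
  refine ⟨?_, ?_⟩
  · rw [ori_swap a b c, ori_swap a b d]; nlinarith [h.1]
  · rw [mul_comm]; exact h.2

theorem Cross.swap_right {a b c d : Pt} (h : Cross a b c d) : Cross a b d c :=
  h.symm.swap_left.symm

theorem InTri.rot {r a b c : Pt} (h : InTri r a b c) : InTri r b c a := by
  unfold InTri at *; tauto

theorem InTri.swap {r a b c : Pt} (h : InTri r a b c) : InTri r b a c := by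
  unfold InTri at *
  rw [ori_swap a b r, ori_swap c a r, ori_swap b c r]
  rcases h with ⟨h1, h2, h3⟩ | ⟨h1, h2, h3⟩
  · right; refine ⟨?_, ?_, ?_⟩ <;> linarith
  · left; refine ⟨?_, ?_, ?_⟩ <;> linarith

theorem inTri_rot {r a b c : Pt} : InTri r b c a ↔ InTri r a b c :=
  ⟨fun h => h.rot.rot, fun h => h.rot⟩

theorem EmptyTri.rot {R : Finset Pt} {a b c : Pt} (h : EmptyTri R a b c) : EmptyTri R b c a :=
  fun r hr hi => h r hr (inTri_rot.1 hi)

theorem EmptyTri.swap {R : Finset Pt} {a b c : Pt} (h : EmptyTri R a b c) : EmptyTri R b a c :=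
  fun r hr hi => h r hr hi.swap

theorem Clear.symm {H : Finset (Sym2 Pt)} {a b : Pt} (h : Clear H a b) : Clear H b a :=
  fun c d hcd hx => h c d hcd hx.swap_left

theorem Clear.mono {H K : Finset (Sym2 Pt)} {a b : Pt} (hK : Clear K a b) (hHK : H ⊆ K) :
    Clear H a b := fun c d hcd => hK c d (hHK hcd)

theorem inTri_iff_of_pos {r a b c : Pt} (h : 0 < ori a b c) :
    InTri r a b c ↔ 0 < ori a b r ∧ 0 < ori b c r ∧ 0 < ori c a r := by
  refine ⟨fun hi => hi.resolve_right fun ⟨h1, h2, h3⟩ => ?_, Or.inl⟩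
  have := ori_add a b c r
  linarith

/-- Reflection in the first coordinate axis. -/
def mir (a : Pt) : Pt := (a.1, -a.2)

theorem ori_mir (a b c : Pt) : ori (mir a) (mir b) (mir c) = - ori a b c := by
  unfold ori mir; ring

/-- A segment `u v` entering the triangle `x y w` through `x y`, with `y` alone on its side and
not ending inside, leaves through `w y`. -/
theorem cross_exit_of_pos {x y w u v : Pt} (hx : 0 < ori u v x) (hw : 0 < ori u v w)
    (hy : ori u v y < 0) (hxy : ori x y u * ori x y v < 0)
    (ho : 0 < ori x y w) (hv : ¬ (0 < ori x y v ∧ 0 ≤ ori y w v ∧ 0 < ori w x v)) :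
    Cross u v w y := by
  have e1 : ori x y v - ori x y u = ori u v x - ori u v y := by unfold ori; ring
  have hvp : 0 < ori x y v := by nlinarith
  have hun : ori x y u < 0 := by nlinarith
  have e2 : ori y w v * ori u v x + ori w x v * ori u v y + ori x y v * ori u v w = 0 := by
    unfold ori; ring
  have hyw : ori y w v < 0 := by
    by_contra hc
    push Not at hc
    by_cases h3 : 0 < ori w x v
    · exact hv ⟨hvp, hc, h3⟩
    · push Not at h3
      nlinarith [mul_nonneg hc hx.le, mul_pos hvp hw, mul_nonneg_of_nonpos_of_nonpos h3 hy.le]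
  have e3 : ori x y v * ori y w u - ori x y u * ori y w v = - (ori x y w * ori u v y) := by
    unfold ori; ring
  have hyu : 0 < ori y w u := by
    by_contra hc
    push Not at hc
    nlinarith [mul_nonneg_of_nonpos_of_nonpos hun.le hyw.le, mul_neg_of_pos_of_neg ho hy,
      mul_nonneg hvp.le (neg_nonneg.2 hc)]
  refine ⟨mul_neg_of_pos_of_neg hw hy, ?_⟩
  rw [ori_swap y w u, ori_swap y w v]
  nlinarith

/-- `Cross.exit` for `x` to the left of `u v`. -/
theorem cross_exit_aux {x y w u v : Pt} (hx : 0 < ori u v x) (hw : 0 < ori u v w)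
    (hy : ori u v y < 0) (hxy : ori x y u * ori x y v < 0)
    (ho : ori x y w ≠ 0)
    (hin : ∀ z, z = u ∨ z = v → ¬ InTri z x y w)
    (hz : ∀ z, z = u ∨ z = v → ori y w z ≠ 0) :
    Cross u v w y := by
  rcases lt_or_gt_of_ne ho with h | h
  · have := @cross_exit_of_pos (mir x) (mir y) (mir w) (mir v) (mir u)
      (by rw [ori_mir, ori_swap]; simpa using hx)
      (by rw [ori_mir, ori_swap]; simpa using hw)
      (by rw [ori_mir, ori_swap]; simpa using hy)
      (by simp only [ori_mir]; nlinarith) (by simp only [ori_mir]; linarith)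
      (by
        simp only [ori_mir]
        rintro ⟨h1, h2, h3⟩
        refine hin u (Or.inl rfl) (Or.inr ⟨by linarith, ?_, by linarith⟩)
        exact lt_of_le_of_ne (by linarith) (hz u (Or.inl rfl)))
    obtain ⟨h1, h2⟩ := this
    simp only [ori_mir] at h1 h2
    refine Cross.swap_left ⟨?_, ?_⟩ <;> nlinarith
  · refine cross_exit_of_pos hx hw hy hxy h ?_
    rintro ⟨h1, h2, h3⟩
    exact hin v (Or.inr rfl) (Or.inl ⟨h1, lt_of_le_of_ne h2 (hz v (Or.inr rfl)).symm, h3⟩)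

/-- A segment `u v` crossing the side `x y` of the triangle `x y w`, with neither end inside and
with `w` on the same side as `x`, crosses the side `w y`. -/
theorem Cross.exit {x y w u v : Pt} (h : Cross u v x y) (hw : 0 < ori u v w * ori u v x)
    (ho : ori x y w ≠ 0) (hu : ¬ InTri u x y w) (hv : ¬ InTri v x y w)
    (hyu : ori y w u ≠ 0) (hyv : ori y w v ≠ 0) : Cross u v w y := by
  have hin : ∀ z, z = u ∨ z = v → ¬ InTri z x y w := by rintro z (rfl | rfl) <;> assumption
  have hz : ∀ z, z = u ∨ z = v → ori y w z ≠ 0 := by rintro z (rfl | rfl) <;> assumption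
  obtain ⟨h1, h2⟩ := h
  rcases lt_trichotomy (ori u v x) 0 with hx | hx | hx
  · refine Cross.swap_left (cross_exit_aux (x := x) (u := v) (v := u) ?_ ?_ ?_ ?_ ho
      (fun z hzz => hin z hzz.symm) (fun z hzz => hz z hzz.symm))
    · rw [ori_swap]; linarith
    · rw [ori_swap]; nlinarith
    · rw [ori_swap]; nlinarith
    · linarith
  · rw [hx] at hw; simp at hw
  · exact cross_exit_aux hx (by nlinarith) (by nlinarith) h2 ho hin hz

theorem inTri_mir {r a b c : Pt} : InTri (mir r) (mir a) (mir b) (mir c) ↔ InTri r a b c := by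
  unfold InTri
  simp only [ori_mir, neg_pos, Left.neg_neg_iff]
  tauto

theorem cross_mir {a b c d : Pt} : Cross (mir a) (mir b) (mir c) (mir d) ↔ Cross a b c d := by
  unfold Cross
  simp only [ori_mir, neg_mul_neg]

theorem InTri.ori_ne {r a b c : Pt} (h : InTri r a b c) : ori a b c ≠ 0 := by
  have := ori_add a b c r
  rcases h with ⟨h1, h2, h3⟩ | ⟨h1, h2, h3⟩
  · linarith
  · exact ne_of_lt (by linarith)

/-- If `r` lies in the triangle `q a b`, the segment `c d` crosses `q r`, and `c` is outside the
triangle, farther than `r` from `a b` and on the side of `a`, then `c d` crosses `q a`. -/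
theorem cross_of_level_aux {q a b : Pt} (ho : 0 < ori q a b) {r c d : Pt}
    (hsa : ori q a c = 0 → ori a b c * ori b q c ≤ 0) (hr : InTri r q a b)
    (hmax : ¬ InTri c q a b) (hx : Cross q r c d) (hlev : ori a b r < ori a b c)
    (hc : ori q r c < 0) : Cross q a c d := by
  rw [inTri_iff_of_pos ho] at hr
  obtain ⟨r1, r2, r3⟩ := hr
  obtain ⟨x1, x2⟩ := hx
  have hd : 0 < ori q r d := by nlinarith
  have s1 : ori q a c + ori a b c + ori b q c = ori q a b := ori_add _ _ _ _
  have e1 : ori q a b * ori q r c = ori b q r * ori q a c - ori q a r * ori b q c := by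
    unfold ori; ring
  have hbq : ori q a c ≥ 0 → 0 < ori b q c := by
    intro h
    by_contra h'
    push Not at h'
    nlinarith [mul_nonneg r3.le h, mul_nonneg r1.le (neg_nonneg.2 h'), mul_neg_of_pos_of_neg ho hc]
  have hac : ori q a c < 0 := by
    by_contra h
    push Not at h
    rcases h.eq_or_lt with h0 | h0
    · have := hsa h0.symm
      have h4 := hbq h
      nlinarith
    · exact hmax ((inTri_iff_of_pos ho).2 ⟨h0, by linarith, hbq h⟩)
  have e2 : ori c d q - ori c d r = ori q r d - ori q r c := by unfold ori; ring
  have e3 : ori q a r + ori a b r + ori b q r = ori q a b := ori_add _ _ _ _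
  have e4 : ori q r c * ori q a d = ori q r d * ori q a c - ori q a r * ori c d q := by
    unfold ori; ring
  have hq : 0 < ori c d q := by
    by_contra h
    push Not at h
    rcases h.eq_or_lt with h0 | h0
    · rw [h0] at x2; simp at x2
    · nlinarith
  have hcr : ori c d r < 0 := by nlinarith
  have hd2 : 0 < ori q a d := by
    by_contra h
    push Not at h
    nlinarith [mul_nonneg_of_nonpos_of_nonpos hc.le h, mul_neg_of_pos_of_neg hd hac,
      mul_pos r1 hq]
  have e5 : ori c d a = ori c d q - (ori q a d - ori q a c) := by unfold ori; ring
  have hca : ori c d a < 0 := by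
    by_contra h
    push Not at h
    have e6 : ori q a b * (-ori q r c * ori c d a) = ori c d q * ori q a r * (ori b q c - ori q a b)
        - ori c d q * ori b q r * ori q a c
        + ori q a b * (ori q r d - ori q r c) * ori q a c := by
      linear_combination (- ori c d q - 0) * e1 - ori q a b * ori q r c * e5 + ori q a b * e4
    have k1 : 0 ≤ ori q a b * (-ori q r c * ori c d a) :=
      mul_nonneg ho.le (mul_nonneg (by linarith) h)
    have k2 : ori c d q * ori q a r * (ori b q c - ori q a b)
        ≤ ori c d q * ori q a r * (- ori q a c) :=
      mul_le_mul_of_nonneg_left (by linarith) (mul_pos hq r1).le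
    have k3 : ori c d q * (ori q a r + ori b q r) < (ori q r d - ori q r c) * ori q a b :=
      mul_lt_mul'' (by linarith) (by linarith) hq.le (by linarith)
    nlinarith [mul_pos_of_neg_of_neg hac (sub_neg.2 k3)]
  exact ⟨mul_neg_of_neg_of_pos hac hd2, mul_neg_of_pos_of_neg hq hca⟩

theorem cross_of_level_pos {q a b : Pt} (ho : 0 < ori q a b) {r c d : Pt}
    (hsa : ori q a c = 0 → ori a b c * ori b q c ≤ 0)
    (hsb : ori q b c = 0 → ori a b c * ori q a c ≤ 0) (hr : InTri r q a b)
    (hmax : ¬ InTri c q a b) (hx : Cross q r c d) (hlev : ori a b r < ori a b c) :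
    Cross q a c d ∨ Cross q b c d := by
  rcases lt_trichotomy (ori q r c) 0 with h | h | h
  · exact Or.inl (cross_of_level_aux ho hsa hr hmax hx hlev h)
  · have := hx.1
    rw [h] at this; simp at this
  · right
    rw [← cross_mir]
    refine cross_of_level_aux (b := mir a) (r := mir r) ?_ ?_ ?_ ?_ (cross_mir.2 hx) ?_ ?_
    · rw [ori_mir, ori_swap']; linarith
    · simp only [ori_mir]
      intro h
      have := hsb (by linarith)
      rw [ori_swap a b c, ori_swap q a c]
      linarith
    · exact inTri_mir.2 hr.swap.rot
    · exact fun h => hmax (inTri_mir.1 h).swap.rot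
    · simp only [ori_mir]
      rw [ori_swap a b c, ori_swap a b r]; linarith
    · rw [ori_mir]; linarith

theorem cross_of_level {q a b r c d : Pt}
    (hsa : ori q a c = 0 → ori a b c * ori b q c ≤ 0)
    (hsb : ori q b c = 0 → ori a b c * ori q a c ≤ 0) (hr : InTri r q a b)
    (hmax : ¬ InTri c q a b) (hx : Cross q r c d)
    (hlev : ori q a b * ori a b r < ori q a b * ori a b c) :
    Cross q a c d ∨ Cross q b c d := by
  rcases lt_or_gt_of_ne hr.ori_ne with h | h
  · rw [← cross_mir, ← @cross_mir q b]
    refine cross_of_level_pos (r := mir r) ?_ ?_ ?_ (inTri_mir.2 hr) (fun h => hmax (inTri_mir.1 h))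
      (cross_mir.2 hx) ?_
    · rw [ori_mir]; linarith
    · simpa [ori_mir] using hsa
    · simpa [ori_mir] using hsb
    · rw [ori_mir, ori_mir]; nlinarith
  · exact cross_of_level_pos h hsa hsb hr hmax hx (lt_of_mul_lt_mul_left hlev h.le)

/-- If `a` and `b` are visible from `q` and the triangle `q a b` contains points of `R`, then it
contains one visible from `q`. -/
theorem exists_clear_in_tri {R : Finset Pt} {H : Finset (Sym2 Pt)}
    (hH : ∀ c d, s(c, d) ∈ H → c ∈ R) {q a b : Pt}
    (hsa : ∀ c ∈ R, ori q a c = 0 → ori a b c * ori b q c ≤ 0)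
    (hsb : ∀ c ∈ R, ori q b c = 0 → ori a b c * ori q a c ≤ 0)
    (hqa : Clear H q a) (hqb : Clear H q b) (hex : ∃ r ∈ R, InTri r q a b) :
    ∃ r ∈ R, InTri r q a b ∧ Clear H q r := by
  obtain ⟨r, hr, hmax⟩ := (R.filter fun r => InTri r q a b).exists_max_image
    (fun r => ori q a b * ori a b r) (by
      obtain ⟨r, h1, h2⟩ := hex
      exact ⟨r, Finset.mem_filter.2 ⟨h1, h2⟩⟩)
  obtain ⟨hrR, hri⟩ := Finset.mem_filter.1 hr
  refine ⟨r, hrR, hri, fun c d hcd hx => ?_⟩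
  have key : ∀ c d, s(c, d) ∈ H → Cross q r c d →
      ori q a b * ori a b c ≤ ori q a b * ori a b r := by
    intro c d hcd hx
    by_contra hlt
    push Not at hlt
    have hc := hH c d hcd
    rcases cross_of_level (hsa c hc) (hsb c hc) hri
      (fun h => absurd (hmax c (Finset.mem_filter.2 ⟨hc, h⟩)) (not_le.2 hlt)) hx hlt with h | h
    · exact hqa c d hcd h
    · exact hqb c d hcd h
  have h1 := key c d hcd hx
  have h2 := key d c (by rwa [Sym2.eq_swap]) hx.swap_right
  obtain ⟨x1, x2⟩ := hx
  have hq : 0 < ori q a b * (ori q a b - ori a b r) := by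
    have := ori_add q a b r
    rcases hri with ⟨g1, g2, g3⟩ | ⟨g1, g2, g3⟩
    · exact mul_pos (by linarith) (by linarith)
    · exact mul_pos_of_neg_of_neg (by linarith) (by linarith)
  have e1 : ori c d q * ori a b r - ori c d r * ori q a b
      = - ori q r c * ori a b d + ori q r d * ori a b c := by unfold ori; ring
  have e2 : ori c d q - ori c d r = ori q r d - ori q r c := by unfold ori; ring
  set D := ori q a b
  set k := ori c d q
  set l := ori c d r
  have e3 : -l * (D * (D - ori a b r)) = - ori q r c * (D * ori a b d - D * ori a b r)
      + ori q r d * (D * ori a b c - D * ori a b r) := by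
    linear_combination D * e1 - D * ori a b r * e2
  rcases lt_or_ge (ori q r c) 0 with hc | hc
  · have hd : 0 < ori q r d := by nlinarith
    have hl : l < 0 := by
      by_contra hl
      push Not at hl
      nlinarith
    nlinarith [mul_pos (neg_pos.2 hl) hq]
  · have hd : ori q r d < 0 := by nlinarith
    have hl : 0 < l := by
      by_contra hl
      push Not at hl
      nlinarith
    nlinarith [mul_pos hl hq]

/-- No three points of `V` are collinear. -/
def GP (V : Finset Pt) : Prop :=
  ∀ a ∈ V, ∀ b ∈ V, ∀ c ∈ V, a ≠ b → a ≠ c → b ≠ c → ori a b c ≠ 0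

/-- `H` is a set of pairwise non-crossing segments between points of `V`. -/
structure PlaneOn (V : Finset Pt) (H : Finset (Sym2 Pt)) : Prop where
  mem : ∀ {a b}, s(a, b) ∈ H → a ∈ V
  ne : ∀ {a b}, s(a, b) ∈ H → a ≠ b
  not_cross : ∀ {a b c d}, s(a, b) ∈ H → s(c, d) ∈ H → ¬ Cross a b c d

theorem GP.mono {V W : Finset Pt} (h : GP W) (hVW : V ⊆ W) : GP V :=
  fun a ha b hb c hc => h a (hVW ha) b (hVW hb) c (hVW hc)

theorem PlaneOn.mem_right {V : Finset Pt} {H : Finset (Sym2 Pt)} (h : PlaneOn V H) {a b : Pt}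
    (hab : s(a, b) ∈ H) : b ∈ V := h.mem (by rwa [Sym2.eq_swap] at hab)

theorem PlaneOn.mono {V : Finset Pt} {H K : Finset (Sym2 Pt)} (h : PlaneOn V K) (hHK : H ⊆ K) :
    PlaneOn V H :=
  ⟨fun e => h.mem (hHK e), fun e => h.ne (hHK e), fun e f => h.not_cross (hHK e) (hHK f)⟩

theorem PlaneOn.clear {V : Finset Pt} {H : Finset (Sym2 Pt)} (h : PlaneOn V H) {a b : Pt}
    (hab : s(a, b) ∈ H) : Clear H a b := fun _ _ hcd => h.not_cross hab hcd

theorem Cross.signs {a b c d : Pt} (h : Cross a b c d) (hd : 0 < ori a b d) :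
    ori a b c < 0 ∧ 0 < ori c d a ∧ ori c d b < 0 := by
  obtain ⟨h1, h2⟩ := h
  have hc : ori a b c < 0 := by nlinarith
  have e : ori c d a - ori c d b = ori a b d - ori a b c := by unfold ori; ring
  refine ⟨hc, ?_⟩
  rcases lt_or_ge (ori c d a) 0 with h | h
  · nlinarith
  · constructor <;> nlinarith

theorem Cross.signs' {a b c d : Pt} (h : Cross a b c d) (hd : ori a b d < 0) :
    0 < ori a b c ∧ ori c d a < 0 ∧ 0 < ori c d b := by
  have h1 : 0 < ori a b c := by nlinarith [h.1]
  obtain ⟨-, h2, h3⟩ := h.swap_right.signs h1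
  rw [ori_swap] at h2 h3
  exact ⟨h1, by linarith, by linarith⟩

/-- The segment `u v` crosses `q r`, where `r` lies in the region cut from the left side of `q r₀`
by the crossing segment `z w`, with `w` on the left.  If `u` lies to the right of `q r`, then
`u` is in the region, or `u v` crosses `q r₀` before `z w` does, or `u v` crosses `z w`. -/
theorem cross_region {q r₀ z w r u v : Pt} (hf : Cross q r₀ z w) (hw : 0 < ori q r₀ w)
    (hr : 0 < ori q r₀ r) (hrf : 0 ≤ ori z w r) (hrw : 0 ≤ ori q r w) (hg : Cross q r u v)
    (hu : ori q r u < 0) (hu0 : ori q r₀ u = 0 → ori z w u < 0) :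
    (0 < ori q r₀ u ∧ 0 ≤ ori z w u) ∨
      (Cross q r₀ u v ∧ 0 < ori u v q - ori u v r₀ ∧ 0 < ori z w q - ori z w r₀ ∧
        ori u v q * (ori z w q - ori z w r₀) < ori z w q * (ori u v q - ori u v r₀)) ∨
      Cross z w u v := by
  have hz : ori q r₀ z < 0 := by nlinarith [hf.1]
  have hv : 0 < ori q r v := by nlinarith [hg.1]
  have d1 : ori z w q - ori z w r₀ = ori q r₀ w - ori q r₀ z := by unfold ori; ring
  have hF0 : 0 < ori z w q ∧ ori z w r₀ < 0 := by
    have := hf.2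
    rcases lt_or_ge (ori z w q) 0 with h | h
    · nlinarith
    · constructor <;> nlinarith
  have d2 : ori u v q - ori u v r = ori q r v - ori q r u := by unfold ori; ring
  have hG0 : 0 < ori u v q ∧ ori u v r < 0 := by
    have := hg.2
    rcases lt_or_ge (ori u v q) 0 with h | h
    · nlinarith
    · constructor <;> nlinarith
  have pl : ori q r₀ w * ori q r z = ori q r₀ z * ori q r w - ori q r₀ r * ori z w q := by
    unfold ori; ring
  have hAz : ori q r z < 0 := by
    by_contra h
    push Not at h
    nlinarith [mul_nonneg hw.le h, mul_nonneg (neg_nonneg.2 hz.le) hrw, mul_pos hr hF0.1]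
  obtain ⟨hFq, hFr⟩ := hF0
  obtain ⟨hGq, hGr⟩ := hG0
  have iX : ori q r v * ori z w u - ori q r u * ori z w v
      = ori u v q * ori z w r - ori u v r * ori z w q := by unfold ori; ring
  have hX : 0 < ori q r v * ori z w u - ori q r u * ori z w v := by
    rw [iX]; nlinarith [mul_nonneg hGq.le hrf]
  have iXo : ori q r v * ori q r₀ u - ori q r u * ori q r₀ v = ori u v q * ori q r₀ r := by
    unfold ori; ring
  have hXo : 0 < ori q r v * ori q r₀ u - ori q r u * ori q r₀ v := by
    rw [iXo]; positivity
  have iN : (ori q r₀ v * ori z w u - ori q r₀ u * ori z w v)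
      = ori u v q * ori z w r₀ - ori z w q * ori u v r₀ := by unfold ori; ring
  have i1 : ori z w v * ori q r u - ori z w u * ori q r v
      = (ori z w v - ori z w u) * ori q r w + ori u v w * (ori q r w - ori q r z) := by
    unfold ori; ring
  have i2 : ori z w v * ori q r₀ u - ori z w u * ori q r₀ v
      = (ori z w v - ori z w u) * ori q r₀ z + ori u v z * (ori q r₀ w - ori q r₀ z) := by
    unfold ori; ring
  by_cases hN : ori q r₀ u < 0 ∧ 0 < ori q r₀ v * ori z w u - ori q r₀ u * ori z w v
  · obtain ⟨hou, hN⟩ := hN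
    right; left
    have hov : 0 < ori q r₀ v := by nlinarith
    have hGr0 : ori u v r₀ < 0 := by nlinarith
    refine ⟨⟨mul_neg_of_neg_of_pos hou hov, mul_neg_of_pos_of_neg hGq hGr0⟩, by linarith,
      by linarith, by nlinarith⟩
  · rcases lt_or_ge (ori z w u) 0 with hFu | hFu
    · right; right
      have hFv : 0 < ori z w v := by nlinarith
      have hGw : ori u v w < 0 := by
        by_contra h
        push Not at h
        have h6 := mul_nonneg h (sub_nonneg.2 (hAz.le.trans hrw))
        have h7 := mul_nonneg (sub_nonneg.2 (hFu.le.trans hFv.le)) hrw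
        linarith
      have hGz : 0 < ori u v z := by
        by_contra h
        push Not at h
        have hle : 0 ≤ ori z w v * ori q r₀ u - ori z w u * ori q r₀ v := by
          rcases lt_or_ge (ori q r₀ u) 0 with h1 | h1
          · by_contra h2
            exact hN ⟨h1, by linarith⟩
          · have e : -ori q r u * (ori z w v * ori q r₀ u - ori z w u * ori q r₀ v)
              = (ori q r v * ori z w u - ori q r u * ori z w v) * ori q r₀ u
                - (ori q r v * ori q r₀ u - ori q r u * ori q r₀ v) * ori z w u := by ring
            have h3 : 0 ≤ -ori q r u * (ori z w v * ori q r₀ u - ori z w u * ori q r₀ v) := by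
              rw [e]
              have h4 := mul_nonneg hX.le h1
              have h5 := mul_pos_of_neg_of_neg (neg_neg_of_pos hXo) hFu
              linarith
            exact nonneg_of_mul_nonneg_right h3 (by linarith)
        have h6 := mul_pos (sub_pos.2 (hFu.trans hFv)) (neg_pos.2 hz)
        have h7 := mul_nonneg (neg_nonneg.2 h) (sub_nonneg.2 (hz.le.trans hw.le))
        linarith
      exact ⟨mul_neg_of_neg_of_pos hFu hFv, mul_neg_of_pos_of_neg hGz hGw⟩
    · left
      refine ⟨?_, hFu⟩
      by_contra h
      push Not at h
      rcases h.eq_or_lt with h0 | h0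
      · linarith [hu0 h0]
      · apply hN
        refine ⟨h0, ?_⟩
        have e : -ori q r u * (ori q r₀ v * ori z w u - ori q r₀ u * ori z w v)
          = (ori q r v * ori q r₀ u - ori q r u * ori q r₀ v) * ori z w u
            - ori q r₀ u * (ori q r v * ori z w u - ori q r u * ori z w v) := by ring
        have : 0 < -ori q r u * (ori q r₀ v * ori z w u - ori q r₀ u * ori z w v) := by
          rw [e]
          have h1 := mul_nonneg hXo.le hFu
          have h2 := mul_pos_of_neg_of_neg h0 (neg_neg_of_pos hX)
          linarith
        exact (mul_pos_iff_of_pos_left (by linarith)).1 this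

theorem cross_region_sign {σ : ℝ} (hσ : σ = 1 ∨ σ = -1) {q r₀ z w r u v : Pt}
    (hf : Cross q r₀ z w) (hw : 0 < σ * ori q r₀ w)
    (hr : 0 < σ * ori q r₀ r) (hrf : 0 ≤ σ * ori z w r) (hrw : 0 ≤ σ * ori q r w)
    (hg : Cross q r u v) (hu : σ * ori q r u < 0)
    (hu0 : ori q r₀ u = 0 → σ * ori z w u < 0) :
    (0 < σ * ori q r₀ u ∧ 0 ≤ σ * ori z w u) ∨
      (Cross q r₀ u v ∧ ori u v q / (ori u v q - ori u v r₀)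
        < ori z w q / (ori z w q - ori z w r₀)) ∨ Cross z w u v := by
  rcases hσ with rfl | rfl
  · simp only [one_mul] at *
    rcases cross_region hf hw hr hrf hrw hg hu hu0 with h | ⟨h1, h2, h3, h4⟩ | h
    · exact Or.inl h
    · exact Or.inr (Or.inl ⟨h1, by rwa [div_lt_div_iff₀ h2 h3]⟩)
    · exact Or.inr (Or.inr h)
  · have := @cross_region (mir q) (mir r₀) (mir z) (mir w) (mir r) (mir u) (mir v)
      (cross_mir.2 hf)
    simp only [ori_mir, cross_mir] at this
    rcases this (by linarith) (by linarith) (by linarith) (by linarith) hg (by linarith)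
      (fun h => by have := hu0 (by linarith); linarith) with h | ⟨h1, h2, h3, h4⟩ | h
    · exact Or.inl ⟨by linarith, by linarith⟩
    · refine Or.inr (Or.inl ⟨h1, ?_⟩)
      rw [← neg_div_neg_eq, ← neg_div_neg_eq (ori z w q), div_lt_div_iff₀] <;> linarith
    · exact Or.inr (Or.inr h)

/-- A nonempty set of points on one side of `q r₀` has an angularly first element. -/
theorem exists_angle_min {σ : ℝ} {q r₀ : Pt} {A : Finset Pt} (hA : A.Nonempty)
    (hpos : ∀ x ∈ A, 0 < σ * ori q r₀ x) : ∃ r ∈ A, ∀ u ∈ A, 0 ≤ σ * ori q r u := by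
  obtain ⟨r, hr, hmax⟩ := A.exists_max_image (fun x =>
    ((x.1 - q.1) * (r₀.1 - q.1) + (x.2 - q.2) * (r₀.2 - q.2)) / (σ * ori q r₀ x)) hA
  refine ⟨r, hr, fun u hu => ?_⟩
  have h := hmax u hu
  have h1 := hpos r hr
  have h2 := hpos u hu
  rw [div_le_div_iff₀ h2 h1] at h
  have e : ((r.1 - q.1) * (r₀.1 - q.1) + (r.2 - q.2) * (r₀.2 - q.2)) * (σ * ori q r₀ u)
      - ((u.1 - q.1) * (r₀.1 - q.1) + (u.2 - q.2) * (r₀.2 - q.2)) * (σ * ori q r₀ r)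
      = ((r₀.1 - q.1) ^ 2 + (r₀.2 - q.2) ^ 2) * (σ * ori q r u) := by unfold ori; ring
  have h3 : 0 < (r₀.1 - q.1) ^ 2 + (r₀.2 - q.2) ^ 2 := by
    by_contra hn
    have h4 : (r₀.1 - q.1) = 0 := by nlinarith [sq_nonneg (r₀.1 - q.1), sq_nonneg (r₀.2 - q.2)]
    have h5 : (r₀.2 - q.2) = 0 := by nlinarith [sq_nonneg (r₀.1 - q.1), sq_nonneg (r₀.2 - q.2)]
    unfold ori at h1
    rw [h4, h5] at h1
    simp at h1
  exact nonneg_of_mul_nonneg_right (by linarith) h3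

theorem shoot_aux {V : Finset Pt} {H : Finset (Sym2 Pt)} (hV : GP V) (hH : PlaneOn V H)
    {q r₀ z w : Pt} (hq : q ∈ V) (hr₀ : r₀ ∈ V) (hzw : s(z, w) ∈ H) (hx : Cross q r₀ z w)
    (hmin : ∀ u v, s(u, v) ∈ H → Cross q r₀ u v → ori z w q / (ori z w q - ori z w r₀)
      ≤ ori u v q / (ori u v q - ori u v r₀)) {σ : ℝ} (hσ : σ = 1 ∨ σ = -1)
    (hw : 0 < σ * ori q r₀ w) :
    ∃ r ∈ V, 0 < σ * ori q r₀ r ∧ 0 ≤ σ * ori q r w ∧ Clear H q r := by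
  have hzV := hH.mem hzw
  have hwV := hH.mem_right hzw
  have hne := hH.ne hzw
  obtain ⟨r, hr, hrmin⟩ := exists_angle_min (σ := σ) (q := q) (r₀ := r₀)
    (A := V.filter fun x => 0 < σ * ori q r₀ x ∧ 0 ≤ σ * ori z w x)
    ⟨w, by simp [hwV, hw]⟩ (fun x hx => (Finset.mem_filter.1 hx).2.1)
  obtain ⟨hrV, hr1, hr2⟩ := Finset.mem_filter.1 hr
  have hrw := hrmin w (by simp [hwV, hw])
  refine ⟨r, hrV, hr1, hrw, ?_⟩
  have key : ∀ u v, s(u, v) ∈ H → Cross q r u v → ¬ σ * ori q r u < 0 := by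
    intro u v huv hg hu
    have huV := hH.mem huv
    have hr₀q : q ≠ r₀ := by rintro rfl; simp at hr1
    have hu0 : ori q r₀ u = 0 → σ * ori z w u < 0 := by
      intro h0
      have hur : u = r₀ := by
        by_contra hn
        refine hV q hq r₀ hr₀ u huV hr₀q ?_ (Ne.symm hn) h0
        rintro rfl
        simp at hu
      subst hur
      rcases hσ with rfl | rfl
      · linarith [(hx.signs (by linarith)).2.2]
      · linarith [(hx.signs' (by linarith)).2.2]
    rcases cross_region_sign hσ hx hw hr1 hr2 hrw hg hu hu0 with h | h | h
    · exact absurd (hrmin u (by simp [huV, h])) (not_le.2 hu)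
    · exact absurd (hmin u v huv h.1) (not_le.2 h.2)
    · exact hH.not_cross hzw huv h
  intro u v huv hg
  have h1 := key u v huv hg
  have h2 := key v u (by rwa [Sym2.eq_swap]) hg.swap_right
  have := hg.1
  rcases hσ with rfl | rfl <;> nlinarith

/-- If `q r₀` is crossed by edges of a plane graph, then one of these edges has, on each side,
between `q r₀` and its endpoint, a vertex visible from `q`. -/
theorem exists_shoot {V : Finset Pt} {H : Finset (Sym2 Pt)} (hV : GP V) (hH : PlaneOn V H)
    {q r₀ : Pt} (hq : q ∈ V) (hr₀ : r₀ ∈ V) (hx : ¬ Clear H q r₀) :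
    ∃ z w, s(z, w) ∈ H ∧ Cross q r₀ z w ∧ 0 < ori q r₀ w ∧ ori q r₀ z < 0 ∧
      (∃ r ∈ V, 0 < ori q r₀ r ∧ 0 ≤ ori q r w ∧ Clear H q r) ∧
      (∃ r ∈ V, ori q r₀ r < 0 ∧ ori q r z ≤ 0 ∧ Clear H q r) := by
  obtain ⟨⟨z, w⟩, hm, hmin⟩ := ((V ×ˢ V).filter fun e => s(e.1, e.2) ∈ H ∧
      Cross q r₀ e.1 e.2).exists_min_image (fun e => ori e.1 e.2 q / (ori e.1 e.2 q - ori e.1 e.2 r₀))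
    (by
      unfold Clear at hx
      push Not at hx
      obtain ⟨c, d, h1, h2⟩ := hx
      exact ⟨(c, d), by simp [hH.mem h1, hH.mem_right h1, h1, h2]⟩)
  obtain ⟨-, hzw, hc⟩ := Finset.mem_filter.1 hm
  have hmin' : ∀ u v, s(u, v) ∈ H → Cross q r₀ u v → ori z w q / (ori z w q - ori z w r₀)
      ≤ ori u v q / (ori u v q - ori u v r₀) := fun u v huv hu =>
    hmin (u, v) (by simp [hH.mem huv, hH.mem_right huv, huv, hu])
  have hwz : s(w, z) ∈ H := by rwa [Sym2.eq_swap]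
  have e : ori w z q / (ori w z q - ori w z r₀) = ori z w q / (ori z w q - ori z w r₀) := by
    rw [ori_swap z w q, ori_swap z w r₀, ← neg_div_neg_eq]; congr 1 <;> ring
  have hmin'' := hmin'
  rw [← e] at hmin''
  simp only at hzw hc
  rcases lt_or_ge 0 (ori q r₀ w) with h | h
  · have hz : ori q r₀ z < 0 := by nlinarith [hc.1]
    refine ⟨z, w, hzw, hc, h, hz, ?_, ?_⟩
    · simpa using shoot_aux hV hH hq hr₀ hzw hc hmin' (Or.inl rfl) (by simpa using h)
    · simpa using shoot_aux hV hH hq hr₀ hwz hc.swap_right hmin'' (Or.inr rfl) (by simpa using hz)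
  · have hz : 0 < ori q r₀ z := by nlinarith [hc.1]
    have h' : ori q r₀ w < 0 := by nlinarith [hc.1]
    refine ⟨w, z, hwz, hc.swap_right, hz, h', ?_, ?_⟩
    · simpa using shoot_aux hV hH hq hr₀ hwz hc.swap_right hmin'' (Or.inl rfl) (by simpa using hz)
    · simpa using shoot_aux hV hH hq hr₀ hzw hc hmin' (Or.inr rfl) (by simpa using h')

theorem PlaneOn.mono_set {V W : Finset Pt} {H : Finset (Sym2 Pt)} (h : PlaneOn V H)
    (hVW : V ⊆ W) : PlaneOn W H := ⟨fun e => hVW (h.mem e), h.ne, h.not_cross⟩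

/-- A segment crossing the side `a b` of a triangle without points of the segment inside leaves
through another side. -/
theorem Cross.exit_or {V : Finset Pt} (hV : GP V) {a b w c d : Pt} (ha : a ∈ V) (hb : b ∈ V)
    (hw : w ∈ V) (hc : c ∈ V) (hd : d ∈ V) (haw : a ≠ w) (hbw : b ≠ w) (hwc : w ≠ c)
    (hwd : w ≠ d) (hx : Cross c d a b) (h1 : ¬ InTri c a b w) (h2 : ¬ InTri d a b w) :
    Cross c d w a ∨ Cross c d w b := by
  obtain ⟨x1, x2⟩ := id hx
  have hca : c ≠ a := by rintro rfl; simp at x1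
  have hcb : c ≠ b := by rintro rfl; simp at x1
  have hda : d ≠ a := by rintro rfl; simp at x1
  have hdb : d ≠ b := by rintro rfl; simp at x1
  have hab : a ≠ b := by rintro rfl; simp at x2
  have hcd : c ≠ d := by rintro rfl; simp at x1
  have hwl : ori c d w ≠ 0 := hV c hc d hd w hw hcd hwc.symm hwd.symm
  by_cases h : 0 < ori c d w * ori c d a
  · exact Or.inr (hx.exit h (hV _ ha _ hb _ hw hab haw hbw) h1 h2
      (hV _ hb _ hw _ hc hbw hcb.symm hwc) (hV _ hb _ hw _ hd hbw hdb.symm hwd))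
  · have ha0 : ori c d a ≠ 0 := left_ne_zero_of_mul x1.ne
    have h' : ori c d w * ori c d a < 0 := lt_of_le_of_ne (not_lt.1 h) (mul_ne_zero hwl ha0)
    have h'' : 0 < ori c d w * ori c d b := by
      have := mul_pos_of_neg_of_neg h' x1
      have e : ori c d w * ori c d a * (ori c d a * ori c d b)
        = ori c d a ^ 2 * (ori c d w * ori c d b) := by ring
      rw [e] at this
      exact pos_of_mul_pos_right this (sq_nonneg _)
    exact Or.inl (hx.swap_right.exit h'' (hV _ hb _ ha _ hw hab.symm hbw haw)
      (fun hi => h1 hi.swap) (fun hi => h2 hi.swap)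
      (hV _ ha _ hw _ hc haw hca.symm hwc) (hV _ ha _ hw _ hd haw hda.symm hwd))

/-- The third side of an empty triangle with two clear sides is clear, up to edges at the apex. -/
theorem clear_of_emptyTri {V R : Finset Pt} (hV : GP V) (hRV : R ⊆ V) {H : Finset (Sym2 Pt)}
    (hH : PlaneOn R H) {q a b : Pt} (hq : q ∈ V) (ha : a ∈ V) (hb : b ∈ V) (hqa : q ≠ a)
    (hqb : q ≠ b) (h1 : Clear H q a) (h2 : Clear H q b) (he : EmptyTri R q a b)
    (hx : ∀ x, s(q, x) ∈ H → ¬ Cross q x a b) : Clear H a b := by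
  intro c d hcd hx'
  have hc := hH.mem hcd
  have hd := hH.mem_right hcd
  have hdc : s(d, c) ∈ H := by rwa [Sym2.eq_swap]
  have hqc : q ≠ c := by rintro rfl; exact hx d hcd hx'.symm
  have hqd : q ≠ d := by rintro rfl; exact hx c hdc hx'.symm.swap_left
  rcases hx'.symm.exit_or hV ha hb hq (hRV hc) (hRV hd) hqa.symm hqb.symm hqc hqd
    (fun h => he c hc h.rot.rot) (fun h => he d hd h.rot.rot) with h | h
  · exact h1 c d hcd h.symm
  · exact h2 c d hcd h.symm

/-- If `a`, `b` are visible from `p` and `c` is joined to them, with the two triangles empty, then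
only the edge `a b` can hide `c`. -/
theorem clear_of_two_emptyTri {V R : Finset Pt} (hV : GP V) (hRV : R ⊆ V) {H : Finset (Sym2 Pt)}
    (hH : PlaneOn R H) {p a b c : Pt} (hp : p ∈ V) (ha : a ∈ V) (hb : b ∈ V) (hc : c ∈ V)
    (hpa : p ≠ a) (hpb : p ≠ b) (hab : a ≠ b) (hca : c ≠ a) (hcb : c ≠ b)
    (h1 : Clear H p a) (h2 : Clear H p b) (h3 : Clear H a c) (h4 : Clear H b c)
    (he1 : EmptyTri R p a c) (he2 : EmptyTri R p b c)
    (hx : s(a, b) ∈ H → ¬ Cross a b p c) : Clear H p c := by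
  intro u v huv hx'
  have hu := hH.mem huv
  have hv := hH.mem_right huv
  have key : ∀ a, a ∈ V → p ≠ a → c ≠ a → Clear H p a → Clear H a c → EmptyTri R p a c →
      a = u ∨ a = v := by
    intro a ha hpa hca h1 h3 he1
    by_contra h
    push Not at h
    rcases hx'.symm.exit_or hV hp hc ha (hRV hu) (hRV hv) hpa hca h.1 h.2
      (fun h => he1 u hu h.swap.rot) (fun h => he1 v hv h.swap.rot) with h | h
    · exact h1.symm u v huv h.symm
    · exact h3 u v huv h.symm
  rcases key a ha hpa hca h1 h3 he1 with rfl | rfl <;>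
    rcases key b hb hpb hcb h2 h4 he2 with rfl | rfl
  · exact hab rfl
  · exact hx huv hx'.symm
  · exact hx (by rwa [Sym2.eq_swap]) hx'.symm.swap_left
  · exact hab rfl

/-- If there are vertices to the left of the line `q b`, then one of them is visible from `q`. -/
theorem exists_clear_left {V : Finset Pt} {H : Finset (Sym2 Pt)} (hV : GP V) (hH : PlaneOn V H)
    {q b v₀ : Pt} (hq : q ∈ V) (hv₀ : v₀ ∈ V) (hl : 0 < ori q b v₀) :
    ∃ r ∈ V, 0 < ori q b r ∧ Clear H q r := by
  by_cases hc : Clear H q v₀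
  · exact ⟨v₀, hv₀, hl, hc⟩
  obtain ⟨z, w, -, hx, hw, hz, ⟨r, hr, hr1, hr2, hr3⟩, ⟨t, ht, ht1, ht2, ht3⟩⟩ :=
    exists_shoot hV hH hq hv₀ hc
  have hF := (hx.signs hw).2.1
  by_cases hbw : 0 < ori q b w
  · refine ⟨r, hr, ?_, hr3⟩
    have := ori_pluecker q b v₀ r w
    have h1 := mul_nonneg hl.le hr2
    have h2 := mul_pos hbw hr1
    exact pos_of_mul_pos_left (b := ori q v₀ w) (by linarith) hw.le
  · have e : ori q v₀ w * ori q b z = ori q v₀ z * ori q b w + ori q b v₀ * ori z w q := by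
      unfold ori; ring
    have hbz : 0 < ori q b z := by
      have h1 := mul_nonneg_of_nonpos_of_nonpos hz.le (not_lt.1 hbw)
      have h2 := mul_pos hl hF
      exact pos_of_mul_pos_right (a := ori q v₀ w) (by linarith) hw.le
    refine ⟨t, ht, ?_, ht3⟩
    have := ori_pluecker q b v₀ t z
    have h1 := mul_nonneg hl.le (neg_nonneg.2 ht2)
    have h2 := mul_pos hbz (neg_pos.2 ht1)
    exact pos_of_mul_pos_left (b := -ori q v₀ z) (by linarith) (by linarith)

/-- The next visible vertex after the visible vertex `a`, in counterclockwise order around `q`. -/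
theorem exists_next {V : Finset Pt} {H : Finset (Sym2 Pt)} (hV : GP V) (hH : PlaneOn V H)
    {q a v₀ : Pt} (hq : q ∈ V) (ha : a ∈ V) (hqa : Clear H q a) (hv₀ : v₀ ∈ V)
    (hl : 0 < ori q a v₀) :
    ∃ b ∈ V, 0 < ori q a b ∧ Clear H q b ∧ EmptyTri V q a b ∧ Clear H a b := by
  obtain ⟨r, hr, hr1, hr2⟩ := exists_clear_left hV hH hq hv₀ hl
  obtain ⟨b, hb, hmin⟩ := exists_angle_min (σ := 1) (q := q) (r₀ := a)
    (A := V.filter fun x => 0 < ori q a x ∧ Clear H q x) ⟨r, by simp [hr, hr1, hr2]⟩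
    (fun x hx => by simpa using (Finset.mem_filter.1 hx).2.1)
  obtain ⟨hbV, hb1, hb2⟩ := Finset.mem_filter.1 hb
  have hmin' : ∀ u ∈ V, 0 < ori q a u → Clear H q u → 0 ≤ ori q b u := fun u h1 h2 h3 => by
    simpa using hmin u (by simp [h1, h2, h3])
  have hqa' : q ≠ a := by rintro rfl; simp at hb1
  have hqb : q ≠ b := by rintro rfl; simp at hb1
  have he : EmptyTri V q a b := by
    intro x hx hi
    have side : ∀ a ∈ V, q ≠ a → ∀ c ∈ V, ori q a c = 0 → c = q ∨ c = a := by
      intro a ha hqa c hc h0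
      by_contra hn
      push Not at hn
      exact hV q hq a ha c hc hqa hn.1.symm hn.2.symm h0
    obtain ⟨c, hc, hci, hcc⟩ := exists_clear_in_tri (R := V) (H := H) (fun c d h => hH.mem h)
      (q := q) (a := a) (b := b)
      (fun c hc h0 => by rcases side a ha hqa' c hc h0 with rfl | rfl <;> simp)
      (fun c hc h0 => by rcases side b hbV hqb c hc h0 with rfl | rfl <;> simp)
      hqa hb2 ⟨x, hx, hi⟩
    obtain ⟨h1, h2, h3⟩ := (inTri_iff_of_pos hb1).1 hci
    have := hmin' c hc h1 hcc
    rw [ori_swap q b c] at h3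
    linarith
  have hno : ∀ x, s(q, x) ∈ H → ¬ Cross q x a b := by
    intro x hx ⟨c1, c2⟩
    have hxV := hH.mem_right hx
    rw [ori_swap' q a x, ori_swap' q b x] at c1
    have e1 := ori_add a b q x
    rw [ori_swap q b x, ori_rot q a b] at e1
    rw [ori_rot q a b] at c2
    have h1 : ori a b x < 0 := by nlinarith
    by_cases h2 : 0 < ori q a x
    · have := hmin' x hxV h2 (hH.clear hx)
      nlinarith
    · nlinarith
  exact ⟨b, hbV, hb1, hb2, he, clear_of_emptyTri hV le_rfl hH hq ha hbV hqa' hqb hqa hb2 he hno⟩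

/-- `T` is a maximal plane graph on `R`. -/
structure IsMaxPlane (R : Finset Pt) (T : Finset (Sym2 Pt)) : Prop extends PlaneOn R T where
  maximal : ∀ {a b}, a ∈ R → b ∈ R → a ≠ b → Clear T a b → s(a, b) ∈ T

/-- In a triangulation, an edge with points to its left has an empty triangle to its left. -/
theorem IsMaxPlane.exists_apex {R : Finset Pt} {T : Finset (Sym2 Pt)} (hR : GP R)
    (hT : IsMaxPlane R T) {a b v₀ : Pt} (hab : s(a, b) ∈ T) (hv₀ : v₀ ∈ R)
    (hl : 0 < ori a b v₀) :
    ∃ c ∈ R, 0 < ori a b c ∧ s(a, c) ∈ T ∧ s(b, c) ∈ T ∧ EmptyTri R a b c := by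
  have ha := hT.mem hab
  have hb := hT.mem_right hab
  obtain ⟨c, hc, h1, h2, h3, h4⟩ := exists_next hR hT.toPlaneOn ha hb (hT.clear hab) hv₀ hl
  exact ⟨c, hc, h1, hT.maximal ha hc (by rintro rfl; simp at h1) h2,
    hT.maximal hb hc (by rintro rfl; simp at h1) h4, h3⟩

theorem exists_pos_of_inTri {p a b c x y : Pt} (h : InTri p a b c) (hxy : ori x y p = 0)
    (hne : ¬ (ori x y a = 0 ∧ ori x y b = 0)) :
    0 < ori x y a ∨ 0 < ori x y b ∨ 0 < ori x y c := by
  by_contra hn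
  push Not at hn
  obtain ⟨h1, h2, h3⟩ := hn
  have e : ori b c p * ori x y a + ori c a p * ori x y b + ori a b p * ori x y c
      = ori a b c * ori x y p := by unfold ori; ring
  rw [hxy, mul_zero] at e
  apply hne
  rcases h with ⟨g1, g2, g3⟩ | ⟨g1, g2, g3⟩
  · have k1 := mul_nonneg g2.le (neg_nonneg.2 h1)
    have k2 := mul_nonneg g3.le (neg_nonneg.2 h2)
    have k3 := mul_nonneg g1.le (neg_nonneg.2 h3)
    constructor
    · exact (mul_eq_zero.1 (by linarith : ori b c p * ori x y a = 0)).resolve_left g2.ne'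
    · exact (mul_eq_zero.1 (by linarith : ori c a p * ori x y b = 0)).resolve_left g3.ne'
  · have k1 := mul_nonneg (neg_nonneg.2 g2.le) (neg_nonneg.2 h1)
    have k2 := mul_nonneg (neg_nonneg.2 g3.le) (neg_nonneg.2 h2)
    have k3 := mul_nonneg (neg_nonneg.2 g1.le) (neg_nonneg.2 h3)
    constructor
    · exact (mul_eq_zero.1 (by linarith : ori b c p * ori x y a = 0)).resolve_left g2.ne
    · exact (mul_eq_zero.1 (by linarith : ori c a p * ori x y b = 0)).resolve_left g3.ne

theorem exists_pos_of_inTri' {p a b c x y : Pt} (h : InTri p a b c) (hxy : 0 < ori x y p) :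
    0 < ori x y a ∨ 0 < ori x y b ∨ 0 < ori x y c := by
  by_contra hn
  push Not at hn
  obtain ⟨h1, h2, h3⟩ := hn
  have e : ori b c p * ori x y a + ori c a p * ori x y b + ori a b p * ori x y c
      = ori a b c * ori x y p := by unfold ori; ring
  have := ori_add a b c p
  rcases h with ⟨g1, g2, g3⟩ | ⟨g1, g2, g3⟩
  · have k1 := mul_nonneg g2.le (neg_nonneg.2 h1)
    have k2 := mul_nonneg g3.le (neg_nonneg.2 h2)
    have k3 := mul_nonneg g1.le (neg_nonneg.2 h3)
    have k4 := mul_pos (by linarith : 0 < ori a b c) hxy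
    linarith
  · have k1 := mul_nonneg (neg_nonneg.2 g2.le) (neg_nonneg.2 h1)
    have k2 := mul_nonneg (neg_nonneg.2 g3.le) (neg_nonneg.2 h2)
    have k3 := mul_nonneg (neg_nonneg.2 g1.le) (neg_nonneg.2 h3)
    have k4 := mul_neg_of_neg_of_pos (by linarith : ori a b c < 0) hxy
    linarith

/-- Around every line through a point inside a triangle there is a corner on the left. -/
theorem exists_left_of_inTri {V : Finset Pt} (hV : GP V) {p a o₁ o₂ o₃ : Pt} (hp : p ∈ V)
    (ha : a ∈ V) (hpa : p ≠ a) (h1 : o₁ ∈ V) (h2 : o₂ ∈ V) (h3 : o₃ ∈ V)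
    (h : InTri p o₁ o₂ o₃) : ∃ v ∈ V, 0 < ori p a v := by
  have hp1 : p ≠ o₁ := by rintro rfl; simp [InTri] at h
  have hp2 : p ≠ o₂ := by rintro rfl; simp [InTri] at h
  have h12 : o₁ ≠ o₂ := by rintro rfl; simp [InTri] at h
  rcases exists_pos_of_inTri h (x := p) (y := a) (by simp) (fun ⟨e1, e2⟩ => by
    by_cases ha1 : a = o₁
    · exact hV p hp a ha o₂ h2 hpa hp2 (ha1 ▸ h12) e2
    · exact hV p hp a ha o₁ h1 hpa hp1 ha1 e1) with h | h | h
  exacts [⟨_, h1, h⟩, ⟨_, h2, h⟩, ⟨_, h3, h⟩]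

/-- A triangle spanned by an inner point and a side lies inside the triangle. -/
theorem InTri.sub {r p a b c : Pt} (hr : InTri r p a b) (hp : InTri p a b c) : InTri r a b c := by
  have e1 : ori p a b * ori b c r = ori a b r * ori b c p + ori b p r * ori a b c := by
    unfold ori; ring
  have e2 : ori p a b * ori c a r = ori a b r * ori c a p + ori p a r * ori a b c := by
    unfold ori; ring
  have e3 := ori_add a b c p
  have e4 := ori_add p a b r
  have e5 : ori a b p = ori p a b := ori_rot _ _ _
  rcases hr with ⟨g1, g2, g3⟩ | ⟨g1, g2, g3⟩ <;> rcases hp with ⟨k1, k2, k3⟩ | ⟨k1, k2, k3⟩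
  · have n1 := mul_pos g2 k2
    have n2 := mul_pos g2 k3
    have n3 := mul_pos g3 (by linarith : 0 < ori a b c)
    have n4 := mul_pos g1 (by linarith : 0 < ori a b c)
    exact Or.inl ⟨g2, pos_of_mul_pos_right (a := ori p a b) (by linarith) (by linarith),
      pos_of_mul_pos_right (a := ori p a b) (by linarith) (by linarith)⟩
  · linarith
  · linarith
  · have n1 := mul_pos_of_neg_of_neg g2 k2
    have n2 := mul_pos_of_neg_of_neg g2 k3
    have n3 := mul_pos_of_neg_of_neg g3 (by linarith : ori a b c < 0)
    have n4 := mul_pos_of_neg_of_neg g1 (by linarith : ori a b c < 0)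
    exact Or.inr ⟨g2, neg_of_mul_pos_right (a := ori p a b) (by linarith) (by linarith),
      neg_of_mul_pos_right (a := ori p a b) (by linarith) (by linarith)⟩

/-- The face of a triangulation containing a point `p` of the hull triangle. -/
theorem IsMaxPlane.exists_face {V : Finset Pt} (hV : GP V) {p : Pt} (hp : p ∈ V)
    {T : Finset (Sym2 Pt)} (hT : IsMaxPlane (V.erase p) T) {o₁ o₂ o₃ : Pt}
    (h1 : o₁ ∈ V) (h2 : o₂ ∈ V) (h3 : o₃ ∈ V) (h : InTri p o₁ o₂ o₃) :
    ∃ a b c, a ∈ V.erase p ∧ b ∈ V.erase p ∧ c ∈ V.erase p ∧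
      (0 < ori p a b ∧ 0 < ori p b c ∧ 0 < ori p c a) ∧ s(a, b) ∈ T ∧ s(b, c) ∈ T ∧
      s(c, a) ∈ T ∧ EmptyTri (V.erase p) a b c ∧ Clear T p a ∧ Clear T p b ∧ Clear T p c := by
  have hTV : PlaneOn V T := hT.mono_set (Finset.erase_subset _ _)
  have hTp : ∀ x, s(p, x) ∉ T := fun x hx => by simpa using hT.mem hx
  have hRV := Finset.erase_subset p V
  have hp1 : p ≠ o₁ := by rintro rfl; simp [InTri] at h
  obtain ⟨v, hv, hv1⟩ := exists_left_of_inTri hV hp h1 hp1 h1 h2 h3 h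
  obtain ⟨a, ha, ha1, hpa⟩ := exists_clear_left hV hTV hp hv hv1
  have hpa' : p ≠ a := by rintro rfl; simp at ha1
  obtain ⟨v, hv, hv1⟩ := exists_left_of_inTri hV hp ha hpa' h1 h2 h3 h
  obtain ⟨b, hb, hb1, hpb, hab, -⟩ := exists_next hV hTV hp ha hpa hv hv1
  have hpb' : p ≠ b := by rintro rfl; simp at hb1
  have hab' : a ≠ b := by rintro rfl; simp at hb1
  have haR : a ∈ V.erase p := by simp [ha, hpa'.symm]
  have hbR : b ∈ V.erase p := by simp [hb, hpb'.symm]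
  have habT : s(a, b) ∈ T := hT.maximal haR hbR hab' (clear_of_emptyTri hV hRV hT.toPlaneOn hp ha
    hb hpa' hpb' hpa hpb (fun r hr => hab r (hRV hr)) fun x hx => absurd hx (hTp x))
  have hl : 0 < ori a b p := by rwa [ori_rot]
  have hex : ∃ v ∈ V.erase p, 0 < ori a b v := by
    have hp2 : p ≠ o₂ := by rintro rfl; simp [InTri] at h
    have hp3 : p ≠ o₃ := by rintro rfl; simp [InTri] at h
    rcases exists_pos_of_inTri' h hl with h' | h' | h'
    exacts [⟨o₁, by simp [h1, hp1.symm], h'⟩, ⟨o₂, by simp [h2, hp2.symm], h'⟩,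
      ⟨o₃, by simp [h3, hp3.symm], h'⟩]
  obtain ⟨v, hv, hv1⟩ := hex
  obtain ⟨c, hc, hc1, hacT, hbcT, habc⟩ := hT.exists_apex (hV.mono hRV) habT hv hv1
  have hcV := hRV hc
  have hpc' : p ≠ c := by rintro rfl; simp at hc
  have hca' : c ≠ a := by rintro rfl; simp at hc1
  have hcb' : c ≠ b := by rintro rfl; simp at hc1
  have e1 := ori_add p a b c
  have npa := hV p hp a ha c hcV hpa' hpc' hca'.symm
  have npb := hV p hp b hb c hcV hpb' hpc' hcb'.symm
  have eb : ori b p c = - ori p b c := ori_swap _ _ _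
  have ea : ori p c a = - ori p a c := ori_swap' _ _ _
  have ec : ori a c b = - ori a b c := ori_swap' _ _ _
  have ec' : ori a c p = ori p a c := ori_rot _ _ _
  have eb' : ori b c p = ori p b c := ori_rot _ _ _
  have ec'' : ori b c a = ori a b c := ori_rot _ _ _
  have hbc : 0 < ori p b c := by
    by_contra hn
    have hn : ori p b c < 0 := lt_of_le_of_ne (not_lt.1 hn) npb
    rcases lt_or_gt_of_ne npa with h' | h'
    · refine hpa b c hbcT ⟨mul_neg_of_pos_of_neg hb1 h', ?_⟩
      rw [eb', ec'']
      exact mul_neg_of_neg_of_pos hn hc1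
    · exact hab c hcV ((inTri_iff_of_pos hb1).2 ⟨h', hc1, by linarith⟩)
  have hca : 0 < ori p c a := by
    by_contra hn
    have hn : 0 < ori p a c := lt_of_le_of_ne (by linarith) npa.symm
    refine hpb a c hacT ⟨?_, ?_⟩
    · rw [ori_swap' p a b]
      exact mul_neg_of_neg_of_pos (by linarith) hbc
    · rw [ec', ec]
      exact mul_neg_of_pos_of_neg hn (by linarith)
  have hi : InTri p a b c := Or.inl ⟨hl, by rwa [eb'], by rwa [ori_rot]⟩
  have sub : ∀ x y, (x = a ∨ x = b) → y = c → EmptyTri (V.erase p) p x y := by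
    rintro x y (rfl | rfl) rfl r hr hri
    · exact habc r hr (hri.swap.rot.sub hi.rot.rot).rot
    · exact habc r hr (hri.sub hi.rot).rot.rot
  refine ⟨a, b, c, haR, hbR, hc, ⟨hb1, hbc, hca⟩, habT, hbcT, by rwa [Sym2.eq_swap], habc, hpa,
    hpb, ?_⟩
  refine clear_of_two_emptyTri hV hRV hT.toPlaneOn hp ha hb hcV hpa' hpb' hab' hca' hcb' hpa hpb
    (hT.clear hacT) (hT.clear hbcT) (sub a c (Or.inl rfl) rfl) (sub b c (Or.inr rfl) rfl) ?_
  rintro - ⟨g, -⟩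
  nlinarith

/-- The determinant expressing the position of the lift of `b` relative to the plane through the
lifts of `u`, `v`, `a`, where `ω` gives the heights. -/
def liftDet (ω : Pt → ℝ) (u v a b : Pt) : ℝ :=
  ω a * ori u v b - ω b * ori u v a + ω u * ori a b v - ω v * ori a b u

/-- The segment `u v` crosses `a b`, and its lift passes below the lift of `a b`. -/
def Low (ω : Pt → ℝ) (u v a b : Pt) : Prop :=
  Cross u v a b ∧ 0 < (ori u v b - ori u v a) * liftDet ω u v a b

theorem Low.swap_left {ω : Pt → ℝ} {u v a b : Pt} (h : Low ω u v a b) : Low ω v u a b := by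
  refine ⟨h.1.swap_left, ?_⟩
  have : (ori v u b - ori v u a) * liftDet ω v u a b
      = (ori u v b - ori u v a) * liftDet ω u v a b := by
    unfold liftDet
    rw [ori_swap u v a, ori_swap u v b]; ring
  rw [this]; exact h.2

theorem Low.swap_right {ω : Pt → ℝ} {u v a b : Pt} (h : Low ω u v a b) : Low ω u v b a := by
  refine ⟨h.1.swap_right, ?_⟩
  have : (ori u v a - ori u v b) * liftDet ω u v b a
      = (ori u v b - ori u v a) * liftDet ω u v a b := by
    unfold liftDet
    rw [ori_swap a b u, ori_swap a b v]; ring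
  rw [this]; exact h.2

theorem Low.or_symm {ω : Pt → ℝ} {u v a b : Pt} (h : Cross u v a b)
    (h0 : liftDet ω u v a b ≠ 0) : Low ω u v a b ∨ Low ω a b u v := by
  have e : (ori a b v - ori a b u) * liftDet ω a b u v
      = - ((ori u v b - ori u v a) * liftDet ω u v a b) := by
    unfold liftDet ori; ring
  have hD : ori u v b - ori u v a ≠ 0 := by
    intro h1
    have := h.1
    rw [sub_eq_zero.1 h1] at this
    nlinarith
  rcases lt_or_gt_of_ne (mul_ne_zero hD h0) with h1 | h1
  · exact Or.inr ⟨h.symm, by linarith⟩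
  · exact Or.inl ⟨h, h1⟩

theorem liftDet_add_affine (ω : Pt → ℝ) (α β γ : ℝ) (x y u v a b : Pt) (u' v' : Pt) :
    liftDet (fun z => ω z + α + β * ori u' v' z + γ * ori x y z) u v a b
      = liftDet ω u v a b := by
  unfold liftDet ori; ring

/-- An affine change of the heights levels both of two crossing segments. -/
theorem Cross.exists_level {u v a b : Pt} (h : Cross u v a b) (ω : Pt → ℝ) :
    ∃ h : Pt → ℝ, (∀ x y z w, liftDet h x y z w = liftDet ω x y z w) ∧
      h u = 0 ∧ h v = 0 ∧ h b = h a := by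
  have hD : ori u v b - ori u v a ≠ 0 := by
    intro h1
    have := h.1
    rw [sub_eq_zero.1 h1] at this
    nlinarith
  have hD' : ori a b v - ori a b u ≠ 0 := by
    intro h1
    have := h.2
    rw [sub_eq_zero.1 h1] at this
    nlinarith
  refine ⟨fun z => ω z + (- ω u + (ω v - ω u) / (ori a b v - ori a b u) * ori a b u)
    + (-(ω b - ω a) / (ori u v b - ori u v a)) * ori u v z
    + (-(ω v - ω u) / (ori a b v - ori a b u)) * ori a b z,
    fun x y z w => liftDet_add_affine _ _ _ _ _ _ _ _ _ _ _ _, ?_, ?_, ?_⟩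
  · simp only [ori_self_mid]; ring
  · simp only [ori_self_right]; field_simp; ring
  · simp only [ori_self_mid, ori_self_right]; field_simp; ring

theorem low_of_level {h ω : Pt → ℝ} (hω : ∀ x y z w, liftDet h x y z w = liftDet ω x y z w)
    {u v x y : Pt} (hu : h u = 0) (hv : h v = 0) (hx : 0 < h x) (hy : 0 < h y)
    (hc : Cross u v x y) : Low ω u v x y := by
  refine ⟨hc, ?_⟩
  rw [← hω]
  unfold liftDet
  rw [hu, hv]
  have := hc.1
  rcases lt_or_ge (ori u v x) 0 with h1 | h1
  · have h2 : 0 < ori u v y := by nlinarith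
    apply mul_pos (by linarith)
    nlinarith [mul_pos hx h2, mul_pos hy (neg_pos.2 h1)]
  · have h2 : ori u v y < 0 := by nlinarith
    apply mul_pos_of_neg_of_neg (by linarith)
    nlinarith [mul_pos hx (neg_pos.2 h2), mul_nonneg hy.le h1]

/-- Heights are generic, and lower inside every triangle than the interpolation of its corners. -/
structure ConvexLift (R : Finset Pt) (ω : Pt → ℝ) : Prop where
  below : ∀ r ∈ R, ∀ a ∈ R, ∀ b ∈ R, ∀ c ∈ R, InTri r a b c →
    0 < ori a b c * liftDet ω a b c r
  generic : ∀ u ∈ R, ∀ v ∈ R, ∀ a ∈ R, ∀ b ∈ R, Cross u v a b → liftDet ω u v a b ≠ 0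


theorem emptyTri_of_cross_aux {R : Finset Pt} (hR : GP R) {a b c d : Pt} (ha : a ∈ R) (hb : b ∈ R)
    (hx : Cross c d a b) (hc : 0 < ori a b c) (h1 : EmptyTri R a b c) (h2 : EmptyTri R a b d) :
    EmptyTri R c d a := by
  intro r hr hin
  have hd : ori a b d < 0 := by nlinarith [hx.2]
  obtain ⟨-, k1, k2⟩ := hx.symm.signs' hd
  have hsum := ori_add c d a r
  have e1 : ori a c r * ori c d b + ori c d r * ori a b c = ori c d a * ori b c r := by
    unfold ori; ring
  have e2 : - (ori d a r * ori c d b) + ori c d r * ori a b d = ori c d a * ori b d r := by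
    unfold ori; ring
  have e3 : ori c a r = - ori a c r := ori_swap _ _ _
  rcases hin with ⟨g1, g2, g3⟩ | ⟨g1, g2, g3⟩
  · linarith
  have n1 := mul_neg_of_neg_of_pos g3 k2
  have n2 := mul_neg_of_neg_of_pos g1 hc
  have n3 := mul_neg_of_neg_of_pos g2 k2
  have n4 := mul_pos_of_neg_of_neg g1 hd
  have m1 : 0 < ori b c r := by
    by_contra hn
    have := mul_nonneg_of_nonpos_of_nonpos k1.le (not_lt.1 hn)
    linarith
  have m2 : ori b d r < 0 := by
    by_contra hn
    have := mul_nonpos_of_nonpos_of_nonneg k1.le (not_lt.1 hn)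
    linarith
  have hab : a ≠ b := by rintro rfl; simp at hc
  have har : a ≠ r := by rintro rfl; simp at g3
  have hbr : b ≠ r := by rintro rfl; simp at m1
  rcases lt_or_gt_of_ne (hR a ha b hb r hr hab har hbr) with h | h
  · exact h2 r hr (Or.inr ⟨h, m2, g2⟩)
  · exact h1 r hr (Or.inl ⟨h, m1, by linarith⟩)

/-- The triangles on the other diagonal of a convex quadrilateral are covered by the triangles
on the first diagonal. -/
theorem emptyTri_of_cross {R : Finset Pt} (hR : GP R) {a b c d : Pt} (ha : a ∈ R) (hb : b ∈ R)
    (hx : Cross c d a b) (h1 : EmptyTri R a b c) (h2 : EmptyTri R a b d) : EmptyTri R c d a := by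
  rcases lt_or_ge 0 (ori a b c) with hc | hc
  · exact emptyTri_of_cross_aux hR ha hb hx hc h1 h2
  · have hd : 0 < ori a b d := by nlinarith [hx.2]
    exact (emptyTri_of_cross_aux hR ha hb hx.swap_left hd h2 h1).swap

theorem below_reflex {h : Pt → ℝ} {a b c d : Pt} {g : ℝ} (hc : 0 < ori a b c) (hd : ori a b d < 0)
    (hcd : 0 < ori c d a) (ha : h a = g) (hb : h b = g) (hcg : h c ≤ g) (hdg : h d ≤ g) :
    InTri a b c d ∧ ori b c d * liftDet h b c d a ≤ 0 := by
  have e1 : ori b c a = ori a b c := ori_rot _ _ _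
  have e2 : ori d b a = - ori a b d := by unfold ori; ring
  have e3 : ori d a c = ori c d a := by unfold ori; ring
  have e4 : ori d a b = ori a b d := by unfold ori; ring
  have e5 := ori_add b c d a
  refine ⟨Or.inl ⟨by linarith, hcd, by linarith⟩, ?_⟩
  apply mul_nonpos_of_nonneg_of_nonpos (by linarith)
  have : liftDet h b c d a = (h d - g) * ori a b c - (h c - g) * ori a b d := by
    unfold liftDet
    rw [ha, hb, e3, e4, ← e5, e1, e2]; ring
  rw [this]
  nlinarith [mul_nonneg (sub_nonneg.2 hdg) hc.le, mul_nonneg (sub_nonneg.2 hcg) (neg_nonneg.2 hd.le)]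

theorem IsMaxPlane.flip_aux {R : Finset Pt} (hR : GP R) {ω : Pt → ℝ} (hω : ConvexLift R ω)
    {T : Finset (Sym2 Pt)} (hT : IsMaxPlane R T) {u v a b : Pt} (hu : u ∈ R)
    (hv : v ∈ R) (hab : s(a, b) ∈ T) (hlow : Low ω u v a b)
    (hmax : ∀ x y, s(x, y) ∈ T → Cross u v x y → liftDet ω u v x y / (ori u v y - ori u v x)
      ≤ liftDet ω u v a b / (ori u v b - ori u v a)) (hpos : 0 < ori a b u) :
    ∃ c ∈ R, ∃ d ∈ R, s(a, c) ∈ T ∧ s(a, d) ∈ T ∧ s(b, c) ∈ T ∧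
      s(b, d) ∈ T ∧ Low ω c d a b ∧ EmptyTri R c d a ∧ EmptyTri R c d b ∧
      ∀ x y, s(x, y) ∈ T → Cross c d x y → s(x, y) = s(a, b) := by
  have ha := hT.mem hab
  have hb := hT.mem_right hab
  have hba : s(b, a) ∈ T := by rwa [Sym2.eq_swap]
  have hneg : ori a b v < 0 := by nlinarith [hlow.1.2]
  obtain ⟨c, hc, hc1, hac, hbc, hce⟩ := hT.exists_apex hR hab hu hpos
  obtain ⟨d, hd, hd1, hbd, had, hde⟩ := hT.exists_apex hR hba hv
    (by rw [ori_swap]; linarith)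
  have hd1' : ori a b d < 0 := by rw [ori_swap] at hd1; linarith
  have hde' : EmptyTri R a b d := hde.swap
  obtain ⟨h, hh, hhu, hhv, hhab⟩ := hlow.1.exists_level ω
  set g := h a with hg
  have hD : ori u v b - ori u v a ≠ 0 := fun h0 => by simpa [h0] using hlow.2
  have hgap : liftDet ω u v a b / (ori u v b - ori u v a) = g := by
    rw [← hh, div_eq_iff hD]; unfold liftDet; rw [hhu, hhv, hhab]; ring
  have hg0 : 0 < g := by
    have h2 := hlow.2
    rw [(div_eq_iff hD).1 hgap] at h2
    have : 0 < g * (ori u v b - ori u v a) ^ 2 := by nlinarith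
    exact pos_of_mul_pos_left this (sq_nonneg _)
  have key : ∀ x y, s(x, y) ∈ T → Cross u v x y → h y = g → h x ≤ g := by
    intro x y hxy hx hy
    have h1 := hmax x y hxy hx
    rw [hgap, ← hh] at h1
    unfold liftDet at h1
    rw [hhu, hhv, hy] at h1
    rcases lt_or_ge (ori u v x) 0 with h2 | h2
    · have h3 : 0 < ori u v y := by nlinarith [hx.1]
      rw [div_le_iff₀ (by linarith)] at h1
      by_contra hn
      nlinarith
    · have h3 : ori u v y < 0 := by nlinarith [hx.1]
      rw [div_le_iff_of_neg (by linarith)] at h1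
      by_contra hn
      nlinarith
  have hle : ∀ w ∈ R, s(a, w) ∈ T → s(b, w) ∈ T → EmptyTri R a b w → h w ≤ g := by
    intro w hw haw hbw he
    by_cases hwu : w = u
    · rw [hwu, hhu]; exact hg0.le
    by_cases hwv : w = v
    · rw [hwv, hhv]; exact hg0.le
    rcases Cross.exit_or hR ha hb hw hu hv (hT.ne haw) (hT.ne hbw) hwu hwv hlow.1
      (he u hu) (he v hv) with hx | hx
    · exact key w a (by rwa [Sym2.eq_swap]) hx rfl
    · exact key w b (by rwa [Sym2.eq_swap]) hx hhab
  have hcg := hle c hc hac hbc hce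
  have hdg := hle d hd had hbd hde'
  have hcd : c ≠ d := by rintro rfl; linarith
  have e0 : ori c d a - ori c d b = ori a b d - ori a b c := by unfold ori; ring
  have hx : Cross c d a b := by
    refine ⟨?_, by nlinarith⟩
    by_contra hn
    rw [not_lt] at hn
    have n1 := hR c hc d hd a ha hcd (hT.ne hac).symm (hT.ne had).symm
    have n2 := hR c hc d hd b hb hcd (hT.ne hbc).symm (hT.ne hbd).symm
    rcases lt_or_gt_of_ne n1 with h1 | h1
    · have h2 : ori c d b < 0 := by
        rcases lt_or_gt_of_ne n2 with h2 | h2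
        · exact h2
        · nlinarith
      obtain ⟨k1, k2⟩ := below_reflex (h := h) (a := b) (b := a) (c := d) (d := c) (g := g)
        hd1 (by rw [ori_swap]; linarith) (by rw [ori_swap]; linarith) hhab rfl hdg hcg
      rw [hh] at k2
      exact absurd (hω.below b hb a ha d hd c hc k1) (not_lt.2 k2)
    · obtain ⟨k1, k2⟩ := below_reflex (h := h) (a := a) (b := b) (c := c) (d := d) (g := g)
        hc1 hd1' h1 rfl hhab hcg hdg
      rw [hh] at k2
      exact absurd (hω.below a ha b hb c hc d hd k1) (not_lt.2 k2)
  have hne := hω.generic c hc d hd a ha b hb hx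
  have hL : Low ω c d a b := by
    refine ⟨hx, lt_of_le_of_ne ?_ (mul_ne_zero (by linarith) hne).symm⟩
    rw [← hh]
    apply mul_nonneg (by linarith)
    unfold liftDet
    rw [hhab]
    nlinarith [mul_nonneg (sub_nonneg.2 hdg) hc1.le,
      mul_nonneg (sub_nonneg.2 hcg) (neg_nonneg.2 hd1'.le)]
  have E1 := emptyTri_of_cross hR ha hb hx hce hde'
  have E2 := emptyTri_of_cross hR hb ha hx.swap_right hce.swap hde
  refine ⟨c, hc, d, hd, hac, had, hbc, hbd, hL, E1, E2, ?_⟩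
  have hP : PlaneOn R (T.erase s(a, b)) := hT.toPlaneOn.mono (Finset.erase_subset _ _)
  have cl : ∀ x y, s(x, y) ∈ T → Clear (T.erase s(a, b)) x y := fun x y hxy =>
    (hT.clear hxy).mono (Finset.erase_subset _ _)
  have := clear_of_two_emptyTri hR subset_rfl hP hc ha hb hd (hT.ne hac).symm (hT.ne hbc).symm
    (hT.ne hab) (hT.ne had).symm (hT.ne hbd).symm (cl a c hac).symm (cl b c hbc).symm
    (cl a d had) (cl b d hbd) E1.rot.rot.swap E2.rot.rot.swap
    (fun hm => absurd hm (Finset.notMem_erase _ _))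
  intro x y hxy hxc
  by_contra hn
  exact this x y (Finset.mem_erase.2 ⟨hn, hxy⟩) hxc

/-- A segment compatible with `H` lying below an edge of the triangulation `T` yields a flip
lowering `T`. -/
theorem IsMaxPlane.exists_flip {R : Finset Pt} (hR : GP R) {ω : Pt → ℝ} (hω : ConvexLift R ω)
    {T H : Finset (Sym2 Pt)} (hT : IsMaxPlane R T) {u v a₀ b₀ : Pt} (hu : u ∈ R)
    (hv : v ∈ R) (huv : Clear H u v) (hab₀ : s(a₀, b₀) ∈ T) (hlow : Low ω u v a₀ b₀) :
    ∃ a b c d, s(a, b) ∈ T ∧ s(a, b) ∉ H ∧ c ∈ R ∧ d ∈ R ∧ s(a, c) ∈ T ∧ s(a, d) ∈ T ∧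
      s(b, c) ∈ T ∧ s(b, d) ∈ T ∧ Low ω c d a b ∧ EmptyTri R c d a ∧ EmptyTri R c d b ∧
      ∀ x y, s(x, y) ∈ T → Cross c d x y → s(x, y) = s(a, b) := by
  have hne : ((R ×ˢ R).filter fun z => s(z.1, z.2) ∈ T ∧ Cross u v z.1 z.2).Nonempty :=
    ⟨(a₀, b₀), by simp [hab₀, hlow.1, hT.mem hab₀, hT.mem_right hab₀]⟩
  obtain ⟨⟨a, b⟩, hm, hmax⟩ := Finset.exists_max_image _
    (fun z : Pt × Pt => liftDet ω u v z.1 z.2 / (ori u v z.2 - ori u v z.1)) hne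
  simp only [Finset.mem_filter, Finset.mem_product] at hm hmax
  obtain ⟨-, hab, hx⟩ := hm
  have hmax' : ∀ x y, s(x, y) ∈ T → Cross u v x y → liftDet ω u v x y / (ori u v y - ori u v x)
      ≤ liftDet ω u v a b / (ori u v b - ori u v a) := fun x y hxy hc =>
    hmax (x, y) ⟨⟨hT.mem hxy, hT.mem_right hxy⟩, hxy, hc⟩
  have hD : ∀ x y, Cross u v x y → ori u v y - ori u v x ≠ 0 := by
    intro x y hc h1
    have := hc.1
    rw [sub_eq_zero.1 h1] at this
    nlinarith
  have hlowab : Low ω u v a b := by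
    refine ⟨hx, ?_⟩
    have h1 := hmax' a₀ b₀ hab₀ hlow.1
    have h2 : 0 < liftDet ω u v a₀ b₀ / (ori u v b₀ - ori u v a₀) := by
      have := hlow.2
      rw [← div_mul_cancel₀ (liftDet ω u v a₀ b₀) (hD _ _ hlow.1)] at this
      nlinarith [mul_self_nonneg (ori u v b₀ - ori u v a₀)]
    have h3 := lt_of_lt_of_le h2 h1
    rw [← div_mul_cancel₀ (liftDet ω u v a b) (hD _ _ hx)]
    have := mul_self_pos.2 (hD _ _ hx)
    nlinarith
  have hnH : s(a, b) ∉ H := fun hm => huv a b hm hx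
  rcases lt_or_ge 0 (ori a b u) with hp | hp
  · obtain ⟨c, hc, d, hd, h⟩ := hT.flip_aux hR hω hu hv hab hlowab hmax' hp
    exact ⟨a, b, c, d, hab, hnH, hc, hd, h⟩
  · have hp' : 0 < ori a b v := by nlinarith [hx.2]
    obtain ⟨c, hc, d, hd, h⟩ := hT.flip_aux hR hω hv hu hab hlowab.swap_left (by
      intro x y hxy hc
      have := hmax' x y hxy hc.swap_left
      have e : ∀ x y, liftDet ω v u x y / (ori v u y - ori v u x)
          = liftDet ω u v x y / (ori u v y - ori u v x) := by
        intro x y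
        rw [← neg_div_neg_eq]
        congr 1
        · unfold liftDet ori; ring
        · unfold ori; ring
      rw [e, e]; exact this) hp'
    exact ⟨a, b, c, d, hab, hnH, hc, hd, h⟩

theorem sym2_cases {P : Pt → Pt → Prop} {a b c d : Pt} (hs : ∀ x y, P x y → P y x)
    (h : s(a, b) = s(c, d)) (hP : P c d) : P a b := by
  rcases Sym2.eq_iff.1 h with ⟨rfl, rfl⟩ | ⟨rfl, rfl⟩
  · exact hP
  · exact hs _ _ hP

theorem not_cross_self (a b : Pt) : ¬ Cross a b a b := fun h => by simpa using h.1

theorem PlaneOn.insert_edge {R : Finset Pt} {H : Finset (Sym2 Pt)} (h : PlaneOn R H) {a b : Pt}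
    (ha : a ∈ R) (hb : b ∈ R) (hab : a ≠ b) (hc : Clear H a b) :
    PlaneOn R (insert s(a, b) H) := by
  have key : ∀ c d, s(c, d) ∈ insert s(a, b) H → ¬ Cross a b c d := by
    intro c d hcd
    rcases Finset.mem_insert.1 hcd with h1 | h1
    · exact sym2_cases (P := fun x y => ¬ Cross a b x y)
        (fun x y hxy hx => hxy hx.swap_right) h1 (not_cross_self a b)
    · exact hc c d h1
  refine ⟨?_, ?_, ?_⟩
  · intro c d hcd
    rcases Finset.mem_insert.1 hcd with h1 | h1
    · rcases Sym2.eq_iff.1 h1 with ⟨rfl, rfl⟩ | ⟨rfl, rfl⟩ <;> assumption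
    · exact h.mem h1
  · intro c d hcd
    rcases Finset.mem_insert.1 hcd with h1 | h1
    · exact sym2_cases (P := fun x y => x ≠ y) (fun x y => Ne.symm) h1 hab
    · exact h.ne h1
  · intro c d e f hcd hef
    rcases Finset.mem_insert.1 hcd with h1 | h1
    · exact sym2_cases (P := fun x y => ¬ Cross x y e f)
        (fun x y hxy hx => hxy hx.swap_left) h1 (key e f hef)
    · rcases Finset.mem_insert.1 hef with h2 | h2
      · exact sym2_cases (P := fun x y => ¬ Cross c d x y)
          (fun x y hxy hx => hxy hx.swap_right) h2 fun hx => hc c d h1 hx.symm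
      · exact h.not_cross h1 h2

theorem PlaneOn.subset_sym2 {R : Finset Pt} {H : Finset (Sym2 Pt)} (h : PlaneOn R H) :
    H ⊆ R.sym2 := by
  intro e he
  induction e using Sym2.ind with
  | _ a b => exact Finset.mk_mem_sym2_iff.2 ⟨h.mem he, h.mem_right he⟩

/-- `T` is the triangulation containing `H` that no segment compatible with `H` passes below. -/
structure IsCanon (R : Finset Pt) (ω : Pt → ℝ) (H T : Finset (Sym2 Pt)) : Prop
    extends IsMaxPlane R T where
  subset : H ⊆ T
  not_low : ∀ {u v a b}, u ∈ R → v ∈ R → Clear H u v → s(a, b) ∈ T → ¬ Low ω u v a b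

theorem Low.flip {R : Finset Pt} (hR : GP R) {ω : Pt → ℝ} {T : Finset (Sym2 Pt)}
    (hT : PlaneOn R T) {a b c d t₁ t₂ : Pt} (ht₁ : t₁ ∈ R) (ht₂ : t₂ ∈ R)
    (hac : s(a, c) ∈ T) (had : s(a, d) ∈ T) (hbc : s(b, c) ∈ T) (hbd : s(b, d) ∈ T)
    (ha' : EmptyTri R c d a) (hb' : EmptyTri R c d b)
    (hl : Low ω c d a b) (ht : Low ω t₁ t₂ c d) :
    ∃ x y, s(x, y) ∈ T ∧ Low ω t₁ t₂ x y := by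
  have hc := hT.mem_right hac
  have hd := hT.mem_right had
  obtain ⟨h, hh, h1, h2, hcd⟩ := ht.1.exists_level ω
  set g := h c with hg
  have hg0 : 0 < g := by
    have h3 := ht.2
    rw [← hh] at h3
    unfold liftDet at h3
    rw [h1, h2, hcd, ← hg] at h3
    have : 0 < g * (ori t₁ t₂ d - ori t₁ t₂ c) ^ 2 := by nlinarith
    exact pos_of_mul_pos_left this (sq_nonneg _)
  have aux : ∀ w, w ∈ R → s(w, c) ∈ T → s(w, d) ∈ T → EmptyTri R c d w → g < h w →
      ∃ x y, s(x, y) ∈ T ∧ Low ω t₁ t₂ x y := by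
    intro w hw hwc hwd he hgw
    rcases Cross.exit_or hR hc hd hw ht₁ ht₂ (hT.ne hwc).symm (hT.ne hwd).symm
      (by rintro rfl; linarith) (by rintro rfl; linarith) ht.1 (he _ ht₁) (he _ ht₂) with hx | hx
    · exact ⟨w, c, hwc, low_of_level hh h1 h2 (by linarith) (by linarith) hx⟩
    · exact ⟨w, d, hwd, low_of_level hh h1 h2 (by linarith) (by linarith) hx⟩
  by_cases k1 : g < h a
  · exact aux a (hT.mem hac) hac had ha' k1
  by_cases k2 : g < h b
  · exact aux b (hT.mem hbc) hbc hbd hb' k2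
  exfalso
  have h3 := hl.2
  rw [← hh] at h3
  have e : liftDet h c d a b = (h a - g) * ori c d b - (h b - g) * ori c d a := by
    unfold liftDet
    rw [hcd, ← hg]; unfold ori; ring
  rw [e] at h3
  have k1' : 0 ≤ g - h a := by linarith
  have k2' : 0 ≤ g - h b := by linarith
  have h4 := hl.1.1
  have : (ori c d b - ori c d a) * ((h a - g) * ori c d b - (h b - g) * ori c d a)
     = - ((g - h a) * ori c d b ^ 2) - (g - h b) * ori c d a ^ 2
      + (ori c d a * ori c d b) * ((g - h a) + (g - h b)) := by ring
  have n1 := mul_nonneg k1' (sq_nonneg (ori c d b))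
  have n2 := mul_nonneg k2' (sq_nonneg (ori c d a))
  have n3 := mul_nonpos_of_nonpos_of_nonneg h4.le (add_nonneg k1' k2')
  linarith

theorem PlaneOn.exists_canon {R : Finset Pt} (hR : GP R) {ω : Pt → ℝ} (hω : ConvexLift R ω)
    {H : Finset (Sym2 Pt)} (hH : PlaneOn R H) : ∃ T, IsCanon R ω H T := by
  obtain ⟨T₀, hT₀, hmax₀⟩ := Finset.exists_max_image
    (R.sym2.powerset.filter fun T => PlaneOn R T ∧ H ⊆ T) Finset.card
    ⟨H, by simp [hH, hH.subset_sym2]⟩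
  obtain ⟨T, hT, hmin⟩ := Finset.exists_min_image
    (R.sym2.powerset.filter fun T => (PlaneOn R T ∧ H ⊆ T) ∧ T.card = T₀.card)
    (fun T => ((R ×ˢ R).filter fun z => Clear H z.1 z.2 ∧
      ∃ x y, s(x, y) ∈ T ∧ Low ω z.1 z.2 x y).card)
    ⟨T₀, by simp only [Finset.mem_filter] at hT₀ ⊢; exact ⟨hT₀.1, hT₀.2, trivial⟩⟩
  simp only [Finset.mem_filter, Finset.mem_powerset] at hT hmax₀ hmin
  obtain ⟨-, ⟨hTp, hHT⟩, hcard⟩ := hT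
  have hM : IsMaxPlane R T := by
    refine ⟨hTp, ?_⟩
    intro a b ha hb hab hcl
    by_contra hn
    have hP := hTp.insert_edge ha hb hab hcl
    have := hmax₀ _ ⟨hP.subset_sym2, hP, hHT.trans (Finset.subset_insert _ _)⟩
    rw [Finset.card_insert_of_notMem hn] at this
    omega
  refine ⟨T, hM, hHT, ?_⟩
  intro u v a₀ b₀ hu hv huv hab₀ hlow
  obtain ⟨a, b, c, d, hab, hnH, hc, hd, hac, had, hbc, hbd, hl, he1, he2, honly⟩ :=
    hM.exists_flip hR hω (H := H) hu hv huv hab₀ hlow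
  have hcd : c ≠ d := by rintro rfl; simpa using hl.1.1
  have hcl : Clear (T.erase s(a, b)) c d := fun x y hxy hx =>
    (Finset.mem_erase.1 hxy).1 (honly x y (Finset.mem_erase.1 hxy).2 hx)
  have hP := (hTp.mono (Finset.erase_subset s(a, b) T)).insert_edge hc hd hcd hcl
  have hHe : H ⊆ T.erase s(a, b) := fun e he =>
    Finset.mem_erase.2 ⟨fun h => hnH (h ▸ he), hHT he⟩
  have hcdT : s(c, d) ∉ T := fun h => hTp.not_cross h hab hl.1
  have hcd' : (insert s(c, d) (T.erase s(a, b))).card = T₀.card := by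
    rw [Finset.card_insert_of_notMem fun h => hcdT (Finset.mem_of_mem_erase h),
      Finset.card_erase_add_one hab, hcard]
  have := hmin _ ⟨hP.subset_sym2, ⟨hP, hHe.trans (Finset.subset_insert _ _)⟩, hcd'⟩
  refine absurd this (not_le.2 (Finset.card_lt_card ?_))
  rw [Finset.ssubset_iff_of_subset]
  · refine ⟨(c, d), ?_, ?_⟩
    · simp only [Finset.mem_filter, Finset.mem_product]
      exact ⟨⟨hc, hd⟩, hcl.mono hHe, a, b, hab, hl⟩
    · simp only [Finset.mem_filter, Finset.mem_product]
      rintro ⟨-, -, x, y, hxy, hL⟩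
      rcases Finset.mem_insert.1 hxy with h1 | h1
      · exact sym2_cases (P := fun x y => ¬ Cross c d x y)
          (fun x y hxy hx => hxy hx.swap_right) h1 (not_cross_self c d) hL.1
      · exact hcl x y h1 hL.1
  · rintro ⟨t₁, t₂⟩ ht
    simp only [Finset.mem_filter, Finset.mem_product] at ht ⊢
    obtain ⟨⟨ht₁, ht₂⟩, htc, x, y, hxy, hL⟩ := ht
    refine ⟨⟨ht₁, ht₂⟩, htc, ?_⟩
    rcases Finset.mem_insert.1 hxy with h1 | h1
    · exact Low.flip hR hTp ht₁ ht₂ hac had hbc hbd he1 he2 hl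
        (sym2_cases (P := fun c d => Low ω t₁ t₂ x y → Low ω t₁ t₂ c d)
          (fun c d h1 h2 => (h1 h2).swap_right) h1.symm id hL)
    · exact ⟨x, y, Finset.mem_of_mem_erase h1, hL⟩

theorem IsCanon.subset_of {R : Finset Pt} {ω : Pt → ℝ} (hω : ConvexLift R ω)
    {H T T' : Finset (Sym2 Pt)} (hT : IsCanon R ω H T) (hT' : IsCanon R ω H T') : T ⊆ T' := by
  intro e he
  induction e using Sym2.ind with
  | _ a b =>
    have ha := hT.mem he
    have hb := hT.mem_right he
    refine hT'.maximal ha hb (hT.ne he) fun c d hcd hx => ?_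
    have hc := hT'.mem hcd
    have hd := hT'.mem_right hcd
    rcases Low.or_symm hx (hω.generic a ha b hb c hc d hd hx) with h | h
    · exact hT'.not_low ha hb ((hT.clear he).mono hT.subset) hcd h
    · exact hT.not_low hc hd ((hT'.clear hcd).mono hT'.subset) he h

theorem IsCanon.eq {R : Finset Pt} {ω : Pt → ℝ} (hω : ConvexLift R ω)
    {H T T' : Finset (Sym2 Pt)} (hT : IsCanon R ω H T) (hT' : IsCanon R ω H T') : T = T' :=
  (hT.subset_of hω hT').antisymm (hT'.subset_of hω hT)

/-- The edges of `T` which are the only edge of `T` crossed by a segment passing below. -/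
def lowEdges (R : Finset Pt) (ω : Pt → ℝ) (T : Finset (Sym2 Pt)) : Finset (Sym2 Pt) :=
  T.filter fun e => ∃ u ∈ R, ∃ v ∈ R, ∃ x y, e = s(x, y) ∧ Low ω u v x y ∧
    ∀ x' y', s(x', y') ∈ T → Cross u v x' y' → s(x', y') = s(x, y)

theorem isCanon_iff {R : Finset Pt} (hR : GP R) {ω : Pt → ℝ} (hω : ConvexLift R ω)
    {H T : Finset (Sym2 Pt)} :
    IsCanon R ω H T ↔ IsMaxPlane R T ∧ lowEdges R ω T ⊆ H ∧ H ⊆ T := by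
  constructor
  · refine fun h => ⟨h.toIsMaxPlane, fun e he => ?_, h.subset⟩
    obtain ⟨heT, u, hu, v, hv, x, y, rfl, hl, ho⟩ := Finset.mem_filter.1 he
    by_contra hn
    refine h.not_low hu hv (fun c d hcd hx => ?_) heT hl
    exact hn (ho c d (h.subset hcd) hx ▸ hcd)
  · rintro ⟨hT, hL, hHT⟩
    refine ⟨hT, hHT, fun {u v a₀ b₀} hu hv huv hab₀ hlow => ?_⟩
    obtain ⟨a, b, c, d, hab, hnH, hc, hd, -, -, -, -, hl, -, -, honly⟩ :=
      hT.exists_flip hR hω (H := H) hu hv huv hab₀ hlow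
    exact hnH (hL (Finset.mem_filter.2 ⟨hab, c, hc, d, hd, a, b, rfl, hl, honly⟩))

/-- Binary trees with inner nodes labelled by edges. -/
inductive ETree : Type
  | leaf : ETree
  | node : Sym2 Pt → ETree → ETree → ETree

namespace ETree

/-- The number of inner nodes reachable from the root without meeting an edge of `H`. -/
def count : ETree → Finset (Sym2 Pt) → ℕ
  | leaf, _ => 0
  | node e l r, H => if e ∈ H then 0 else 1 + l.count H + r.count H

/-- The labels of a tree. -/
def edges : ETree → Finset (Sym2 Pt)
  | leaf => ∅
  | node e l r => insert e (l.edges ∪ r.edges)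

/-- The labels of a tree are distinct. -/
def Good : ETree → Prop
  | leaf => True
  | node e l r => e ∉ l.edges ∪ r.edges ∧ Disjoint l.edges r.edges ∧ l.Good ∧ r.Good

end ETree

/-- The points of `R` in the open sector from `a` to `b` around `p` that `p` sees past `H`. -/
def sectorVis (R : Finset Pt) (H : Finset (Sym2 Pt)) (p a b : Pt) : Finset Pt :=
  R.filter fun z => 0 < ori p a z ∧ 0 < ori p z b ∧ Clear H p z

/-- Along segments that `p` sees behind each other, the lift is lower for the nearer one. -/
def RayLift (R : Finset Pt) (ω : Pt → ℝ) (p : Pt) : Prop :=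
  ∀ c ∈ R, ∀ b ∈ R, ∀ a ∈ R, 0 < ori p c b * ori p c a → 0 < ori p c b * ori p a b →
    ori p c b ^ 2 * ω a < ori p c b * ori p a b * ω c + ori p c b * ori p c a * ω b

theorem exists_near {V : Finset Pt} (hV : GP V) {p : Pt} (hp : p ∈ V) {H : Finset (Sym2 Pt)}
    (hH : PlaneOn (V.erase p) H) {σ : ℝ} {a b z : Pt}
    (ha : a ∈ V.erase p) (hz : z ∈ V.erase p) (hpa : Clear H p a)
    (hz1 : 0 < σ * ori p a z) (hz2 : 0 < σ * ori p z b) (hab : 0 < σ * ori p a b)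
    (hpz : Clear H p z) :
    ∃ u ∈ V.erase p, 0 < σ * ori p a u ∧ 0 < σ * ori p u b ∧ Clear H p u ∧ Clear H a u := by
  obtain ⟨u, hu, hmin⟩ := exists_angle_min (σ := σ) (q := p) (r₀ := a)
    (A := (V.erase p).filter fun z => 0 < σ * ori p a z ∧ 0 < σ * ori p z b ∧ Clear H p z)
    ⟨z, by simp only [Finset.mem_filter]; exact ⟨hz, hz1, hz2, hpz⟩⟩
    (fun x hx => (Finset.mem_filter.1 hx).2.1)
  obtain ⟨hu, hu1, hu2, hpu⟩ := Finset.mem_filter.1 hu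
  refine ⟨u, hu, hu1, hu2, hpu, ?_⟩
  have hpa' : p ≠ a := (Finset.ne_of_mem_erase ha).symm
  have hpu' : p ≠ u := (Finset.ne_of_mem_erase hu).symm
  refine clear_of_emptyTri hV (Finset.erase_subset _ _) hH hp (Finset.mem_of_mem_erase ha)
    (Finset.mem_of_mem_erase hu) hpa' hpu' hpa hpu ?_
    fun x hx => absurd (hH.mem hx) (Finset.notMem_erase _ _)
  by_contra hn
  unfold EmptyTri at hn
  push Not at hn
  have hne : ∀ w ∈ V.erase p, ∀ w' ∈ V.erase p, ori p w w' = 0 → w = w' := by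
    intro w hw w' hw' h
    by_contra hww
    exact hV p hp w (Finset.mem_of_mem_erase hw) w' (Finset.mem_of_mem_erase hw')
      (Finset.ne_of_mem_erase hw).symm (Finset.ne_of_mem_erase hw').symm hww h
  obtain ⟨r, hr, hin, hcl⟩ := exists_clear_in_tri (fun c d h => hH.mem h)
    (fun c hc h => by rw [hne a ha c hc h]; simp)
    (fun c hc h => by rw [hne u hu c hc h]; simp) hpa hpu hn
  have hs : 0 < σ * ori p a r ∧ σ * ori p u r < 0 := by
    have e1 := ori_add p a u r
    have e2 : ori u p r = - ori p u r := ori_swap _ _ _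
    rcases hin with ⟨g1, g2, g3⟩ | ⟨g1, g2, g3⟩
    · have : 0 < σ := pos_of_mul_pos_left hu1 (by linarith)
      exact ⟨mul_pos this g1, by nlinarith⟩
    · have : σ < 0 := neg_of_mul_pos_left hu1 (by linarith)
      exact ⟨mul_pos_of_neg_of_neg this g1, by nlinarith⟩
  have hrb : 0 < σ * ori p r b := by
    have e : (σ * ori p a u) * (σ * ori p r b) = (σ * ori p a r) * (σ * ori p u b)
        - (σ * ori p a b) * (σ * ori p u r) := by
      unfold ori; ring
    have : 0 < (σ * ori p a u) * (σ * ori p r b) := by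
      rw [e]; nlinarith [mul_pos hs.1 hu2]
    exact pos_of_mul_pos_right this hu1.le
  have := hmin r (Finset.mem_filter.2 ⟨hr, hs.1, hrb, hcl⟩)
  linarith [hs.2]

theorem low_of_cone {V : Finset Pt} (hV : GP V) {p : Pt} {ω : Pt → ℝ}
    (hray : RayLift (V.erase p) ω p) {σ : ℝ} (hσ : σ = 1 ∨ σ = -1) {a b c u : Pt}
    (ha : a ∈ V.erase p) (hb : b ∈ V.erase p) (hc : c ∈ V.erase p) (hu : u ∈ V.erase p)
    (hab : 0 < σ * ori p a b) (hc1 : 0 < σ * ori b a c) (hc2 : σ * ori p a c < 0)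
    (hu1 : 0 < σ * ori p a u) (hu2 : 0 < σ * ori p u b) (hu3 : 0 < σ * ori b a u)
    (he : ¬ InTri u b a c) : Low ω a u c b := by
  have s2 : σ ^ 2 = 1 := by rcases hσ with rfl | rfl <;> norm_num
  have e0 : σ * ori p c b = σ * ori p a b + σ * ori b a c - σ * ori p a c := by unfold ori; ring
  have e0' : σ * ori p u b = σ * ori p a b + σ * ori b a u - σ * ori p a u := by unfold ori; ring
  have e1 : (σ * ori p a b) * (σ * ori a c u) = (σ * ori b a c) * (σ * ori p a u)
      - (σ * ori p a c) * (σ * ori b a u) := by unfold ori; ring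
  have e2 : (σ * ori p a b) * (σ * ori p c u) = (σ * ori p c b) * (σ * ori p a u)
      - (σ * ori p a c) * (σ * ori p u b) := by unfold ori; ring
  have hcb : 0 < σ * ori p c b := by linarith
  have k1 : 0 < σ * ori a c u := by
    refine pos_of_mul_pos_right (a := σ * ori p a b) ?_ hab.le
    rw [e1]
    nlinarith [mul_pos hc1 hu1, mul_pos (neg_pos.2 hc2) hu3]
  have k2 : 0 < σ * ori p c u := by
    refine pos_of_mul_pos_right (a := σ * ori p a b) ?_ hab.le
    rw [e2]
    nlinarith [mul_pos hcb hu1, mul_pos (neg_pos.2 hc2) hu2]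
  have hcbne : c ≠ b := by rintro rfl; simp at hcb
  have hcune : c ≠ u := by rintro rfl; simp at k1
  have hbune : b ≠ u := by rintro rfl; simp at hu2
  have k3 : σ * ori c b u < 0 := by
    have hne := hV c (Finset.mem_of_mem_erase hc) b (Finset.mem_of_mem_erase hb) u
      (Finset.mem_of_mem_erase hu) hcbne hcune hbune
    have hne' : σ * ori c b u ≠ 0 := mul_ne_zero (by rintro rfl; norm_num at s2) hne
    rcases lt_or_gt_of_ne hne' with h | h
    · exact h
    · exfalso
      apply he
      rcases hσ with rfl | rfl
      · exact Or.inl ⟨by linarith, by linarith, by linarith⟩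
      · exact Or.inr ⟨by linarith, by linarith, by linarith⟩
  have k4 : σ * ori c b a = σ * ori b a c := by unfold ori; ring
  have k5 : σ * ori a u c = - (σ * ori a c u) := by unfold ori; ring
  have k6 : σ * ori a u b = σ * ori b a u := by unfold ori; ring
  have sgn : ∀ x y : ℝ, x * y = (σ * x) * (σ * y) := by
    intro x y
    calc x * y = σ ^ 2 * (x * y) := by rw [s2, one_mul]
      _ = _ := by ring
  have hx : Cross a u c b := by
    constructor
    · rw [sgn, k5, k6]; nlinarith
    · rw [sgn, k4]; nlinarith
  refine ⟨hx, ?_⟩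
  have r1 := hray c hc b hb a ha
    (by rw [sgn]; exact mul_pos hcb (by rw [ori_swap']; linarith)) (by rw [sgn]; exact mul_pos hcb hab)
  have r2 := hray c hc b hb u hu (by rw [sgn]; exact mul_pos hcb k2)
    (by rw [sgn]; exact mul_pos hcb hu2)
  have hsq : 0 < ori p c b ^ 2 := by
    have := mul_pos hcb hcb
    nlinarith
  have e3 : ori p c b ^ 2 * ((ori a u b - ori a u c) * liftDet ω a u c b)
      = (σ * ori a u b - σ * ori a u c) *
       ((σ * ori c b a) * (ori p c b * ori p u b * ω c + ori p c b * ori p c u * ω b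
          - ori p c b ^ 2 * ω u) -
        (σ * ori c b u) * (ori p c b * ori p a b * ω c + ori p c b * ori p c a * ω b
          - ori p c b ^ 2 * ω a)) := by
    have : ori p c b ^ 2 * ((ori a u b - ori a u c) * liftDet ω a u c b)
      = (ori a u b - ori a u c) *
       ((ori c b a) * (ori p c b * ori p u b * ω c + ori p c b * ori p c u * ω b
          - ori p c b ^ 2 * ω u) -
        (ori c b u) * (ori p c b * ori p a b * ω c + ori p c b * ori p c a * ω b
          - ori p c b ^ 2 * ω a)) := by unfold liftDet ori; ring
    rw [this]
    linear_combination (-(ori a u b - ori a u c) *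
       ((ori c b a) * (ori p c b * ori p u b * ω c + ori p c b * ori p c u * ω b
          - ori p c b ^ 2 * ω u) -
        (ori c b u) * (ori p c b * ori p a b * ω c + ori p c b * ori p c a * ω b
          - ori p c b ^ 2 * ω a))) * s2
  refine pos_of_mul_pos_right (a := ori p c b ^ 2) ?_ hsq.le
  rw [e3, k5, k6, k4]
  apply mul_pos (by linarith)
  have n1 := mul_pos hc1 (sub_pos.2 r2)
  have n2 := mul_pos (neg_pos.2 k3) (sub_pos.2 r1)
  linarith

/-- A triangulation `T` of the points of `V` other than `p`, together with a lift adapted to `p`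
and a set `K` of edges present in all graphs under consideration. -/
structure WindowSetup (V : Finset Pt) (ω : Pt → ℝ) (p : Pt) (T K : Finset (Sym2 Pt)) : Prop where
  gp : GP V
  mem : p ∈ V
  convex : ConvexLift (V.erase p) ω
  ray : RayLift (V.erase p) ω p
  max : IsMaxPlane (V.erase p) T
  low_sub : lowEdges (V.erase p) ω T ⊆ K
  two_sided : ∀ a b, s(a, b) ∈ T → s(a, b) ∉ K → ∃ v ∈ V.erase p, ori a b v < 0

namespace WindowSetup

variable {V : Finset Pt} {ω : Pt → ℝ} {p : Pt} {T K : Finset (Sym2 Pt)}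

theorem ori_ne (W : WindowSetup V ω p T K) {a b : Pt} (ha : a ∈ V.erase p) (hb : b ∈ V.erase p)
    (hab : a ≠ b) : ori p a b ≠ 0 :=
  W.gp p W.mem a (Finset.mem_of_mem_erase ha) b (Finset.mem_of_mem_erase hb)
    (Finset.ne_of_mem_erase ha).symm (Finset.ne_of_mem_erase hb).symm hab

theorem ori_ne' (W : WindowSetup V ω p T K) {a b c : Pt} (ha : a ∈ V.erase p) (hb : b ∈ V.erase p)
    (hc : c ∈ V.erase p) (hab : a ≠ b) (hac : a ≠ c) (hbc : b ≠ c) : ori a b c ≠ 0 :=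
  W.gp a (Finset.mem_of_mem_erase ha) b (Finset.mem_of_mem_erase hb) c
    (Finset.mem_of_mem_erase hc) hab hac hbc

/-- A point in the sector of an empty window lies beyond the window. -/
theorem beyond (W : WindowSetup V ω p T K) {a b z : Pt} (ha : a ∈ V.erase p) (hb : b ∈ V.erase p)
    (hz : z ∈ V.erase p) (hab : 0 < ori p a b) (he : EmptyTri (V.erase p) p a b)
    (h1 : 0 < ori p a z) (h2 : 0 < ori p z b) : 0 < ori b a z := by
  have hne := W.ori_ne' hb ha hz (by rintro rfl; simp at hab) (by rintro rfl; simp at h2)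
    (by rintro rfl; simp at h1)
  rcases lt_or_gt_of_ne hne with h | h
  · refine absurd (Or.inl ⟨h1, ?_, ?_⟩) (he z hz)
    · rw [ori_swap]; linarith
    · rw [ori_rot']; exact h2
  · exact h

theorem cross_window {a b z : Pt} (hab : 0 < ori p a b) (h1 : 0 < ori p a z) (h2 : 0 < ori p z b)
    (h3 : 0 < ori b a z) : Cross p z a b := by
  have e1 : ori p z a = - ori p a z := ori_swap' _ _ _
  have e2 : ori a b p = ori p a b := ori_rot _ _ _
  have e3 : ori a b z = - ori b a z := ori_swap _ _ _
  exact ⟨by rw [e1]; nlinarith, by rw [e2, e3]; nlinarith⟩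

theorem sectorVis_eq_empty_of_mem (W : WindowSetup V ω p T K) {a b : Pt} (ha : a ∈ V.erase p)
    (hb : b ∈ V.erase p) (hab : 0 < ori p a b) (he : EmptyTri (V.erase p) p a b)
    {H : Finset (Sym2 Pt)} (hH : s(a, b) ∈ H) : sectorVis (V.erase p) H p a b = ∅ := by
  refine Finset.filter_eq_empty_iff.2 fun z hz ⟨h1, h2, h3⟩ => ?_
  exact h3 a b hH (cross_window hab h1 h2 (W.beyond ha hb hz hab he h1 h2))

theorem isCanon (W : WindowSetup V ω p T K) {H : Finset (Sym2 Pt)} (hKH : K ⊆ H) (hHT : H ⊆ T) :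
    IsCanon (V.erase p) ω H T :=
  (isCanon_iff (W.gp.mono (Finset.erase_subset _ _)) W.convex).2
    ⟨W.max, W.low_sub.trans hKH, hHT⟩

/-- If the triangle behind a window leaves the sector then nothing is visible in the sector. -/
theorem sectorVis_eq_empty (W : WindowSetup V ω p T K) {a b c : Pt}
    (hab : 0 < ori p a b) (he : EmptyTri (V.erase p) p a b)
    (hc : 0 < ori b a c) (hac : s(a, c) ∈ T) (hbc : s(b, c) ∈ T)
    (hec : EmptyTri (V.erase p) b a c) (hout : ¬ (0 < ori p a c ∧ 0 < ori p c b))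
    {H : Finset (Sym2 Pt)} (hKH : K ⊆ H) (hHT : H ⊆ T) (hpa : Clear H p a) (hpb : Clear H p b) :
    sectorVis (V.erase p) H p a b = ∅ := by
  have hm := W.max
  have ha := hm.mem hac
  have hb := hm.mem hbc
  have hcm := hm.mem_right hac
  refine Finset.filter_eq_empty_iff.2 fun z hz ⟨h1, h2, h3⟩ => ?_
  have hH : PlaneOn (V.erase p) H := hm.toPlaneOn.mono hHT
  have n1 := W.ori_ne ha hcm (hm.ne hac)
  have n2 := W.ori_ne hcm hb (hm.ne hbc).symm
  rcases lt_or_gt_of_ne n1 with h | h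
  · obtain ⟨u, hu, hu1, hu2, -, hau⟩ := exists_near W.gp W.mem hH (σ := 1) (b := b) ha hz hpa
      (by linarith) (by linarith) (by linarith) h3
    have hu3 := W.beyond ha hb hu hab he (by linarith) (by linarith)
    refine (W.isCanon hKH hHT).not_low ha hu hau (by rwa [Sym2.eq_swap] : s(c, b) ∈ T) ?_
    exact low_of_cone W.gp W.ray (σ := 1) (Or.inl rfl) ha hb hcm hu (by linarith) (by linarith)
      (by linarith) hu1 hu2 (by linarith) (hec u hu)
  · have hcb : ori p c b < 0 := by
      rcases lt_or_gt_of_ne n2 with h' | h'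
      · exact h'
      · exact absurd ⟨h, h'⟩ hout
    have sw : ∀ x y, -1 * ori p x y = ori p y x := by intro x y; rw [ori_swap' p x y]; ring
    have sw' : ∀ x, -1 * ori a b x = ori b a x := by intro x; rw [ori_swap a b x]; ring
    obtain ⟨u, hu, hu1, hu2, -, hbu⟩ := exists_near W.gp W.mem hH (σ := -1) (b := a) hb hz hpb
      (by rwa [sw]) (by rwa [sw]) (by rwa [sw]) h3
    rw [sw] at hu1 hu2
    have hu3 := W.beyond ha hb hu hab he hu2 hu1
    refine (W.isCanon hKH hHT).not_low hb hu hbu (by rwa [Sym2.eq_swap] : s(c, a) ∈ T) ?_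
    exact low_of_cone W.gp W.ray (σ := -1) (Or.inr rfl) hb ha hcm hu (by rwa [sw]) (by rwa [sw'])
      (by rw [sw]; exact hcb) (by rwa [sw]) (by rwa [sw]) (by rwa [sw']) fun h => hec u hu h.swap

/-- `z` lies in the closed sector from `a` to `b` around `p`. -/
def InSector (p a b z : Pt) : Prop := 0 ≤ ori p a z ∧ 0 ≤ ori p z b

theorem sector_inter (W : WindowSetup V ω p T K) {a b c : Pt} (hb : b ∈ V.erase p) {e : Sym2 Pt}
    (he : e ∈ T)
    (h1 : ∀ z ∈ e, InSector p a b z) (h2 : ∀ z ∈ e, InSector p b c z) : False := by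
  induction e using Sym2.ind with
  | _ x y =>
    have key : ∀ z ∈ s(x, y), z = b := by
      intro z hz
      have g1 := (h1 z hz).2
      have g2 := (h2 z hz).1
      rw [ori_swap'] at g2
      by_contra hzb
      refine W.ori_ne ?_ hb hzb (by linarith)
      rcases Sym2.mem_iff.1 hz with rfl | rfl
      · exact W.max.mem he
      · exact W.max.mem_right he
    exact W.max.ne he ((key x (Sym2.mem_mk_left _ _)).trans (key y (Sym2.mem_mk_right _ _)).symm)

/-- The visibility through a window is described by a binary tree of edges. -/
theorem exists_tree (W : WindowSetup V ω p T K) : ∀ n : ℕ, ∀ a b : Pt, s(a, b) ∈ T →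
    0 < ori p a b → EmptyTri (V.erase p) p a b →
    ((V.erase p).filter fun z => 0 < ori p a z ∧ 0 < ori p z b).card ≤ n →
    ∃ τ : ETree, τ.Good ∧ τ.edges ⊆ T \ K ∧ (∀ e ∈ τ.edges, ∀ z ∈ e, InSector p a b z) ∧
      ∀ H, K ⊆ H → H ⊆ T → Clear H p a → Clear H p b →
        (sectorVis (V.erase p) H p a b).card = τ.count H := by
  intro n
  induction n with
  | zero =>
    intro a b _ _ _ hn
    refine ⟨.leaf, trivial, by simp [ETree.edges], by simp [ETree.edges], fun H _ _ _ _ => ?_⟩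
    rw [ETree.count, Finset.card_eq_zero, sectorVis]
    rw [nonpos_iff_eq_zero, Finset.card_eq_zero, Finset.filter_eq_empty_iff] at hn
    exact Finset.filter_eq_empty_iff.2 fun z hz ⟨h1, h2, _⟩ => hn hz ⟨h1, h2⟩
  | succ n ih =>
    intro a b hab hpos he hn
    have hm := W.max
    have ha := hm.mem hab
    have hb := hm.mem_right hab
    have hR : GP (V.erase p) := W.gp.mono (Finset.erase_subset _ _)
    by_cases hK : s(a, b) ∈ K
    · refine ⟨.leaf, trivial, by simp [ETree.edges], by simp [ETree.edges],
        fun H hKH _ _ _ => ?_⟩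
      rw [W.sectorVis_eq_empty_of_mem ha hb hpos he (hKH hK)]; rfl
    obtain ⟨v, hv, hv1⟩ := W.two_sided a b hab hK
    obtain ⟨c, hc, hc1, hbc, hac, hec⟩ := hm.exists_apex hR (by rwa [Sym2.eq_swap] : s(b, a) ∈ T)
      hv (by rw [ori_swap]; linarith)
    by_cases hin : 0 < ori p a c ∧ 0 < ori p c b
    swap
    · refine ⟨.leaf, trivial, by simp [ETree.edges], by simp [ETree.edges],
        fun H hKH hHT h1 h2 => ?_⟩
      rw [W.sectorVis_eq_empty hpos he hc1 hac hbc hec hin hKH hHT h1 h2]; rfl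
    obtain ⟨hin1, hin2⟩ := hin
    have hx : Cross p c a b := cross_window hpos hin1 hin2 hc1
    have E1 : EmptyTri (V.erase p) p a c :=
      (emptyTri_of_cross hR ha hb hx he.rot hec.swap).rot.rot.swap
    have E2 : EmptyTri (V.erase p) p b c :=
      (emptyTri_of_cross hR hb ha hx.swap_right he.rot.swap hec).rot.rot.swap
    have E2' : EmptyTri (V.erase p) p c b := E2.rot.rot.swap
    have tr : ∀ z, 0 < ori p a z → 0 < ori p z c → 0 < ori p z b := by
      intro z h1 h2
      have e := ori_pluecker p a z c b
      exact pos_of_mul_pos_right (a := ori p a c)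
        (by nlinarith [mul_pos h1 hin2, mul_pos hpos h2]) hin1.le
    have tr' : ∀ z, 0 < ori p c z → 0 < ori p z b → 0 < ori p a z := by
      intro z h1 h2
      have e := ori_pluecker p a c z b
      exact pos_of_mul_pos_left (b := ori p c b)
        (by nlinarith [mul_pos h2 hin1, mul_pos hpos h1]) hin2.le
    have tn : ∀ z, InSector p a c z → InSector p a b z := by
      intro z h
      refine ⟨h.1, ?_⟩
      have e := ori_pluecker p a z c b
      by_contra hn
      rw [not_le] at hn
      nlinarith [mul_nonneg h.1 hin2.le, mul_nonneg hpos.le h.2, mul_neg_of_pos_of_neg hin1 hn]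
    have tn' : ∀ z, InSector p c b z → InSector p a b z := by
      intro z h
      refine ⟨?_, h.2⟩
      have e := ori_pluecker p a c z b
      by_contra hn
      rw [not_le] at hn
      nlinarith [mul_nonneg h.2 hin1.le, mul_nonneg hpos.le h.1, mul_neg_of_neg_of_pos hn hin2]
    have hcmem : c ∈ (V.erase p).filter fun z => 0 < ori p a z ∧ 0 < ori p z b := by
      simp only [Finset.mem_filter]; exact ⟨hc, hin1, hin2⟩
    obtain ⟨l, hl1, hl2, hl3, hl4⟩ := ih a c hac hin1 E1 (by
      refine Nat.le_of_lt_succ (lt_of_lt_of_le (Finset.card_lt_card ?_) hn)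
      refine (Finset.ssubset_iff_of_subset fun z hz => ?_).2 ⟨c, hcmem, by simp⟩
      simp only [Finset.mem_filter] at hz ⊢
      exact ⟨hz.1, hz.2.1, tr z hz.2.1 hz.2.2⟩)
    obtain ⟨r, hr1, hr2, hr3, hr4⟩ := ih c b (by rwa [Sym2.eq_swap]) hin2 E2' (by
      refine Nat.le_of_lt_succ (lt_of_lt_of_le (Finset.card_lt_card ?_) hn)
      refine (Finset.ssubset_iff_of_subset fun z hz => ?_).2 ⟨c, hcmem, by simp⟩
      simp only [Finset.mem_filter] at hz ⊢
      exact ⟨hz.1, tr' z hz.2.1 hz.2.2, hz.2.2⟩)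
    refine ⟨.node s(a, b) l r, ⟨?_, ?_, hl1, hr1⟩, ?_, ?_, ?_⟩
    · rw [Finset.mem_union, not_or]
      constructor
      · intro h
        have := (hl3 _ h b (Sym2.mem_mk_right _ _)).2
        rw [ori_swap'] at this; linarith
      · intro h
        have := (hr3 _ h a (Sym2.mem_mk_left _ _)).1
        rw [ori_swap'] at this; linarith
    · rw [Finset.disjoint_left]
      exact fun e h1 h2 => W.sector_inter hc (Finset.mem_sdiff.1 (hl2 h1)).1 (hl3 e h1) (hr3 e h2)
    · exact Finset.insert_subset (Finset.mem_sdiff.2 ⟨hab, hK⟩) (Finset.union_subset hl2 hr2)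
    · intro e h z hz
      rcases Finset.mem_insert.1 h with rfl | h
      · rcases Sym2.mem_iff.1 hz with rfl | rfl
        · exact ⟨by simp, hpos.le⟩
        · exact ⟨hpos.le, by simp⟩
      · rcases Finset.mem_union.1 h with h | h
        · exact tn z (hl3 e h z hz)
        · exact tn' z (hr3 e h z hz)
    · intro H hKH hHT hpa hpb
      rw [ETree.count]
      split_ifs with hmem
      · rw [W.sectorVis_eq_empty_of_mem ha hb hpos he hmem]; rfl
      have hV := W.gp
      have hcl : ∀ {x y}, s(x, y) ∈ T → Clear H x y := fun h => (hm.clear h).mono hHT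
      have hpc : Clear H p c := clear_of_two_emptyTri hV (Finset.erase_subset _ _)
        (hm.toPlaneOn.mono hHT) W.mem (Finset.mem_of_mem_erase ha) (Finset.mem_of_mem_erase hb)
        (Finset.mem_of_mem_erase hc) (Finset.ne_of_mem_erase ha).symm
        (Finset.ne_of_mem_erase hb).symm (hm.ne hab) (hm.ne hac).symm (hm.ne hbc).symm hpa hpb
        (hcl hac) (hcl hbc) E1 E2 fun h => absurd h hmem
      rw [← hl4 H hKH hHT hpa hpc, ← hr4 H hKH hHT hpc hpb]
      have hsplit : sectorVis (V.erase p) H p a b = insert c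
          (sectorVis (V.erase p) H p a c ∪ sectorVis (V.erase p) H p c b) := by
        ext z
        simp only [sectorVis, Finset.mem_insert, Finset.mem_union, Finset.mem_filter]
        constructor
        · rintro ⟨hz, h1, h2, h3⟩
          by_cases hzc : z = c
          · exact Or.inl hzc
          refine Or.inr ?_
          rcases lt_or_gt_of_ne (W.ori_ne hz hc hzc) with h | h
          · refine Or.inr ⟨hz, ?_, h2, h3⟩
            rw [ori_swap']; linarith
          · exact Or.inl ⟨hz, h1, h, h3⟩
        · rintro (rfl | ⟨hz, h1, h2, h3⟩ | ⟨hz, h1, h2, h3⟩)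
          · exact ⟨hc, hin1, hin2, hpc⟩
          · exact ⟨hz, h1, tr z h1 h2, h3⟩
          · exact ⟨hz, tr' z h1 h2, h2, h3⟩
      have hdis : Disjoint (sectorVis (V.erase p) H p a c) (sectorVis (V.erase p) H p c b) := by
        rw [Finset.disjoint_left]
        intro z h1 h2
        have g1 := (Finset.mem_filter.1 h1).2.2.1
        have g2 := (Finset.mem_filter.1 h2).2.1
        rw [ori_swap'] at g2; linarith
      rw [hsplit, Finset.card_insert_of_notMem (by simp [sectorVis]), Finset.card_union_of_disjoint hdis]
      omega

end WindowSetup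

namespace WindowSetup

variable {V : Finset Pt} {ω : Pt → ℝ} {p : Pt} {T K : Finset (Sym2 Pt)}

/-- The number of points visible from `p` is described by three trees of edges. -/
theorem exists_three_trees (W : WindowSetup V ω p T K) {o₁ o₂ o₃ : Pt}
    (h1 : o₁ ∈ V) (h2 : o₂ ∈ V) (h3 : o₃ ∈ V) (h : InTri p o₁ o₂ o₃) :
    ∃ t₁ t₂ t₃ : ETree, (t₁.Good ∧ t₂.Good ∧ t₃.Good) ∧
      (t₁.edges ⊆ T \ K ∧ t₂.edges ⊆ T \ K ∧ t₃.edges ⊆ T \ K) ∧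
      (Disjoint t₁.edges t₂.edges ∧ Disjoint t₂.edges t₃.edges ∧ Disjoint t₃.edges t₁.edges) ∧
      ∀ H, K ⊆ H → H ⊆ T → ((V.erase p).filter fun z => Clear H p z).card
        = 3 + (t₁.count H + t₂.count H + t₃.count H) := by
  obtain ⟨a, b, c, ha, hb, hc, ⟨hab, hbc, hca⟩, eab, ebc, eca, hem, pa, pb, pc⟩ :=
    W.max.exists_face W.gp W.mem h1 h2 h3 h
  have hp : InTri p a b c := Or.inl ⟨by rw [ori_rot]; exact hab, by rw [ori_rot]; exact hbc,
    by rw [ori_rot]; exact hca⟩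
  have E1 : EmptyTri (V.erase p) p a b := fun r hr hin => hem r hr (hin.sub hp)
  have E2 : EmptyTri (V.erase p) p b c := fun r hr hin =>
    hem.rot r hr (hin.sub (inTri_rot.2 hp))
  have E3 : EmptyTri (V.erase p) p c a := fun r hr hin =>
    hem.rot.rot r hr (hin.sub (inTri_rot.2 (inTri_rot.2 hp)))
  obtain ⟨t₁, g1, s1, i1, c1⟩ := W.exists_tree _ a b eab hab E1 le_rfl
  obtain ⟨t₂, g2, s2, i2, c2⟩ := W.exists_tree _ b c ebc hbc E2 le_rfl
  obtain ⟨t₃, g3, s3, i3, c3⟩ := W.exists_tree _ c a eca hca E3 le_rfl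
  refine ⟨t₁, t₂, t₃, ⟨g1, g2, g3⟩, ⟨s1, s2, s3⟩, ⟨?_, ?_, ?_⟩, ?_⟩
  · exact Finset.disjoint_left.2 fun e k1 k2 =>
      W.sector_inter hb (Finset.mem_sdiff.1 (s1 k1)).1 (i1 e k1) (i2 e k2)
  · exact Finset.disjoint_left.2 fun e k1 k2 =>
      W.sector_inter hc (Finset.mem_sdiff.1 (s2 k1)).1 (i2 e k1) (i3 e k2)
  · exact Finset.disjoint_left.2 fun e k1 k2 =>
      W.sector_inter ha (Finset.mem_sdiff.1 (s3 k1)).1 (i3 e k1) (i1 e k2)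
  intro H hKH hHT
  have pa' := pa.mono hHT
  have pb' := pb.mono hHT
  have pc' := pc.mono hHT
  rw [← c1 H hKH hHT pa' pb', ← c2 H hKH hHT pb' pc', ← c3 H hKH hHT pc' pa']
  have sw : ∀ x y, ori p x y = - ori p y x := fun x y => ori_swap' p y x
  have hsplit : ((V.erase p).filter fun z => Clear H p z) = ({a, b, c} : Finset Pt) ∪
      (sectorVis (V.erase p) H p a b ∪ sectorVis (V.erase p) H p b c ∪
        sectorVis (V.erase p) H p c a) := by
    ext z
    simp only [sectorVis, Finset.mem_union, Finset.mem_filter, Finset.mem_insert,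
      Finset.mem_singleton]
    constructor
    · rintro ⟨hz, hcl⟩
      by_cases za : z = a
      · exact Or.inl (Or.inl za)
      by_cases zb : z = b
      · exact Or.inl (Or.inr (Or.inl zb))
      by_cases zc : z = c
      · exact Or.inl (Or.inr (Or.inr zc))
      refine Or.inr ?_
      have na := W.ori_ne ha hz (Ne.symm za)
      have nb := W.ori_ne hb hz (Ne.symm zb)
      have nc := W.ori_ne hc hz (Ne.symm zc)
      have e : ori p b c * ori p a z + ori p c a * ori p b z + ori p a b * ori p c z = 0 := by
        unfold ori; ring
      rw [sw z b, sw z c, sw z a]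
      rcases lt_or_gt_of_ne na with a1 | a1 <;> rcases lt_or_gt_of_ne nb with b1 | b1 <;>
        rcases lt_or_gt_of_ne nc with c1 | c1
      · nlinarith [mul_pos hbc (neg_pos.2 a1), mul_pos hca (neg_pos.2 b1),
          mul_pos hab (neg_pos.2 c1)]
      · exact Or.inr ⟨hz, c1, by linarith, hcl⟩
      · exact Or.inl (Or.inr ⟨hz, b1, by linarith, hcl⟩)
      · exact Or.inr ⟨hz, c1, by linarith, hcl⟩
      · exact Or.inl (Or.inl ⟨hz, a1, by linarith, hcl⟩)
      · exact Or.inl (Or.inl ⟨hz, a1, by linarith, hcl⟩)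
      · exact Or.inl (Or.inr ⟨hz, b1, by linarith, hcl⟩)
      · nlinarith [mul_pos hbc a1, mul_pos hca b1, mul_pos hab c1]
    · rintro ((rfl | rfl | rfl) | ((h | h) | h))
      exacts [⟨ha, pa'⟩, ⟨hb, pb'⟩, ⟨hc, pc'⟩, ⟨h.1, h.2.2.2⟩, ⟨h.1, h.2.2.2⟩, ⟨h.1, h.2.2.2⟩]
  have d1 : Disjoint (sectorVis (V.erase p) H p a b) (sectorVis (V.erase p) H p b c) := by
    rw [Finset.disjoint_left]
    intro z k1 k2
    simp only [sectorVis, Finset.mem_filter] at k1 k2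
    have := sw z b
    linarith [k1.2.2.1, k2.2.1]
  have d2 : Disjoint (sectorVis (V.erase p) H p a b ∪ sectorVis (V.erase p) H p b c)
      (sectorVis (V.erase p) H p c a) := by
    rw [Finset.disjoint_left]
    intro z k1 k2
    simp only [sectorVis, Finset.mem_filter, Finset.mem_union] at k1 k2
    have := sw z c
    have := sw z a
    rcases k1 with k1 | k1
    · linarith [k1.2.1, k2.2.2.1]
    · linarith [k1.2.2.1, k2.2.1]
  have d3 : Disjoint ({a, b, c} : Finset Pt) (sectorVis (V.erase p) H p a b ∪
      sectorVis (V.erase p) H p b c ∪ sectorVis (V.erase p) H p c a) := by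
    rw [Finset.disjoint_left]
    intro z k1 k2
    simp only [sectorVis, Finset.mem_filter, Finset.mem_union, Finset.mem_insert,
      Finset.mem_singleton] at k1 k2
    have := sw a b
    have := sw b c
    have := sw c a
    rcases k1 with rfl | rfl | rfl
    · rcases k2 with (k2 | k2) | k2
      · simp at k2
      · linarith [k2.2.1, k2.2.2.1]
      · simp at k2
    · rcases k2 with (k2 | k2) | k2
      · simp at k2
      · simp at k2
      · linarith [k2.2.1, k2.2.2.1]
    · rcases k2 with (k2 | k2) | k2
      · linarith [k2.2.1, k2.2.2.1]
      · simp at k2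
      · simp at k2
  have hcard : ({a, b, c} : Finset Pt).card = 3 := by
    rw [Finset.card_eq_three]
    exact ⟨a, b, c, W.max.ne eab, (W.max.ne eca).symm, W.max.ne ebc, rfl⟩
  rw [hsplit, Finset.card_union_of_disjoint d3, Finset.card_union_of_disjoint d2,
    Finset.card_union_of_disjoint d1, hcard]

end WindowSetup

/-- The Euclidean distance to `p`. -/
def cone (p z : Pt) : ℝ := √((z.1 - p.1) ^ 2 + (z.2 - p.2) ^ 2)

/-- The inner product of the vectors from `p`. -/
def dotAt (p a b : Pt) : ℝ := (a.1 - p.1) * (b.1 - p.1) + (a.2 - p.2) * (b.2 - p.2)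

theorem cone_sq (p z : Pt) : cone p z * cone p z = dotAt p z z := by
  unfold cone dotAt
  rw [Real.mul_self_sqrt (by positivity)]; ring

theorem cone_pos {p z : Pt} (h : z ≠ p) : 0 < cone p z := by
  apply Real.sqrt_pos.2
  by_contra hn
  apply h
  have h1 : (z.1 - p.1) ^ 2 = 0 := by nlinarith [sq_nonneg (z.1 - p.1), sq_nonneg (z.2 - p.2)]
  have h2 : (z.2 - p.2) ^ 2 = 0 := by nlinarith [sq_nonneg (z.1 - p.1), sq_nonneg (z.2 - p.2)]
  ext
  · have := pow_eq_zero_iff (two_ne_zero) |>.1 h1; linarith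
  · have := pow_eq_zero_iff (two_ne_zero) |>.1 h2; linarith

theorem dotAt_lt {p a r : Pt} (h : ori p a r ≠ 0) : dotAt p a r < cone p a * cone p r := by
  unfold cone
  rw [← Real.sqrt_mul (by positivity)]
  apply Real.lt_sqrt_of_sq_lt
  have : 0 < ori p a r ^ 2 := by positivity
  unfold ori at this
  unfold dotAt
  nlinarith

theorem cone_below {V : Finset Pt} (hV : GP V) {p : Pt} (hp : p ∈ V) {r a b c : Pt}
    (hr : r ∈ V.erase p) (ha : a ∈ V.erase p) (hb : b ∈ V.erase p) (hc : c ∈ V.erase p)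
    (h : InTri r a b c) : 0 < ori a b c * liftDet (cone p) a b c r := by
  have hne : ∀ x ∈ V.erase p, x ≠ r → dotAt p x r < cone p x * cone p r := fun x hx hxr =>
    dotAt_lt (hV p hp x (Finset.mem_of_mem_erase hx) r (Finset.mem_of_mem_erase hr)
      (Finset.ne_of_mem_erase hx).symm (Finset.ne_of_mem_erase hr).symm hxr)
  have k1 := hne a ha (by rintro rfl; simp [InTri] at h)
  have k2 := hne b hb (by rintro rfl; simp [InTri] at h)
  have k3 := hne c hc (by rintro rfl; simp [InTri] at h)
  have hpos := cone_pos (Finset.ne_of_mem_erase hr)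
  refine pos_of_mul_pos_left (b := cone p r) ?_ hpos.le
  have hs := ori_add a b c r
  have e : ori a b c * dotAt p r r = ori b c r * dotAt p a r + ori c a r * dotAt p b r
      + ori a b r * dotAt p c r := by
    unfold ori dotAt; ring
  have e2 : ori a b c * liftDet (cone p) a b c r * cone p r
      = ori a b c * ori b c r * (cone p a * cone p r) + ori a b c * ori c a r * (cone p b * cone p r)
        + ori a b c * ori a b r * (cone p c * cone p r)
        - ori a b c * (ori a b c * (cone p r * cone p r)) := by
    have e3 : ori c r b = ori b c r := by unfold ori; ring
    have e4 : ori c r a = - ori c a r := ori_swap' _ _ _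
    unfold liftDet
    rw [e3, e4]; ring
  rw [e2, cone_sq, e]
  have q : 0 < ori a b c * ori b c r ∧ 0 < ori a b c * ori c a r ∧ 0 < ori a b c * ori a b r := by
    rcases h with ⟨g1, g2, g3⟩ | ⟨g1, g2, g3⟩
    · have : 0 < ori a b c := by linarith
      exact ⟨by positivity, by positivity, by positivity⟩
    · have : ori a b c < 0 := by linarith
      exact ⟨mul_pos_of_neg_of_neg this g2, mul_pos_of_neg_of_neg this g3,
        mul_pos_of_neg_of_neg this g1⟩
  have n1 := mul_pos q.1 (sub_pos.2 k1)
  have n2 := mul_pos q.2.1 (sub_pos.2 k2)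
  have n3 := mul_pos q.2.2 (sub_pos.2 k3)
  linarith

theorem cone_ray (p : Pt) {a b c : Pt} (h1 : 0 < ori p c b * ori p c a)
    (h2 : 0 < ori p c b * ori p a b) :
    ori p c b ^ 2 * cone p a
      < ori p c b * ori p a b * cone p c + ori p c b * ori p c a * cone p b := by
  have hpos : 0 < cone p a := cone_pos (by rintro rfl; simp at h1)
  refine lt_of_mul_lt_mul_right (a := cone p a) ?_ hpos.le
  have k1 : dotAt p c a < cone p c * cone p a := dotAt_lt fun h => by simp [h] at h1
  have k2 : dotAt p b a < cone p b * cone p a := dotAt_lt fun h => by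
    rw [ori_swap'] at h; simp [neg_eq_zero.1 h] at h2
  have e : ori p c b ^ 2 * cone p a * cone p a
      = ori p c b * ori p a b * dotAt p c a + ori p c b * ori p c a * dotAt p b a := by
    rw [mul_assoc, cone_sq]; unfold ori dotAt; ring
  rw [e]
  nlinarith [mul_pos h2 (sub_pos.2 k1), mul_pos h1 (sub_pos.2 k2)]

theorem exists_generic (R : Finset Pt) : ∃ η : Pt → ℝ, ∀ u ∈ R, ∀ v ∈ R, ∀ a ∈ R, ∀ b ∈ R,
    Cross u v a b → liftDet η u v a b ≠ 0 := by
  let Q := (R ×ˢ R ×ˢ R ×ˢ R).filter fun q => Cross q.1 q.2.1 q.2.2.1 q.2.2.2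
  let L : Q → Module.Dual ℝ (Pt → ℝ) := fun q =>
    { toFun := fun η => liftDet η q.1.1 q.1.2.1 q.1.2.2.1 q.1.2.2.2
      map_add' := fun x y => by unfold liftDet; simp only [Pi.add_apply]; ring
      map_smul' := fun r x => by
        unfold liftDet; simp only [Pi.smul_apply, smul_eq_mul, RingHom.id_apply]; ring }
  obtain ⟨η, hη⟩ := Module.Dual.exists_forall_ne_zero_of_forall_exists L (fun q => by
    obtain ⟨⟨u, v, a, b⟩, hq⟩ := q
    have hx : Cross u v a b := (Finset.mem_filter.1 hq).2
    refine ⟨fun z => if z = a then 1 else 0, ?_⟩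
    have h1 : b ≠ a := by
      rintro rfl
      have := hx.2; simp at this
    have h2 : u ≠ a := by rintro rfl; simpa using hx.1
    have h3 : v ≠ a := by rintro rfl; simpa using hx.1
    change liftDet (fun z => if z = a then (1 : ℝ) else 0) u v a b ≠ 0
    simp only [liftDet, if_true, h1, h2, h3, if_false]
    intro h0
    have h4 : ori u v b = 0 := by linarith
    simpa [h4] using hx.1)
  refine ⟨η, fun u hu v hv a ha b hb hx => hη ⟨(u, v, a, b), ?_⟩⟩
  simp only [Q, Finset.mem_filter, Finset.mem_product]
  exact ⟨⟨hu, hv, ha, hb⟩, hx⟩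

theorem exists_lift {V : Finset Pt} (hV : GP V) {p : Pt} (hp : p ∈ V) :
    ∃ ω, ConvexLift (V.erase p) ω ∧ RayLift (V.erase p) ω p := by
  obtain ⟨η, hη⟩ := exists_generic (V.erase p)
  let ω : ℝ → Pt → ℝ := fun ε z => cone p z + ε * η z
  have hdet : ∀ ε a b c d, liftDet (ω ε) a b c d
      = liftDet (cone p) a b c d + ε * liftDet η a b c d := by
    intro ε a b c d; simp only [liftDet, ω]; ring
  have hcont : ∀ A B : ℝ, 0 < A → ∀ᶠ ε : ℝ in nhdsWithin 0 (Set.Ioi 0), 0 < A + ε * B := by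
    intro A B hA
    have : Filter.Tendsto (fun ε : ℝ => A + ε * B) (nhds 0) (nhds (A + 0 * B)) :=
      (Continuous.tendsto (by fun_prop) 0)
    rw [zero_mul, add_zero] at this
    exact (this.mono_left nhdsWithin_le_nhds).eventually (lt_mem_nhds hA)
  have E1 : ∀ᶠ ε : ℝ in nhdsWithin 0 (Set.Ioi 0), ∀ r ∈ V.erase p, ∀ a ∈ V.erase p,
      ∀ b ∈ V.erase p, ∀ c ∈ V.erase p, InTri r a b c →
      0 < ori a b c * liftDet (ω ε) a b c r := by
    simp only [Filter.eventually_all_finset, Filter.eventually_imp_distrib_left]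
    intro r hr a ha b hb c hc h
    filter_upwards [hcont _ (ori a b c * liftDet η a b c r) (cone_below hV hp hr ha hb hc h)]
      with ε hε
    rw [hdet]; linarith
  have E2 : ∀ᶠ ε : ℝ in nhdsWithin 0 (Set.Ioi 0), ∀ u ∈ V.erase p, ∀ v ∈ V.erase p,
      ∀ a ∈ V.erase p, ∀ b ∈ V.erase p, Cross u v a b → liftDet (ω ε) u v a b ≠ 0 := by
    simp only [Filter.eventually_all_finset, Filter.eventually_imp_distrib_left]
    intro u hu v hv a ha b hb hx
    have hne := hη u hu v hv a ha b hb hx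
    have : ∀ᶠ ε : ℝ in nhdsWithin 0 (Set.Ioi 0),
        ε ≠ - liftDet (cone p) u v a b / liftDet η u v a b := by
      by_cases h0 : - liftDet (cone p) u v a b / liftDet η u v a b = 0
      · rw [h0]
        filter_upwards [self_mem_nhdsWithin] with ε hε
        exact ne_of_gt hε
      · exact nhdsWithin_le_nhds (isOpen_ne.mem_nhds (Ne.symm h0))
    filter_upwards [this] with ε hε h0
    rw [hdet] at h0
    apply hε
    field_simp
    linarith
  have E3 : ∀ᶠ ε : ℝ in nhdsWithin 0 (Set.Ioi 0), RayLift (V.erase p) (ω ε) p := by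
    simp only [RayLift, Filter.eventually_all_finset, Filter.eventually_imp_distrib_left]
    intro c hc b hb a ha h1 h2
    filter_upwards [hcont _ (ori p c b * ori p a b * η c + ori p c b * ori p c a * η b
      - ori p c b ^ 2 * η a) (sub_pos.2 (cone_ray p h1 h2))] with ε hε
    simp only [ω]
    linarith
  obtain ⟨ε, h1, h2, h3⟩ := (E1.and (E2.and E3)).exists
  exact ⟨ω ε, ⟨h1, h2⟩, h3⟩

/-! ### Weighted averages over subsets -/

/-- The average of `f` over the random subset of `F` in which every element is chosen
independently with odds `l`. -/
def wavg (l : ℝ) (F : Finset (Sym2 Pt)) (f : Finset (Sym2 Pt) → ℝ) : ℝ :=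
  (∑ B ∈ F.powerset, l ^ B.card * f B) / (1 + l) ^ F.card

theorem wavg_empty (l : ℝ) (f : Finset (Sym2 Pt) → ℝ) : wavg l ∅ f = f ∅ := by
  simp [wavg]

theorem wavg_insert {l : ℝ} (hl : 0 < l) {F : Finset (Sym2 Pt)} {e : Sym2 Pt} (he : e ∉ F)
    (f : Finset (Sym2 Pt) → ℝ) :
    wavg l (insert e F) f = wavg l F fun B => (f B + l * f (insert e B)) / (1 + l) := by
  have h : (1 + l) ≠ 0 := by positivity
  unfold wavg
  rw [Finset.sum_powerset_insert he, Finset.card_insert_of_notMem he, ← Finset.sum_add_distrib,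
    pow_succ, div_eq_div_iff (by positivity) (by positivity), Finset.sum_mul, Finset.sum_mul]
  refine Finset.sum_congr rfl fun B hB => ?_
  rw [Finset.card_insert_of_notMem fun h => he (Finset.mem_powerset.1 hB h)]
  field_simp
  ring

theorem wavg_const {l : ℝ} (hl : 0 < l) (F : Finset (Sym2 Pt)) (r : ℝ) :
    wavg l F (fun _ => r) = r := by
  induction F using Finset.induction_on with
  | empty => exact wavg_empty _ _
  | insert e F he ih =>
    rw [wavg_insert hl he]
    have h : (1 + l) ≠ 0 := by positivity
    have : (r + l * r) / (1 + l) = r := by field_simp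
    rw [this, ih]

theorem wavg_add (l : ℝ) (F : Finset (Sym2 Pt)) (f g : Finset (Sym2 Pt) → ℝ) :
    wavg l F (fun B => f B + g B) = wavg l F f + wavg l F g := by
  simp only [wavg, mul_add, Finset.sum_add_distrib, add_div]

theorem wavg_mul_left (l : ℝ) (F : Finset (Sym2 Pt)) (r : ℝ) (f : Finset (Sym2 Pt) → ℝ) :
    wavg l F (fun B => r * f B) = r * wavg l F f := by
  simp only [wavg, mul_left_comm _ r, ← Finset.mul_sum, mul_div_assoc]

theorem wavg_congr (l : ℝ) {F : Finset (Sym2 Pt)} {f g : Finset (Sym2 Pt) → ℝ}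
    (h : ∀ B ⊆ F, f B = g B) : wavg l F f = wavg l F g := by
  unfold wavg
  congr 1
  exact Finset.sum_congr rfl fun B hB => by rw [h B (Finset.mem_powerset.1 hB)]

/-- The function `f` on sets does not depend on the membership of elements outside `E`. -/
def DependsOn' (E : Finset (Sym2 Pt)) (f : Finset (Sym2 Pt) → ℝ) : Prop :=
  ∀ e ∉ E, ∀ B, f (insert e B) = f B

theorem wavg_mul_aux {l : ℝ} (hl : 0 < l) (F : Finset (Sym2 Pt)) :
    ∀ f g : Finset (Sym2 Pt) → ℝ,
      (∀ e ∈ F, (∀ B, f (insert e B) = f B) ∨ ∀ B, g (insert e B) = g B) →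
      wavg l F (fun B => f B * g B) = wavg l F f * wavg l F g := by
  have hx : (1 + l) ≠ 0 := by positivity
  induction F using Finset.induction_on with
  | empty => intro f g _; simp [wavg_empty]
  | insert e F he ih =>
    intro f g h
    rw [wavg_insert hl he, wavg_insert hl he, wavg_insert hl he, ← ih]
    · refine wavg_congr l fun B _ => ?_
      rcases h e (Finset.mem_insert_self _ _) with h | h <;> rw [h] <;> field_simp
    · intro e' he'
      rcases h e' (Finset.mem_insert_of_mem he') with h | h
      · left; intro B; rw [Finset.insert_comm, h, h]
      · right; intro B; rw [Finset.insert_comm, h, h]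

theorem wavg_mul {l : ℝ} (hl : 0 < l) (F : Finset (Sym2 Pt)) {E E' : Finset (Sym2 Pt)}
    (hE : Disjoint E E') {f g : Finset (Sym2 Pt) → ℝ} (hf : DependsOn' E f)
    (hg : DependsOn' E' g) :
    wavg l F (fun B => f B * g B) = wavg l F f * wavg l F g := by
  refine wavg_mul_aux hl F f g fun e _ => ?_
  by_cases he : e ∈ E
  · exact Or.inr (hg e (Finset.disjoint_left.1 hE he))
  · exact Or.inl (hf e he)

namespace ETree

theorem count_insert (K : Finset (Sym2 Pt)) (t : ETree) {e : Sym2 Pt} (he : e ∉ t.edges)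
    (B : Finset (Sym2 Pt)) : t.count (K ∪ insert e B) = t.count (K ∪ B) := by
  induction t with
  | leaf => rfl
  | node e' u v hu hv =>
    simp only [edges, Finset.mem_insert, Finset.mem_union, not_or] at he
    have h : e' ∈ K ∪ insert e B ↔ e' ∈ K ∪ B := by
      simp only [Finset.union_insert, Finset.mem_insert, Ne.symm he.1, false_or]
    simp only [count, hu he.2.1, hv he.2.2, h]

theorem dependsOn_count (K : Finset (Sym2 Pt)) (t : ETree) (φ : ℕ → ℝ) :
    DependsOn' t.edges fun B => φ (t.count (K ∪ B)) := fun e he B => by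
  simp only [count_insert K t he]

/-- The average of `(1 + l) ^ count`, where `c = l / (1 + l)`. -/
def mean (c : ℝ) : ETree → ℝ
  | leaf => 1
  | node _ u v => c + u.mean c * v.mean c

/-- The average of `count * (1 + l) ^ count`, where `c = l / (1 + l)`. -/
def dmean (c : ℝ) : ETree → ℝ
  | leaf => 0
  | node _ u v => u.mean c * v.mean c + u.dmean c * v.mean c + u.mean c * v.dmean c

theorem mean_pos {c : ℝ} (hc : 0 < c) (t : ETree) : 0 < t.mean c := by
  induction t with
  | leaf => simp [mean]
  | node e u v hu hv => simp only [mean]; positivity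

theorem dmean_nonneg {c : ℝ} (hc : 0 < c) (t : ETree) : 0 ≤ t.dmean c := by
  induction t with
  | leaf => simp [dmean]
  | node e u v hu hv =>
    have := mean_pos hc u
    have := mean_pos hc v
    simp only [dmean]; positivity

theorem wavg_count {l : ℝ} (hl : 0 < l) (K : Finset (Sym2 Pt)) (t : ETree) :
    ∀ F : Finset (Sym2 Pt), t.Good → t.edges ⊆ F → Disjoint F K →
      wavg l F (fun B => (1 + l) ^ t.count (K ∪ B)) = t.mean (l / (1 + l)) ∧
      wavg l F (fun B => t.count (K ∪ B) * (1 + l) ^ t.count (K ∪ B)) =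
        t.dmean (l / (1 + l)) := by
  have hx : (1 + l) ≠ 0 := by positivity
  induction t with
  | leaf =>
    intro F _ _ _
    simp only [count, pow_zero, mean, dmean, Nat.cast_zero, zero_mul, wavg_const hl, and_self]
  | node e u v hu hv =>
    intro F hg hF hK
    obtain ⟨he, hd, hgu, hgv⟩ := hg
    simp only [edges] at hF
    have heF : e ∈ F := hF (Finset.mem_insert_self _ _)
    have heK : e ∉ K := Finset.disjoint_left.1 hK heF
    obtain ⟨F, heF', rfl⟩ : ∃ F', e ∉ F' ∧ insert e F' = F :=
      ⟨F.erase e, Finset.notMem_erase _ _, Finset.insert_erase heF⟩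
    have hK' : Disjoint F K := Finset.disjoint_of_subset_left (Finset.subset_insert _ _) hK
    have hsub : u.edges ∪ v.edges ⊆ F := fun z hz => by
      rcases Finset.mem_insert.1 (hF (Finset.mem_insert_of_mem hz)) with rfl | h
      · exact absurd hz he
      · exact h
    obtain ⟨u1, u2⟩ := hu F hgu (Finset.union_subset_left hsub) hK'
    obtain ⟨v1, v2⟩ := hv F hgv (Finset.union_subset_right hsub) hK'
    have hin : ∀ B, (node e u v).count (K ∪ insert e B) = 0 := fun B => by simp [count]
    have hout : ∀ B ⊆ F, (node e u v).count (K ∪ B) =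
        1 + u.count (K ∪ B) + v.count (K ∪ B) := fun B hB => by
      have : e ∉ K ∪ B := by
        simp only [Finset.mem_union, not_or]; exact ⟨heK, fun h => heF' (hB h)⟩
      simp [count, this]
    have huv := fun (φ ψ : ℕ → ℝ) =>
      wavg_mul hl F hd (dependsOn_count K u φ) (dependsOn_count K v ψ)
    have a1 := huv (fun n => (1 + l) ^ n) (fun n => (1 + l) ^ n)
    have a2 := huv (fun n => n * (1 + l) ^ n) (fun n => (1 + l) ^ n)
    have a3 := huv (fun n => (1 + l) ^ n) (fun n => n * (1 + l) ^ n)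
    simp only [u1, u2, v1, v2] at a1 a2 a3
    constructor
    · rw [wavg_insert hl heF', mean, ← a1]
      conv_rhs => rw [← wavg_const hl F (l / (1 + l)), ← wavg_add]
      refine wavg_congr l fun B hB => ?_
      rw [hin, hout B hB]
      field_simp
      ring
    · rw [wavg_insert hl heF', dmean, ← a1, ← a2, ← a3, ← wavg_add, ← wavg_add]
      refine wavg_congr l fun B hB => ?_
      rw [hin, hout B hB]
      push_cast
      field_simp
      ring

end ETree

/-! ### Convex certificates -/

/-- The line `b ↦ b S - T` lies, for `b ≤ B`, below the maximum of consecutive lines of `P`. -/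
def dominated (B S T : ℚ) : List (ℚ × ℚ) → Bool
  | [] => false
  | [q] => decide (q.1 ≤ S) && decide ((S - q.1) * B ≤ T - q.2)
  | q :: q' :: P =>
    (decide (q.1 ≤ S) && decide (S ≤ q'.1) && decide (q.1 < q'.1) &&
      decide (q.2 * (q'.1 - S) + q'.2 * (S - q.1) ≤ T * (q'.1 - q.1))) ||
    dominated B S T (q' :: P)

theorem exists_of_dominated {B S T : ℚ} {P : List (ℚ × ℚ)} (h : dominated B S T P = true)
    {b : ℝ} (hb : b ≤ B) : ∃ q ∈ P, b * S - T ≤ b * q.1 - q.2 := by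
  induction P with
  | nil => simp [dominated] at h
  | cons q P ih =>
    cases P with
    | nil =>
      simp only [dominated, Bool.and_eq_true, decide_eq_true_eq] at h
      obtain ⟨h1, h2⟩ := h
      have h1' : (q.1 : ℝ) ≤ S := by exact_mod_cast h1
      have h2' : ((S : ℝ) - q.1) * B ≤ T - q.2 := by exact_mod_cast h2
      refine ⟨q, by simp, ?_⟩
      nlinarith [mul_le_mul_of_nonneg_left hb (sub_nonneg.2 h1')]
    | cons q' P =>
      simp only [dominated, Bool.or_eq_true, Bool.and_eq_true, decide_eq_true_eq] at h
      rcases h with ⟨⟨⟨h1, h2⟩, h3⟩, h4⟩ | h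
      · have h1' : (q.1 : ℝ) ≤ S := by exact_mod_cast h1
        have h2' : (S : ℝ) ≤ q'.1 := by exact_mod_cast h2
        have h3' : (q.1 : ℝ) < q'.1 := by exact_mod_cast h3
        have h4' : (q.2 : ℝ) * (q'.1 - S) + q'.2 * (S - q.1) ≤ T * (q'.1 - q.1) := by
          exact_mod_cast h4
        by_contra hn
        push Not at hn
        have k1 := hn q (by simp)
        have k2 := hn q' (by simp)
        have e1 := mul_nonneg (sub_nonneg.2 h2') (sub_nonneg.2 k1.le)
        have e2 := mul_nonneg (sub_nonneg.2 h1') (sub_nonneg.2 k2.le)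
        rcases h1'.eq_or_lt with h | h
        · have := mul_pos (sub_pos.2 (h ▸ h3' : (S : ℝ) < q'.1)) (sub_pos.2 k1)
          nlinarith
        · have := mul_pos (sub_pos.2 h) (sub_pos.2 k2)
          nlinarith
      · obtain ⟨r, hr, h⟩ := ih h
        exact ⟨r, List.mem_cons_of_mem _ hr, h⟩

/-- The lines in `P` are closed, up to domination, under the recursion for tree averages, and
all triples evaluate to at most `m`. -/
def certified (c B m : ℚ) (P : List (ℚ × ℚ)) : Bool :=
  P.contains (1, 0) &&
  P.all (fun q => decide (0 < q.1) && decide (0 ≤ q.2)) &&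
  P.all (fun q => P.all fun r =>
    dominated B (c + q.1 * r.1) (q.1 * r.1 + q.2 * r.1 + q.1 * r.2) P) &&
  P.all (fun q => P.all fun r => P.all fun s =>
    decide (B * (q.1 * r.1 * s.1) - q.2 * r.1 * s.1 - q.1 * r.2 * s.1 - q.1 * r.1 * s.2 ≤ m))

theorem ETree.exists_line {c B m : ℚ} {P : List (ℚ × ℚ)} (h : certified c B m P = true)
    (hc : 0 < c) (t : ETree) : ∀ {b : ℝ}, b ≤ B →
      ∃ q ∈ P, b * t.mean c - t.dmean c ≤ b * q.1 - q.2 := by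
  simp only [certified, Bool.and_eq_true, List.all_eq_true, List.contains_iff_mem,
    decide_eq_true_eq] at h
  obtain ⟨⟨⟨h1, h2⟩, h3⟩, -⟩ := h
  have hc' : (0 : ℝ) < c := by exact_mod_cast hc
  induction t with
  | leaf => intro b _; exact ⟨_, h1, by simp [mean, dmean]⟩
  | node e u v hu hv =>
    intro b hb
    have mu := u.mean_pos hc'
    have du := u.dmean_nonneg hc'
    have hb1 : b - 1 - u.dmean c / u.mean c ≤ B := by
      have : 0 ≤ u.dmean c / u.mean c := by positivity
      linarith
    obtain ⟨r, hr, kr⟩ := hv hb1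
    have r1 : (0 : ℝ) < r.1 := by exact_mod_cast (h2 r hr).1
    have r2 : (0 : ℝ) ≤ r.2 := by exact_mod_cast (h2 r hr).2
    have hb2 : b - 1 - r.2 / r.1 ≤ B := by
      have : 0 ≤ (r.2 : ℝ) / r.1 := by positivity
      linarith
    obtain ⟨q, hq, kq⟩ := hu hb2
    obtain ⟨s, hs, ks⟩ := exists_of_dominated (h3 q hq r hr) hb
    refine ⟨s, hs, le_trans ?_ ks⟩
    have e1 := mul_le_mul_of_nonneg_left kr mu.le
    have e2 := mul_le_mul_of_nonneg_left kq r1.le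
    have f1 : u.mean c * (u.dmean c / u.mean c) = u.dmean c := by field_simp
    have f2 : (r.1 : ℝ) * (r.2 / r.1) = r.2 := by field_simp
    simp only [mean, dmean]
    push_cast
    have g1 : u.mean c * ((b - 1 - u.dmean c / u.mean c) * v.mean c - v.dmean c)
        = (b - 1) * u.mean c * v.mean c - u.dmean c * v.mean c - u.mean c * v.dmean c := by
      linear_combination (- v.mean c) * f1
    have g2 : u.mean c * ((b - 1 - u.dmean c / u.mean c) * r.1 - r.2)
        = (r.1 : ℝ) * ((b - 1 - r.2 / r.1) * u.mean c - u.dmean c) := by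
      linear_combination (- (r.1 : ℝ)) * f1 + u.mean c * f2
    have g3 : (r.1 : ℝ) * ((b - 1 - r.2 / r.1) * q.1 - q.2)
        = (b - 1) * q.1 * r.1 - q.1 * r.2 - q.2 * r.1 := by
      linear_combination (- (q.1 : ℝ)) * f2
    rw [g1, g2] at e1
    rw [g3] at e2
    linarith

theorem ETree.three_le {c B m : ℚ} {P : List (ℚ × ℚ)} (h : certified c B m P = true)
    (hc : 0 < c) (u v w : ETree) :
    B * (u.mean c * v.mean c * w.mean c) - u.dmean c * v.mean c * w.mean c
      - u.mean c * v.dmean c * w.mean c - u.mean c * v.mean c * w.dmean c ≤ m := by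
  have hc' : (0 : ℝ) < c := by exact_mod_cast hc
  have mu := u.mean_pos hc'
  have mv := v.mean_pos hc'
  have mw := w.mean_pos hc'
  have du : 0 ≤ u.dmean c / u.mean c := div_nonneg (u.dmean_nonneg hc') mu.le
  have dv : 0 ≤ v.dmean c / v.mean c := div_nonneg (v.dmean_nonneg hc') mv.le
  have h' := h
  simp only [certified, Bool.and_eq_true, List.all_eq_true, List.contains_iff_mem,
    decide_eq_true_eq] at h'
  obtain ⟨⟨⟨-, h2⟩, -⟩, h4⟩ := h'
  have hP : ∀ q ∈ P, (0 : ℝ) < q.1 ∧ 0 ≤ (q.2 : ℝ) / q.1 := fun q hq => by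
    have a1 : (0 : ℝ) < q.1 := by exact_mod_cast (h2 q hq).1
    have a2 : (0 : ℝ) ≤ q.2 := by exact_mod_cast (h2 q hq).2
    exact ⟨a1, by positivity⟩
  obtain ⟨q, hq, kq⟩ := w.exists_line h hc
    (b := B - u.dmean c / u.mean c - v.dmean c / v.mean c) (by linarith)
  obtain ⟨q1, q2⟩ := hP q hq
  obtain ⟨r, hr, kr⟩ := v.exists_line h hc
    (b := B - u.dmean c / u.mean c - q.2 / q.1) (by linarith)
  obtain ⟨r1, r2⟩ := hP r hr
  obtain ⟨s, hs, ks⟩ := u.exists_line h hc (b := B - r.2 / r.1 - q.2 / q.1) (by linarith)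
  have fin : (B * (s.1 * r.1 * q.1) - s.2 * r.1 * q.1 - s.1 * r.2 * q.1 - s.1 * r.1 * q.2 : ℝ)
      ≤ m := by exact_mod_cast h4 s hs r hr q hq
  have e1 := mul_le_mul_of_nonneg_left kq (mul_pos mu mv).le
  have e2 := mul_le_mul_of_nonneg_left kr (mul_pos mu q1).le
  have e3 := mul_le_mul_of_nonneg_left ks (mul_pos r1 q1).le
  have fu : u.mean c * (u.dmean c / u.mean c) = u.dmean c := by field_simp
  have fv : v.mean c * (v.dmean c / v.mean c) = v.dmean c := by field_simp
  have fq : (q.1 : ℝ) * (q.2 / q.1) = q.2 := by field_simp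
  have fr : (r.1 : ℝ) * (r.2 / r.1) = r.2 := by field_simp
  generalize u.dmean c / u.mean c = xu at *
  generalize v.dmean c / v.mean c = xv at *
  generalize (q.2 : ℝ) / q.1 = xq at *
  generalize (r.2 : ℝ) / r.1 = xr at *
  rw [← fu, ← fv]
  rw [← fq] at e1 fin
  rw [← fv, ← fr] at e2
  rw [← fr] at fin
  rw [← fu] at e3
  linarith

/-- The weighted average of `(1 + l) ^ d * (a - c * d)` with `d = 3 + ∑ count`. -/
theorem ETree.wavg_three_le {l : ℝ} (hl : 0 < l) {c B m : ℚ} {P : List (ℚ × ℚ)}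
    (h : certified c B m P = true) (hc : (c : ℝ) = l / (1 + l)) {u v w : ETree}
    {F K : Finset (Sym2 Pt)} (gu : u.Good) (gv : v.Good) (gw : w.Good) (hu : u.edges ⊆ F)
    (hv : v.edges ⊆ F) (hw : w.edges ⊆ F) (huv : Disjoint u.edges v.edges)
    (hvw : Disjoint v.edges w.edges) (hwu : Disjoint w.edges u.edges) (hF : Disjoint F K) :
    wavg l F (fun B' => (1 + l) ^ (3 + (u.count (K ∪ B') + v.count (K ∪ B') + w.count (K ∪ B')))
      * (c * B + 3 * c - c * (3 + (u.count (K ∪ B') + v.count (K ∪ B') + w.count (K ∪ B')) : ℕ))) ≤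
      c * (1 + l) ^ 3 * m := by
  have hc0 : 0 < c := by
    have : (0 : ℝ) < c := by rw [hc]; positivity
    exact_mod_cast this
  obtain ⟨u1, u2⟩ := u.wavg_count hl K F gu hu hF
  obtain ⟨v1, v2⟩ := v.wavg_count hl K F gv hv hF
  obtain ⟨w1, w2⟩ := w.wavg_count hl K F gw hw hF
  rw [← hc] at u1 u2 v1 v2 w1 w2
  have key := fun (φ ψ χ : ℕ → ℝ) => by
    have d : DependsOn' (u.edges ∪ v.edges)
        (fun B => φ (u.count (K ∪ B)) * ψ (v.count (K ∪ B))) := fun e he B => by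
      simp only [Finset.mem_union, not_or] at he
      simp only [count_insert K u he.1, count_insert K v he.2]
    have a := wavg_mul hl F (Finset.disjoint_union_left.2 ⟨hwu.symm, hvw⟩) d
      (dependsOn_count K w χ)
    rw [wavg_mul hl F huv (dependsOn_count K u φ) (dependsOn_count K v ψ)] at a
    exact a
  have k0 := key (fun n => (1 + l) ^ n) (fun n => (1 + l) ^ n) (fun n => (1 + l) ^ n)
  have k1 := key (fun n => n * (1 + l) ^ n) (fun n => (1 + l) ^ n) (fun n => (1 + l) ^ n)
  have k2 := key (fun n => (1 + l) ^ n) (fun n => n * (1 + l) ^ n) (fun n => (1 + l) ^ n)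
  have k3 := key (fun n => (1 + l) ^ n) (fun n => (1 + l) ^ n) (fun n => n * (1 + l) ^ n)
  simp only [u1, u2, v1, v2, w1, w2] at k0 k1 k2 k3
  have fin := mul_le_mul_of_nonneg_left (three_le h hc0 u v w)
    (show (0 : ℝ) ≤ c * (1 + l) ^ 3 by rw [hc]; positivity)
  refine le_trans (le_of_eq ?_) fin
  rw [show B * (u.mean c * v.mean c * w.mean c) - u.dmean c * v.mean c * w.mean c
      - u.mean c * v.dmean c * w.mean c - u.mean c * v.mean c * w.dmean c
      = (B : ℝ) * (u.mean c * v.mean c * w.mean c) + (-1) * (u.dmean c * v.mean c * w.mean c)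
      + (-1) * (u.mean c * v.dmean c * w.mean c) + (-1) * (u.mean c * v.mean c * w.dmean c) by
      ring, ← k0, ← k1, ← k2, ← k3, ← wavg_mul_left, ← wavg_mul_left, ← wavg_mul_left,
    ← wavg_mul_left, ← wavg_add, ← wavg_add, ← wavg_add, ← wavg_mul_left]
  refine wavg_congr l fun B' _ => ?_
  push_cast
  ring

theorem certified_six : certified (6 / 7) (85 / 16) (13399977 / 268912)
    [(1, 0), (13 / 7, 1), (19 / 7, 20 / 7), (211 / 49, 351 / 49), (289 / 49, 640 / 49),
      (403 / 49, 1121 / 49), (3037 / 343, 8783 / 343), (4303 / 343, 14898 / 343)] = true := by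
  decide +kernel

theorem certified_two : certified (2 / 3) (51 / 8) (90613 / 1944)
    [(1, 0), (5 / 3, 1), (7 / 3, 8 / 3), (31 / 9, 55 / 9), (41 / 9, 32 / 3), (55 / 9, 161 / 9),
      (173 / 27, 523 / 27), (235 / 27, 850 / 27), (1015 / 81, 1457 / 27)] = true := by
  decide +kernel

theorem certified_one : certified (1 / 2) 8 (3025 / 64)
    [(1, 0), (3 / 2, 1), (2, 5 / 2), (11 / 4, 21 / 4), (7 / 2, 35 / 4), (9 / 2, 14),
      (6, 183 / 8), (129 / 16, 583 / 16), (81 / 8, 833 / 16)] = true := by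
  decide +kernel

theorem exists_right_of_inTri {V : Finset Pt} (hV : GP V) {p a o₁ o₂ o₃ : Pt} (hp : p ∈ V)
    (ha : a ∈ V) (hpa : p ≠ a) (h1 : o₁ ∈ V) (h2 : o₂ ∈ V) (h3 : o₃ ∈ V)
    (h : InTri p o₁ o₂ o₃) : ∃ v ∈ V, ori p a v < 0 := by
  have hp1 : p ≠ o₁ := by rintro rfl; simp [InTri] at h
  have hp2 : p ≠ o₂ := by rintro rfl; simp [InTri] at h
  have h12 : o₁ ≠ o₂ := by rintro rfl; simp [InTri] at h
  have key : ∀ v, 0 < ori a p v → ori p a v < 0 := fun v hv => by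
    rw [ori_swap] at hv; linarith
  rcases exists_pos_of_inTri h (x := a) (y := p) (by simp) (fun ⟨e1, e2⟩ => by
    by_cases ha1 : a = o₁
    · exact hV a ha p hp o₂ h2 hpa.symm (ha1 ▸ h12) hp2 e2
    · exact hV a ha p hp o₁ h1 hpa.symm ha1 hp1 e1) with h | h | h
  exacts [⟨_, h1, key _ h⟩, ⟨_, h2, key _ h⟩, ⟨_, h3, key _ h⟩]

/-- The edges of a triangle. -/
def triEdges (a b c : Pt) : Finset (Sym2 Pt) := {s(a, b), s(b, c), s(c, a)}

/-- A point set in general position whose convex hull is the triangle `a b c`. -/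
structure Framed (a b c : Pt) (V : Finset Pt) : Prop where
  gp : GP V
  mem₁ : a ∈ V
  mem₂ : b ∈ V
  mem₃ : c ∈ V
  ne₁ : a ≠ b
  ne₂ : b ≠ c
  ne₃ : c ≠ a
  inner : ∀ z ∈ V, z ∉ ({a, b, c} : Finset Pt) → InTri z a b c

/-- The plane graphs on `V` which contain the edges of the triangle `a b c`. -/
def framedGraphs (a b c : Pt) (V : Finset Pt) : Finset (Finset (Sym2 Pt)) :=
  V.sym2.powerset.filter fun G => PlaneOn V G ∧ triEdges a b c ⊆ G

theorem mem_framedGraphs {a b c : Pt} {V : Finset Pt} {G : Finset (Sym2 Pt)} :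
    G ∈ framedGraphs a b c V ↔ PlaneOn V G ∧ triEdges a b c ⊆ G := by
  simp only [framedGraphs, Finset.mem_filter, Finset.mem_powerset, and_iff_right_iff_imp]
  exact fun h => h.1.subset_sym2

namespace Framed

variable {a b c : Pt} {V : Finset Pt}

theorem erase (h : Framed a b c V) {p : Pt} (hp : p ∈ V \ {a, b, c}) :
    Framed a b c (V.erase p) := by
  simp only [Finset.mem_sdiff, Finset.mem_insert, Finset.mem_singleton, not_or] at hp
  obtain ⟨-, p1, p2, p3⟩ := hp
  exact ⟨h.gp.mono (Finset.erase_subset _ _), Finset.mem_erase.2 ⟨Ne.symm p1, h.mem₁⟩,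
    Finset.mem_erase.2 ⟨Ne.symm p2, h.mem₂⟩, Finset.mem_erase.2 ⟨Ne.symm p3, h.mem₃⟩, h.ne₁, h.ne₂,
    h.ne₃, fun z hz => h.inner z (Finset.mem_of_mem_erase hz)⟩

theorem inTri (h : Framed a b c V) {p : Pt} (hp : p ∈ V \ {a, b, c}) : InTri p a b c :=
  h.inner p (Finset.mem_sdiff.1 hp).1 (Finset.mem_sdiff.1 hp).2

theorem mem_triEdges (h : Framed a b c V) {x y : Pt} (hx : x ∈ ({a, b, c} : Finset Pt))
    (hy : y ∈ ({a, b, c} : Finset Pt)) (hxy : x ≠ y) : s(x, y) ∈ triEdges a b c := by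
  simp only [Finset.mem_insert, Finset.mem_singleton] at hx hy
  unfold triEdges
  rcases hx with rfl | rfl | rfl <;> rcases hy with rfl | rfl | rfl <;>
    first | exact absurd rfl hxy | simp

theorem two_sided (h : Framed a b c V) {x y : Pt} (hx : x ∈ V) (hy : y ∈ V) (hxy : x ≠ y)
    (he : s(x, y) ∉ triEdges a b c) : ∃ v ∈ V, ori x y v < 0 := by
  by_cases h1 : x ∈ ({a, b, c} : Finset Pt)
  · by_cases h2 : y ∈ ({a, b, c} : Finset Pt)
    · exact absurd (h.mem_triEdges h1 h2 hxy) he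
    · obtain ⟨v, hv, hl⟩ := exists_left_of_inTri h.gp hy hx hxy.symm h.mem₁ h.mem₂ h.mem₃
        (h.inner y hy h2)
      exact ⟨v, hv, by rw [ori_swap]; linarith⟩
  · exact exists_right_of_inTri h.gp hx hy hxy h.mem₁ h.mem₂ h.mem₃ (h.inner x hx h1)

theorem windowSetup (h : Framed a b c V) {p : Pt} (hp : p ∈ V \ {a, b, c}) {ω : Pt → ℝ}
    (hω : ConvexLift (V.erase p) ω) (hr : RayLift (V.erase p) ω p) {T : Finset (Sym2 Pt)}
    (hT : IsMaxPlane (V.erase p) T) :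
    WindowSetup V ω p T (lowEdges (V.erase p) ω T ∪ triEdges a b c) :=
  ⟨h.gp, (Finset.mem_sdiff.1 hp).1, hω, hr, hT, Finset.subset_union_left, fun _ _ hx hK =>
    (h.erase hp).two_sided (hT.mem hx) (hT.mem_right hx) (hT.ne hx) fun h' =>
      hK (Finset.mem_union_right _ h')⟩

end Framed

/-- The triangulations which contain the edges of the triangle `a b c`. -/
def framedMax (a b c : Pt) (R : Finset Pt) : Finset (Finset (Sym2 Pt)) :=
  R.sym2.powerset.filter fun T => IsMaxPlane R T ∧ triEdges a b c ⊆ T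

theorem mem_framedMax {a b c : Pt} {V : Finset Pt} {T : Finset (Sym2 Pt)} :
    T ∈ framedMax a b c V ↔ IsMaxPlane V T ∧ triEdges a b c ⊆ T := by
  simp only [framedMax, Finset.mem_filter, Finset.mem_powerset, and_iff_right_iff_imp]
  exact fun h => h.1.toPlaneOn.subset_sym2

/-- Plane graphs are partitioned into intervals. -/
theorem sum_framedGraphs {a b c : Pt} {R : Finset Pt} (hR : GP R) {ω : Pt → ℝ}
    (hω : ConvexLift R ω) (f : Finset (Sym2 Pt) → ℝ) :
    ∑ H ∈ framedGraphs a b c R, f H = ∑ T ∈ framedMax a b c R,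
      ∑ B ∈ (T \ (lowEdges R ω T ∪ triEdges a b c)).powerset,
        f (lowEdges R ω T ∪ triEdges a b c ∪ B) := by
  have hcan : ∀ H ∈ framedGraphs a b c R, ∃ T ∈ framedMax a b c R, IsCanon R ω H T := by
    intro H hH
    obtain ⟨h1, h2⟩ := mem_framedGraphs.1 hH
    obtain ⟨T, hT⟩ := h1.exists_canon hR hω
    exact ⟨T, mem_framedMax.2 ⟨hT.toIsMaxPlane, h2.trans hT.subset⟩, hT⟩
  choose! τ hτ hτ' using hcan
  rw [← Finset.sum_fiberwise_of_maps_to hτ]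
  refine Finset.sum_congr rfl fun T hT => ?_
  obtain ⟨hT1, hT2⟩ := mem_framedMax.1 hT
  have hK : lowEdges R ω T ∪ triEdges a b c ⊆ T :=
    Finset.union_subset (Finset.filter_subset _ _) hT2
  refine Finset.sum_bij' (fun H _ => H \ (lowEdges R ω T ∪ triEdges a b c))
    (fun B _ => lowEdges R ω T ∪ triEdges a b c ∪ B) ?_ ?_ ?_ ?_ ?_
  · intro H hH
    obtain ⟨h1, rfl⟩ := Finset.mem_filter.1 hH
    exact Finset.mem_powerset.2 (Finset.sdiff_subset_sdiff (hτ' H h1).subset le_rfl)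
  · intro B hB
    have hBT : lowEdges R ω T ∪ triEdges a b c ∪ B ⊆ T :=
      Finset.union_subset hK ((Finset.mem_powerset.1 hB).trans Finset.sdiff_subset)
    have hB' : lowEdges R ω T ∪ triEdges a b c ∪ B ∈ framedGraphs a b c R :=
      mem_framedGraphs.2 ⟨hT1.toPlaneOn.mono hBT,
        Finset.subset_union_right.trans Finset.subset_union_left⟩
    refine Finset.mem_filter.2 ⟨hB', (hτ' _ hB').eq hω ?_⟩
    exact (isCanon_iff hR hω).2
      ⟨hT1, Finset.subset_union_left.trans Finset.subset_union_left, hBT⟩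
  · intro H hH
    obtain ⟨h1, rfl⟩ := Finset.mem_filter.1 hH
    exact Finset.union_sdiff_of_subset (Finset.union_subset
      ((isCanon_iff hR hω).1 (hτ' H h1)).2.1 (mem_framedGraphs.1 h1).2)
  · intro B hB
    refine Finset.union_sdiff_cancel_left ?_
    exact (Finset.disjoint_of_subset_left (Finset.mem_powerset.1 hB)
      Finset.sdiff_disjoint).symm
  · intro H hH
    obtain ⟨h1, rfl⟩ := Finset.mem_filter.1 hH
    rw [Finset.union_sdiff_of_subset (Finset.union_subset
      ((isCanon_iff hR hω).1 (hτ' H h1)).2.1 (mem_framedGraphs.1 h1).2)]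

/-- The points of `R` that `p` sees past `H`. -/
def visible (R : Finset Pt) (H : Finset (Sym2 Pt)) (p : Pt) : Finset Pt :=
  R.filter fun z => Clear H p z

/-- The generating function of framed plane graphs by the number of edges. -/
def framedSum (a b c : Pt) (l : ℝ) (V : Finset Pt) : ℝ := ∑ G ∈ framedGraphs a b c V, l ^ G.card

theorem framed_visible_le {a b c : Pt} {V : Finset Pt} (h : Framed a b c V) {p : Pt}
    (hp : p ∈ V \ {a, b, c}) {l : ℝ} (hl : 0 < l) {q B m : ℚ} {P : List (ℚ × ℚ)}
    (hP : certified q B m P = true) (hq : (q : ℝ) = l / (1 + l)) :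
    ∑ H ∈ framedGraphs a b c (V.erase p), l ^ H.card * ((1 + l) ^ (visible (V.erase p) H p).card *
      (q * B + 3 * q - q * (visible (V.erase p) H p).card)) ≤
    q * (1 + l) ^ 3 * m * framedSum a b c l (V.erase p) := by
  obtain ⟨ω, hω, hr⟩ := exists_lift h.gp (Finset.mem_sdiff.1 hp).1
  have hR := (h.erase hp).gp
  rw [framedSum, sum_framedGraphs hR hω, sum_framedGraphs hR hω, Finset.mul_sum]
  refine Finset.sum_le_sum fun T hT => ?_
  obtain ⟨hT1, hT2⟩ := mem_framedMax.1 hT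
  obtain ⟨t₁, t₂, t₃, ⟨g1, g2, g3⟩, ⟨s1, s2, s3⟩, ⟨d1, d2, d3⟩, hc⟩ :=
    (h.windowSetup hp hω hr hT1).exists_three_trees h.mem₁ h.mem₂ h.mem₃ (h.inTri hp)
  set K := lowEdges (V.erase p) ω T ∪ triEdges a b c with hKdef
  have hK : K ⊆ T := Finset.union_subset (Finset.filter_subset _ _) hT2
  have key := ETree.wavg_three_le hl hP hq g1 g2 g3 s1 s2 s3 d1 d2 d3
    (Finset.sdiff_disjoint (s := K) (t := T))
  have hpos : 0 < (1 + l) ^ (T \ K).card := by positivity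
  rw [wavg, div_le_iff₀ hpos] at key
  have hone : (1 + l) ^ (T \ K).card = ∑ B ∈ (T \ K).powerset, l ^ B.card := by
    have := wavg_const hl (T \ K) 1
    rw [wavg, div_eq_one_iff_eq hpos.ne'] at this
    simpa using this.symm
  rw [hone] at key
  have hcard : ∀ B ∈ (T \ K).powerset, (K ∪ B).card = K.card + B.card := fun B hB =>
    Finset.card_union_of_disjoint (Finset.disjoint_of_subset_left (Finset.mem_powerset.1 hB)
      Finset.sdiff_disjoint).symm
  have k2 := mul_le_mul_of_nonneg_left key (show 0 ≤ l ^ K.card by positivity)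
  rw [mul_left_comm, Finset.mul_sum, Finset.mul_sum] at k2
  convert k2 using 1
  · refine Finset.sum_congr rfl fun B hB => ?_
    rw [hcard B hB, pow_add, visible, hc (K ∪ B) Finset.subset_union_left
      (Finset.union_subset hK ((Finset.mem_powerset.1 hB).trans Finset.sdiff_subset))]
    ring
  · congr 1
    refine Finset.sum_congr rfl fun B hB => ?_
    rw [hcard B hB, pow_add]

theorem sum_powerset_pow_mul (l α : ℝ) (hl : 0 < l) (D : Finset Pt) :
    ∑ A ∈ D.powerset, l ^ A.card * (α - A.card) =
      (1 + l) ^ D.card * (α - l / (1 + l) * D.card) := by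
  have hx : (1 + l) ≠ 0 := by positivity
  induction D using Finset.induction_on generalizing α with
  | empty => simp
  | insert z D hz ih =>
    rw [Finset.sum_powerset_insert hz]
    have : ∑ A ∈ D.powerset, l ^ (insert z A).card * (α - (insert z A).card) =
        l * ∑ A ∈ D.powerset, l ^ A.card * ((α - 1) - A.card) := by
      rw [Finset.mul_sum]
      refine Finset.sum_congr rfl fun A hA => ?_
      rw [Finset.card_insert_of_notMem fun h => hz (Finset.mem_powerset.1 hA h)]
      push_cast
      ring
    rw [this, ih, ih, Finset.card_insert_of_notMem hz]
    push_cast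
    field_simp
    ring

/-- The edges from `p` to the points of `A`. -/
def spokes (p : Pt) (A : Finset Pt) : Finset (Sym2 Pt) := A.image fun z => s(p, z)

theorem mem_spokes {p : Pt} {A : Finset Pt} {e : Sym2 Pt} :
    e ∈ spokes p A ↔ ∃ z ∈ A, s(p, z) = e := by simp only [spokes, Finset.mem_image]

theorem card_spokes (p : Pt) (A : Finset Pt) : (spokes p A).card = A.card :=
  Finset.card_image_of_injective _ fun _ _ h => Sym2.congr_right.1 h

theorem mem_spokes_right {p z : Pt} {A : Finset Pt} : s(p, z) ∈ spokes p A ↔ z ∈ A := by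
  rw [mem_spokes]
  exact ⟨fun ⟨y, hy, h⟩ => Sym2.congr_right.1 h ▸ hy, fun h => ⟨z, h, rfl⟩⟩

theorem PlaneOn.spokes_union {V : Finset Pt} {H : Finset (Sym2 Pt)} {p : Pt} (hp : p ∈ V)
    (hH : PlaneOn (V.erase p) H) {A : Finset Pt} (hA : A ⊆ visible (V.erase p) H p) :
    PlaneOn V (H ∪ spokes p A) := by
  induction A using Finset.induction_on with
  | empty => simpa [spokes] using hH.mono_set (Finset.erase_subset _ _)
  | insert z A hz ih =>
    have : H ∪ spokes p (insert z A) = insert s(p, z) (H ∪ spokes p A) := by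
      simp [spokes, Finset.image_insert, Finset.union_insert]
    rw [this]
    have hz' := Finset.mem_filter.1 (hA (Finset.mem_insert_self _ _))
    refine (ih ((Finset.subset_insert _ _).trans hA)).insert_edge hp
      (Finset.mem_of_mem_erase hz'.1) (Finset.ne_of_mem_erase hz'.1).symm ?_
    intro x y hxy hx
    rcases Finset.mem_union.1 hxy with h | h
    · exact hz'.2 x y h hx
    · obtain ⟨w, -, hw⟩ := mem_spokes.1 h
      rcases Sym2.eq_iff.1 hw with ⟨rfl, rfl⟩ | ⟨rfl, rfl⟩ <;> simpa using hx.1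

theorem PlaneOn.notMem_of_erase {V : Finset Pt} {H : Finset (Sym2 Pt)} {p : Pt}
    (hH : PlaneOn (V.erase p) H) {e : Sym2 Pt} (he : e ∈ H) : p ∉ e := fun hpe => by
  obtain ⟨z, rfl⟩ := Sym2.mem_iff_exists.1 hpe
  exact Finset.notMem_erase p V (hH.mem he)

theorem mem_of_mem_spokes {p : Pt} {A : Finset Pt} {e : Sym2 Pt} (he : e ∈ spokes p A) : p ∈ e := by
  obtain ⟨z, -, rfl⟩ := mem_spokes.1 he
  exact Sym2.mem_mk_left _ _

theorem PlaneOn.filter_not_spokes_union {V : Finset Pt} {H : Finset (Sym2 Pt)} {p : Pt}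
    (hH : PlaneOn (V.erase p) H) (A : Finset Pt) :
    (H ∪ spokes p A).filter (fun e => p ∉ e) = H := by
  ext e
  simp only [Finset.mem_filter, Finset.mem_union]
  exact ⟨fun ⟨h, hp⟩ => h.resolve_right fun h' => hp (mem_of_mem_spokes h'),
    fun h => ⟨Or.inl h, hH.notMem_of_erase h⟩⟩

theorem PlaneOn.filter_notMem {V : Finset Pt} {G : Finset (Sym2 Pt)} (hG : PlaneOn V G) (p : Pt) :
    PlaneOn (V.erase p) (G.filter fun e => p ∉ e) where
  mem hab := by
    obtain ⟨h1, h2⟩ := Finset.mem_filter.1 hab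
    exact Finset.mem_erase.2 ⟨fun h => h2 (h ▸ Sym2.mem_mk_left _ _), hG.mem h1⟩
  ne hab := hG.ne (Finset.mem_filter.1 hab).1
  not_cross hab hcd := hG.not_cross (Finset.mem_filter.1 hab).1 (Finset.mem_filter.1 hcd).1

theorem PlaneOn.filter_eq_spokes {V : Finset Pt} {G : Finset (Sym2 Pt)} (hG : PlaneOn V G) (p : Pt) :
    G.filter (fun e => p ∈ e) = spokes p ((V.erase p).filter fun z => s(p, z) ∈ G) := by
  ext e
  simp only [Finset.mem_filter, mem_spokes]
  constructor
  · rintro ⟨he, hp⟩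
    obtain ⟨z, rfl⟩ := Sym2.mem_iff_exists.1 hp
    exact ⟨z, ⟨Finset.mem_erase.2 ⟨(hG.ne he).symm, hG.mem_right he⟩, he⟩, rfl⟩
  · rintro ⟨z, ⟨-, he⟩, rfl⟩
    exact ⟨he, Sym2.mem_mk_left _ _⟩

theorem PlaneOn.neighbours_subset {V : Finset Pt} {G : Finset (Sym2 Pt)} (hG : PlaneOn V G)
    (p : Pt) : ((V.erase p).filter fun z => s(p, z) ∈ G) ⊆
      visible (V.erase p) (G.filter fun e => p ∉ e) p := fun z hz => by
  obtain ⟨h1, h2⟩ := Finset.mem_filter.1 hz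
  exact Finset.mem_filter.2 ⟨h1, (hG.clear h2).mono (Finset.filter_subset _ _)⟩

theorem notMem_of_mem_triEdges {a b c p : Pt} (hp : p ∉ ({a, b, c} : Finset Pt)) {e : Sym2 Pt}
    (he : e ∈ triEdges a b c) : p ∉ e := by
  simp only [Finset.mem_insert, Finset.mem_singleton, not_or] at hp
  simp only [triEdges, Finset.mem_insert, Finset.mem_singleton] at he
  rcases he with rfl | rfl | rfl <;> simp [hp.1, hp.2.1, hp.2.2]

theorem filter_notMem_mem_framedGraphs {a b c p : Pt} {V : Finset Pt} {G : Finset (Sym2 Pt)}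
    (hp : p ∉ ({a, b, c} : Finset Pt)) (hG : G ∈ framedGraphs a b c V) :
    G.filter (fun e => p ∉ e) ∈ framedGraphs a b c (V.erase p) := by
  obtain ⟨h1, h2⟩ := mem_framedGraphs.1 hG
  exact mem_framedGraphs.2 ⟨h1.filter_notMem p, fun e he =>
    Finset.mem_filter.2 ⟨h2 he, notMem_of_mem_triEdges hp he⟩⟩

/-- Splitting off the edges at `p`. -/
theorem sum_framed_spokes {a b c p : Pt} {V : Finset Pt} (hpV : p ∈ V)
    (hp : p ∉ ({a, b, c} : Finset Pt)) {l : ℝ} (hl : 0 < l) (α : ℝ) :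
    ∑ G ∈ framedGraphs a b c V, l ^ G.card * (α - vingDeg G p) =
      ∑ H ∈ framedGraphs a b c (V.erase p), l ^ H.card *
        ((1 + l) ^ (visible (V.erase p) H p).card *
          (α - l / (1 + l) * (visible (V.erase p) H p).card)) := by
  simp_rw [← sum_powerset_pow_mul l α hl, Finset.mul_sum]
  rw [Finset.sum_sigma' (framedGraphs a b c (V.erase p))
    (fun H => (visible (V.erase p) H p).powerset)]
  refine Finset.sum_bij'
    (fun G _ => ⟨G.filter fun e => p ∉ e, (V.erase p).filter fun z => s(p, z) ∈ G⟩)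
    (fun q _ => q.1 ∪ spokes p q.2) ?_ ?_ ?_ ?_ ?_
  · intro G hG
    exact Finset.mem_sigma.2 ⟨filter_notMem_mem_framedGraphs hp hG,
      Finset.mem_powerset.2 ((mem_framedGraphs.1 hG).1.neighbours_subset p)⟩
  · rintro ⟨H, A⟩ hq
    obtain ⟨h1, h2⟩ := Finset.mem_sigma.1 hq
    obtain ⟨h3, h4⟩ := mem_framedGraphs.1 h1
    exact mem_framedGraphs.2 ⟨h3.spokes_union hpV (Finset.mem_powerset.1 h2),
      h4.trans Finset.subset_union_left⟩
  · intro G hG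
    change G.filter (fun e => p ∉ e) ∪ spokes p ((V.erase p).filter fun z => s(p, z) ∈ G) = G
    rw [← (mem_framedGraphs.1 hG).1.filter_eq_spokes p, Finset.union_comm,
      Finset.filter_union_filter_not_eq]
  · rintro ⟨H, A⟩ hq
    obtain ⟨h1, h2⟩ := Finset.mem_sigma.1 hq
    obtain ⟨h3, h4⟩ := mem_framedGraphs.1 h1
    have e1 := h3.filter_not_spokes_union A
    have e2 : (V.erase p).filter (fun z => s(p, z) ∈ H ∪ spokes p A) = A := by
      ext z
      simp only [Finset.mem_filter, Finset.mem_union, mem_spokes_right]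
      constructor
      · rintro ⟨-, h | h⟩
        · exact absurd (Sym2.mem_mk_left _ _) (h3.notMem_of_erase h)
        · exact h
      · exact fun h => ⟨(Finset.mem_filter.1 (Finset.mem_powerset.1 h2 h)).1, Or.inr h⟩
    simp only [e1, e2]
  · intro G hG
    have hs := (mem_framedGraphs.1 hG).1.filter_eq_spokes p
    have hd : vingDeg G p = ((V.erase p).filter fun z => s(p, z) ∈ G).card := by
      rw [vingDeg, hs, card_spokes]
    have hc : G.card = (G.filter fun e => p ∉ e).card +
        ((V.erase p).filter fun z => s(p, z) ∈ G).card := by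
      rw [← hd, vingDeg, add_comm, Finset.card_filter_add_card_filter_not]
    simp only
    rw [hd, hc, pow_add]
    ring

theorem sum_vingDeg_le {a b c : Pt} {V : Finset Pt} (h : Framed a b c V) {G : Finset (Sym2 Pt)}
    (hG : G ∈ framedGraphs a b c V) :
    (∑ p ∈ V \ {a, b, c}, (vingDeg G p : ℝ)) ≤ 2 * (G.card - 3) := by
  have ht : (triEdges a b c).card = 3 := by
    have n1 := h.ne₁; have n2 := h.ne₂; have n3 := h.ne₃
    refine Finset.card_eq_three.2 ⟨_, _, _, ?_, ?_, ?_, rfl⟩ <;>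
      simp only [ne_eq, Sym2.eq_iff] <;> tauto
  have hsub := (mem_framedGraphs.1 hG).2
  have key : ∑ p ∈ V \ {a, b, c}, vingDeg G p ≤ 2 * (G \ triEdges a b c).card := by
    have h1 : ∀ p ∈ V \ {a, b, c},
        vingDeg G p = ∑ e ∈ G \ triEdges a b c, if p ∈ e then 1 else 0 := by
      intro p hp
      rw [← Finset.card_filter, vingDeg]
      congr 1
      ext e
      simp only [Finset.mem_filter, Finset.mem_sdiff]
      exact ⟨fun ⟨h1, h2⟩ => ⟨⟨h1, fun h3 => notMem_of_mem_triEdges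
        (Finset.mem_sdiff.1 hp).2 h3 h2⟩, h2⟩, fun ⟨⟨h1, _⟩, h2⟩ => ⟨h1, h2⟩⟩
    rw [Finset.sum_congr rfl h1, Finset.sum_comm, mul_comm, ← smul_eq_mul]
    refine Finset.sum_le_card_nsmul _ _ _ fun e _ => ?_
    rw [← Finset.card_filter]
    induction e using Sym2.ind with
    | _ x y =>
      refine (Finset.card_le_card (t := {x, y}) fun z hz => ?_).trans Finset.card_le_two
      simpa using (Finset.mem_filter.1 hz).2
  rw [Finset.card_sdiff_of_subset hsub, ht] at key
  have h3 : 3 ≤ G.card := ht ▸ Finset.card_le_card hsub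
  have : ((∑ p ∈ V \ {a, b, c}, vingDeg G p : ℕ) : ℝ) ≤ ((2 * (G.card - 3) : ℕ) : ℝ) := by
    exact_mod_cast key
  push_cast [Nat.cast_sub h3] at this
  linarith

theorem framed_recursion {a b c : Pt} {V : Finset Pt} (h : Framed a b c V) {l : ℝ} (hl : 0 < l)
    {q B m : ℚ} {P : List (ℚ × ℚ)} (hP : certified q B m P = true) (hq : (q : ℝ) = l / (1 + l)) :
    ∑ G ∈ framedGraphs a b c V,
      l ^ G.card * ((q * B + 3 * q) * (V \ {a, b, c}).card - 2 * (G.card - 3)) ≤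
    q * (1 + l) ^ 3 * m * ∑ p ∈ V \ {a, b, c}, framedSum a b c l (V.erase p) := by
  have h1 : ∀ p ∈ V \ {a, b, c}, ∑ G ∈ framedGraphs a b c V,
      l ^ G.card * ((q * B + 3 * q) - vingDeg G p) ≤
        q * (1 + l) ^ 3 * m * framedSum a b c l (V.erase p) := fun p hp => by
    rw [sum_framed_spokes (Finset.mem_sdiff.1 hp).1 (Finset.mem_sdiff.1 hp).2 hl, ← hq]
    exact framed_visible_le h hp hl hP hq
  rw [Finset.mul_sum]
  refine le_trans ?_ (Finset.sum_le_sum h1)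
  rw [Finset.sum_comm]
  refine Finset.sum_le_sum fun G hG => ?_
  rw [← Finset.mul_sum, Finset.sum_sub_distrib, Finset.sum_const, nsmul_eq_mul, mul_comm _ (_ : ℝ)]
  have := sum_vingDeg_le h hG
  have hpos : 0 ≤ l ^ G.card := by positivity
  rw [mul_comm]
  refine mul_le_mul_of_nonneg_left ?_ hpos
  linarith

theorem ETree.count_le (t : ETree) (ht : t.Good) (H : Finset (Sym2 Pt)) :
    t.count H ≤ (t.edges \ H).card := by
  induction t with
  | leaf => simp [count]
  | node e u v hu hv =>
    obtain ⟨he, hd, gu, gv⟩ := ht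
    by_cases heH : e ∈ H
    · simp [count, heH]
    · have h1 := hu gu
      have h2 := hv gv
      have h3 : ((ETree.node e u v).edges \ H).card =
          1 + ((u.edges \ H).card + (v.edges \ H).card) := by
        rw [edges, Finset.insert_sdiff_of_notMem _ heH,
          Finset.card_insert_of_notMem fun h => he (Finset.mem_sdiff.1 h).1,
          Finset.union_sdiff_distrib, Finset.card_union_of_disjoint, add_comm]
        exact Finset.disjoint_of_subset_left Finset.sdiff_subset
          (Finset.disjoint_of_subset_right Finset.sdiff_subset hd)
      simp only [count, heH, if_false]
      omega

theorem Framed.card_le {a b c : Pt} (n : ℕ) : ∀ {V : Finset Pt}, Framed a b c V →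
    (V \ {a, b, c}).card = n → ∀ G ∈ framedGraphs a b c V, G.card ≤ 3 * n + 3 := by
  induction n with
  | zero =>
    intro V h hn G hG
    have hsub : V ⊆ {a, b, c} := Finset.sdiff_eq_empty_iff_subset.1 (Finset.card_eq_zero.1 hn)
    have hP := (mem_framedGraphs.1 hG).1
    have : G ⊆ triEdges a b c := fun e he => by
      induction e using Sym2.ind with
      | _ x y => exact h.mem_triEdges (hsub (hP.mem he)) (hsub (hP.mem_right he)) (hP.ne he)
    exact (Finset.card_le_card this).trans Finset.card_le_three
  | succ n ih =>
    intro V h hn G hG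
    obtain ⟨p, hp⟩ : (V \ {a, b, c}).Nonempty := Finset.card_pos.1 (by omega)
    obtain ⟨hpV, hp'⟩ := Finset.mem_sdiff.1 hp
    have hn' : (V.erase p \ {a, b, c}).card = n := by
      rw [Finset.erase_sdiff_comm, Finset.card_erase_of_mem hp, hn]; rfl
    obtain ⟨ω, hω, hr⟩ := exists_lift h.gp hpV
    have hR := (h.erase hp).gp
    have hH := filter_notMem_mem_framedGraphs hp' hG
    have hGP := (mem_framedGraphs.1 hG).1
    obtain ⟨hHP, hHt⟩ := mem_framedGraphs.1 hH
    set H := G.filter fun e => p ∉ e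
    obtain ⟨T, hT⟩ := hHP.exists_canon hR hω
    obtain ⟨hT1, hT2, hT3⟩ := (isCanon_iff hR hω).1 hT
    obtain ⟨t₁, t₂, t₃, ⟨g1, g2, g3⟩, ⟨s1, s2, s3⟩, ⟨d1, d2, d3⟩, hc⟩ :=
      (h.windowSetup hp hω hr hT1).exists_three_trees h.mem₁ h.mem₂ h.mem₃ (h.inTri hp)
    have e1 := hc H (Finset.union_subset hT2 hHt) hT3
    have hTn := ih (h.erase hp) hn' T (mem_framedGraphs.2 ⟨hT1.toPlaneOn, hHt.trans hT3⟩)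
    have c1 := t₁.count_le g1 H
    have c2 := t₂.count_le g2 H
    have c3 := t₃.count_le g3 H
    have hs : ((t₁.edges \ H) ∪ (t₂.edges \ H) ∪ (t₃.edges \ H)).card ≤ (T \ H).card := by
      refine Finset.card_le_card (Finset.union_subset (Finset.union_subset ?_ ?_) ?_) <;>
        exact Finset.sdiff_subset_sdiff (Finset.Subset.trans ‹_› Finset.sdiff_subset) le_rfl
    have hd : ∀ {X Y : Finset (Sym2 Pt)}, Disjoint X Y → Disjoint (X \ H) (Y \ H) := fun h =>
      Finset.disjoint_of_subset_left Finset.sdiff_subset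
        (Finset.disjoint_of_subset_right Finset.sdiff_subset h)
    rw [Finset.card_union_of_disjoint (Finset.disjoint_union_left.2 ⟨hd d3.symm, hd d2⟩),
      Finset.card_union_of_disjoint (hd d1), Finset.card_sdiff_of_subset hT3] at hs
    have hcT := Finset.card_le_card hT3
    have hcard : G.card = H.card + ((V.erase p).filter fun z => s(p, z) ∈ G).card := by
      rw [← card_spokes p, ← hGP.filter_eq_spokes p, add_comm,
        Finset.card_filter_add_card_filter_not]
    have hle := Finset.card_le_card (hGP.neighbours_subset p)
    change _ ≤ ((V.erase p).filter fun z => Clear H p z).card at hle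
    omega

theorem triEdges_card {a b c : Pt} {V : Finset Pt} (h : Framed a b c V) :
    (triEdges a b c).card = 3 := by
  have n1 := h.ne₁; have n2 := h.ne₂; have n3 := h.ne₃
  refine Finset.card_eq_three.2 ⟨_, _, _, ?_, ?_, ?_, rfl⟩ <;>
    simp only [ne_eq, Sym2.eq_iff] <;> tauto

/-- Framed plane graphs with weights `l ^ card` have total weight at most `l ^ 3 * A ^ n`, where
`n` is the number of inner points. -/
def FramedBound (a b c : Pt) (l A : ℝ) : Prop :=
  ∀ V, Framed a b c V → framedSum a b c l V ≤ l ^ 3 * A ^ (V \ {a, b, c}).card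

theorem framedBound_of_alternative {a b c : Pt} {l A μ : ℝ} (hl : 0 < l) (hA : 0 ≤ A)
    {q B m : ℚ} {P : List (ℚ × ℚ)} (hP : certified q B m P = true) (hq : (q : ℝ) = l / (1 + l))
    (hm : 0 ≤ m) (hμ : 0 < q * B + 3 * q - 2 * μ)
    (hΦ : q * (1 + l) ^ 3 * m ≤ A * (q * B + 3 * q - 2 * μ))
    (halt : ∀ V, Framed a b c V →
      ∑ G ∈ framedGraphs a b c V, l ^ G.card * ((G.card : ℝ) - 3) ≤
        μ * (V \ {a, b, c}).card * framedSum a b c l V ∨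
      framedSum a b c l V ≤ l ^ 3 * A ^ (V \ {a, b, c}).card) :
    FramedBound a b c l A := by
  suffices ∀ n, ∀ V, Framed a b c V → (V \ {a, b, c}).card = n →
      framedSum a b c l V ≤ l ^ 3 * A ^ n from fun V h => this _ V h rfl
  intro n
  induction n with
  | zero =>
    intro V h hn
    have hsub : framedGraphs a b c V ⊆ {triEdges a b c} := fun G hG => by
      have h1 := Framed.card_le 0 h hn G hG
      rw [Finset.mem_singleton]
      exact (Finset.eq_of_subset_of_card_le (mem_framedGraphs.1 hG).2
        (by rw [triEdges_card h]; omega)).symm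
    refine (Finset.sum_le_sum_of_subset_of_nonneg hsub fun _ _ _ => by positivity).trans ?_
    simp [triEdges_card h]
  | succ n ih =>
    intro V h hn
    rcases halt V h with h1 | h1
    · have hrec := framed_recursion h hl hP hq
      have hub : ∑ p ∈ V \ {a, b, c}, framedSum a b c l (V.erase p) ≤
          (V \ {a, b, c}).card • (l ^ 3 * A ^ n) := by
        refine Finset.sum_le_card_nsmul _ _ _ fun p hp => ih _ (h.erase hp) ?_
        rw [Finset.erase_sdiff_comm, Finset.card_erase_of_mem hp, hn]; rfl
      have hsplit : ∑ G ∈ framedGraphs a b c V,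
          l ^ G.card * ((q * B + 3 * q) * (V \ {a, b, c}).card - 2 * ((G.card : ℝ) - 3)) =
          (q * B + 3 * q) * (V \ {a, b, c}).card * framedSum a b c l V -
            2 * ∑ G ∈ framedGraphs a b c V, l ^ G.card * ((G.card : ℝ) - 3) := by
        rw [framedSum, Finset.mul_sum, Finset.mul_sum, ← Finset.sum_sub_distrib]
        exact Finset.sum_congr rfl fun G _ => by ring
      rw [hsplit] at hrec
      have hΦ0 : 0 ≤ q * (1 + l) ^ 3 * m := by
        have : (0 : ℝ) ≤ m := by exact_mod_cast hm
        rw [hq]; positivity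
      have hub' := mul_le_mul_of_nonneg_left hub hΦ0
      rw [nsmul_eq_mul] at hub'
      rw [hn] at hrec h1 hub'
      have hn0 : (0 : ℝ) < (n + 1 : ℕ) := by positivity
      have hfin : ((n + 1 : ℕ) : ℝ) * ((q * B + 3 * q - 2 * μ) * framedSum a b c l V) ≤
          ((n + 1 : ℕ) : ℝ) * (q * (1 + l) ^ 3 * m * (l ^ 3 * A ^ n)) := by
        linarith
      have hfin' := le_of_mul_le_mul_left hfin hn0
      have hX : 0 ≤ l ^ 3 * A ^ n := by positivity
      have h3 := mul_le_mul_of_nonneg_right hΦ hX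
      refine le_of_mul_le_mul_left (hfin'.trans (h3.trans (le_of_eq ?_))) hμ
      ring
    · rwa [hn] at h1

/-- If the average number of edges is large, the bound for a larger weight applies. -/
theorem FramedBound.alternative {a b c : Pt} {l l' A A' μ : ℝ} (hl : 0 < l) (hl' : l ≤ l')
    (hA' : 0 ≤ A') (h' : FramedBound a b c l' A') (hA : A' ≤ A * (l' / l) ^ μ) (V : Finset Pt)
    (hV : Framed a b c V) :
    ∑ G ∈ framedGraphs a b c V, l ^ G.card * ((G.card : ℝ) - 3) ≤
        μ * (V \ {a, b, c}).card * framedSum a b c l V ∨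
      framedSum a b c l V ≤ l ^ 3 * A ^ (V \ {a, b, c}).card := by
  rw [or_iff_not_imp_left]
  intro hgt
  push Not at hgt
  set n := (V \ {a, b, c}).card
  have hr : 0 < l' / l := div_pos (hl.trans_le hl') hl
  have hr1 : 1 ≤ l' / l := (one_le_div hl).2 hl'
  have hlog : 0 ≤ Real.log (l' / l) := Real.log_nonneg hr1
  set κ : ℝ := 3 + μ * n with hκ
  have htan : ∀ k : ℕ, (l' / l) ^ κ * (1 + Real.log (l' / l) * ((k : ℝ) - κ)) ≤ (l' / l) ^ k := by
    intro k
    have : (l' / l) ^ k = (l' / l) ^ κ * Real.exp (Real.log (l' / l) * ((k : ℝ) - κ)) := by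
      rw [← Real.rpow_def_of_pos hr, ← Real.rpow_add hr, ← Real.rpow_natCast]
      congr 1
      ring
    rw [this]
    refine mul_le_mul_of_nonneg_left ?_ (Real.rpow_nonneg hr.le _)
    linarith [Real.add_one_le_exp (Real.log (l' / l) * ((k : ℝ) - κ))]
  have hsum : (l' / l) ^ κ * framedSum a b c l V ≤ framedSum a b c l' V := by
    have h1 : (l' / l) ^ κ * (framedSum a b c l V + Real.log (l' / l) *
        (∑ G ∈ framedGraphs a b c V, l ^ G.card * ((G.card : ℝ) - 3) -
          μ * n * framedSum a b c l V)) ≤ framedSum a b c l' V := by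
      rw [framedSum, framedSum, Finset.mul_sum, ← Finset.sum_sub_distrib, Finset.mul_sum,
        ← Finset.sum_add_distrib, Finset.mul_sum]
      refine Finset.sum_le_sum fun G _ => ?_
      have h2 := mul_le_mul_of_nonneg_left (htan G.card) (show 0 ≤ l ^ G.card by positivity)
      have h3 : l ^ G.card * (l' / l) ^ G.card = l' ^ G.card := by
        rw [← mul_pow, mul_div_cancel₀ _ hl.ne']
      rw [h3] at h2
      refine le_trans (le_of_eq ?_) h2
      rw [hκ]
      ring
    refine le_trans (mul_le_mul_of_nonneg_left ?_ (Real.rpow_nonneg hr.le _)) h1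
    have := mul_nonneg hlog (sub_nonneg.2 hgt.le)
    linarith
  have h4 := hsum.trans (h' V hV)
  have hκ' : (l' / l) ^ κ = (l' / l) ^ 3 * ((l' / l) ^ μ) ^ n := by
    rw [hκ, Real.rpow_add hr, Real.rpow_mul hr.le, Real.rpow_natCast]
    norm_num
  have h5 : A' ^ n ≤ A ^ n * ((l' / l) ^ μ) ^ n := by
    rw [← mul_pow]; exact pow_le_pow_left₀ hA' hA n
  have hpos : 0 < (l' / l) ^ κ := Real.rpow_pos_of_pos hr _
  refine le_of_mul_le_mul_left (h4.trans ?_) hpos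
  rw [hκ']
  have h6 := mul_le_mul_of_nonneg_left h5 (show 0 ≤ l' ^ 3 from pow_nonneg (hl.le.trans hl') 3)
  refine h6.trans (le_of_eq ?_)
  have h7 : (l' / l) ^ 3 * l ^ 3 = l' ^ 3 := by rw [← mul_pow, div_mul_cancel₀ _ hl.ne']
  rw [← h7]
  ring

theorem framedBound_six (a b c : Pt) : FramedBound a b c 6 13023 := by
  refine framedBound_of_alternative (μ := 3) (by norm_num) (by norm_num) certified_six
    (by norm_num) (by norm_num) (by norm_num) (by norm_num) fun V h => Or.inl ?_
  rw [framedSum, Finset.mul_sum]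
  refine Finset.sum_le_sum fun G hG => ?_
  rw [mul_comm]
  refine mul_le_mul_of_nonneg_right ?_ (by positivity)
  have : (G.card : ℝ) ≤ (3 * (V \ {a, b, c}).card + 3 : ℕ) := by
    exact_mod_cast Framed.card_le _ h rfl G hG
  push_cast at this
  linarith

theorem framedBound_two (a b c : Pt) : FramedBound a b c 2 775 := by
  refine framedBound_of_alternative (μ := 18 / 7) (by norm_num) (by norm_num) certified_two
    (by norm_num) (by norm_num) (by norm_num) (by norm_num)
    ((framedBound_six a b c).alternative (by norm_num) (by norm_num) (by norm_num) ?_)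
  rw [← div_le_iff₀' (by norm_num), show (6 / 2 : ℝ) = 3 by norm_num,
    ← pow_le_pow_iff_left₀ (by norm_num) (by positivity) (show 7 ≠ 0 by norm_num),
    ← Real.rpow_natCast ((3 : ℝ) ^ (18 / 7 : ℝ)), ← Real.rpow_mul (by norm_num)]
  rw [show (18 / 7 : ℝ) * (7 : ℕ) = (18 : ℕ) by norm_num, Real.rpow_natCast]
  norm_num

theorem framedBound_one (a b c : Pt) : FramedBound a b c 1 172 := by
  refine framedBound_of_alternative (μ := 11 / 5) (by norm_num) (by norm_num) certified_one
    (by norm_num) (by norm_num) (by norm_num) (by norm_num)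
    ((framedBound_two a b c).alternative (by norm_num) (by norm_num) (by norm_num) ?_)
  rw [← div_le_iff₀' (by norm_num), show (2 / 1 : ℝ) = 2 by norm_num,
    ← pow_le_pow_iff_left₀ (by norm_num) (by positivity) (show 5 ≠ 0 by norm_num),
    ← Real.rpow_natCast ((2 : ℝ) ^ (11 / 5 : ℝ)), ← Real.rpow_mul (by norm_num)]
  rw [show (11 / 5 : ℝ) * (5 : ℕ) = (11 : ℕ) by norm_num, Real.rpow_natCast]
  norm_num

theorem card_framedGraphs_le {a b c : Pt} {V : Finset Pt} (h : Framed a b c V) :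
    ((framedGraphs a b c V).card : ℝ) ≤ 172 ^ (V \ {a, b, c}).card := by
  simpa [framedSum] using framedBound_one a b c V h

theorem GenPos.gp {S : Finset Pt} (h : GenPos S) : GP S := by
  intro a ha b hb c hc hab hac hbc h0
  refine h a ha b hb c hc hab hac hbc ?_
  rw [collinear_iff_of_mem (p₀ := a) (by simp)]
  refine ⟨b - a, ?_⟩
  have h1 : (b.1 - a.1) * (c.2 - a.2) = (b.2 - a.2) * (c.1 - a.1) := by
    unfold ori at h0; linarith
  have hc' : ∃ r : ℝ, c = r • (b - a) +ᵥ a := by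
    by_cases hx : b.1 - a.1 = 0
    · have hy : b.2 - a.2 ≠ 0 := fun hy =>
        hab (Prod.ext (by linarith) (by linarith))
      refine ⟨(c.2 - a.2) / (b.2 - a.2), Prod.ext ?_ ?_⟩
      · have : c.1 - a.1 = 0 := by
          rw [hx, zero_mul] at h1
          exact (mul_eq_zero.1 h1.symm).resolve_left hy
        simp [hx]; linarith
      · simp [div_mul_cancel₀ _ hy]
    · refine ⟨(c.1 - a.1) / (b.1 - a.1), Prod.ext ?_ ?_⟩
      · simp [div_mul_cancel₀ _ hx]
      · have : (c.1 - a.1) / (b.1 - a.1) * (b.2 - a.2) = c.2 - a.2 := by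
          field_simp; linarith
        simp [this]
  intro p hp
  simp only [Set.mem_insert_iff, Set.mem_singleton_iff] at hp
  rcases hp with rfl | rfl | rfl
  · exact ⟨0, by simp⟩
  · exact ⟨1, by simp⟩
  · exact hc'

theorem Cross.edgesCross {a b c d : Pt} (h : Cross a b c d) : EdgesCross s(a, b) s(c, d) := by
  refine ⟨a, b, c, d, rfl, rfl, ?_⟩
  obtain ⟨h1, h2⟩ := h
  have k : ∀ {u v : ℝ}, u * v < 0 → 0 < u / (u - v) ∧ 0 < -v / (u - v) ∧
      u / (u - v) + -v / (u - v) = 1 := by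
    intro u v huv
    rcases mul_neg_iff.1 huv with ⟨hu, hv⟩ | ⟨hu, hv⟩
    · have : 0 < u - v := by linarith
      exact ⟨div_pos hu this, div_pos (by linarith) this, by field_simp; ring⟩
    · have : u - v < 0 := by linarith
      exact ⟨div_pos_of_neg_of_neg hu this, div_pos_of_neg_of_neg (by linarith) this,
        by field_simp [this.ne]; ring⟩
  obtain ⟨a1, a2, a3⟩ := k h2
  obtain ⟨b1, b2, b3⟩ := k h1
  have hD : ori a b c - ori a b d = -(ori c d a - ori c d b) := by unfold ori; ring
  have hD0 : ori c d a - ori c d b ≠ 0 := fun h0 => by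
    rw [h0, div_zero] at a1; exact lt_irrefl _ a1
  refine ⟨(-ori c d b / (ori c d a - ori c d b)) • a + (ori c d a / (ori c d a - ori c d b)) • b,
    ⟨_, _, a2, a1, by rw [add_comm]; exact a3, rfl⟩,
    ⟨_, _, b2, b1, by rw [add_comm]; exact b3, ?_⟩⟩
  rw [hD]
  refine Prod.ext ?_ ?_
  · simp only [Prod.fst_add, Prod.smul_fst, smul_eq_mul]
    field_simp
    unfold ori; ring
  · simp only [Prod.snd_add, Prod.smul_snd, smul_eq_mul]
    field_simp
    unfold ori; ring

theorem GP.insert {V : Finset Pt} (h : GP V) {a : Pt}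
    (ha : ∀ x ∈ V, ∀ y ∈ V, x ≠ y → ori x y a ≠ 0) : GP (insert a V) := by
  intro x hx y hy z hz hxy hxz hyz
  rcases Finset.mem_insert.1 hx with rfl | hx' <;>
    rcases Finset.mem_insert.1 hy with rfl | hy' <;>
    rcases Finset.mem_insert.1 hz with rfl | hz'
  · exact absurd rfl hxy
  · exact absurd rfl hxy
  · exact absurd rfl hxz
  · rw [← ori_rot]; exact ha y hy' z hz' hyz
  · exact absurd rfl hyz
  · rw [← ori_rot']; exact ha z hz' x hx' hxz.symm
  · exact ha x hx' y hy' hxy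
  · exact h x hx' y hy' z hz' hxy hxz hyz

theorem eventually_quadratic_ne {u v : ℝ} (h : u ≠ 0 ∨ v ≠ 0) (w : ℝ) :
    ∀ᶠ t : ℝ in Filter.atTop, u * t ^ 2 + v * t + w ≠ 0 := by
  have hp : (Polynomial.C u * Polynomial.X ^ 2 + Polynomial.C v * Polynomial.X +
      Polynomial.C w : Polynomial ℝ) ≠ 0 := fun h0 => by
    have e1 := congrArg (fun p => Polynomial.coeff p 1) h0
    have e2 := congrArg (fun p => Polynomial.coeff p 2) h0
    simp [Polynomial.coeff_C] at e1 e2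
    tauto
  filter_upwards [Polynomial.eventually_atTop_not_isRoot _ hp] with t ht h0
  exact ht (by simpa [Polynomial.IsRoot] using h0)

/-- Every point set lies in a large triangle in general position. -/
theorem exists_frame {S : Finset Pt} (hS : GP S) :
    ∃ a b c : Pt, 0 < ori a b c ∧ GP (insert c (insert b (insert a S))) ∧
      ∀ z ∈ S, 0 < ori a b z ∧ 0 < ori b c z ∧ 0 < ori c a z := by
  have hin : ∀ᶠ t : ℝ in Filter.atTop, ∀ z ∈ S, |z.1| + |z.2| + 2 < t :=
    (Finset.eventually_all S).2 fun z _ => Filter.eventually_gt_atTop _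
  have hgen : ∀ᶠ t : ℝ in Filter.atTop, ∀ x ∈ S, ∀ y ∈ S, x ≠ y →
      ori x y (-t ^ 2, -t) ≠ 0 ∧ ori x y (t ^ 2, -t) ≠ 0 ∧ ori x y (t, t ^ 2) ≠ 0 := by
    refine (Finset.eventually_all S).2 fun x _ => (Finset.eventually_all S).2 fun y _ => ?_
    by_cases hxy : x = y
    · simp [hxy]
    have h0 : y.1 - x.1 ≠ 0 ∨ y.2 - x.2 ≠ 0 := by
      by_contra hn
      push Not at hn
      exact hxy (Prod.ext (by linarith [hn.1]) (by linarith [hn.2]))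
    filter_upwards [
      eventually_quadratic_ne (u := y.2 - x.2) (v := -(y.1 - x.1))
        (by rw [neg_ne_zero]; exact h0.symm) ((y.2 - x.2) * x.1 - (y.1 - x.1) * x.2),
      eventually_quadratic_ne (u := -(y.2 - x.2)) (v := -(y.1 - x.1))
        (by rw [neg_ne_zero, neg_ne_zero]; exact h0.symm)
        ((y.2 - x.2) * x.1 - (y.1 - x.1) * x.2),
      eventually_quadratic_ne (u := y.1 - x.1) (v := -(y.2 - x.2))
        (by rw [neg_ne_zero]; exact h0) ((y.2 - x.2) * x.1 - (y.1 - x.1) * x.2)]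
      with t h1 h2 h3 _
    refine ⟨fun h => h1 ?_, fun h => h2 ?_, fun h => h3 ?_⟩ <;>
      (simp only [ori] at h; linarith)
  obtain ⟨t, h1, h2, h3⟩ := (hin.and (hgen.and (Filter.eventually_gt_atTop (2 : ℝ)))).exists
  have hins : ∀ z ∈ S, 0 < ori (-t ^ 2, -t) (t ^ 2, -t) z ∧ 0 < ori (t ^ 2, -t) (t, t ^ 2) z ∧
      0 < ori (t, t ^ 2) (-t ^ 2, -t) z := by
    intro z hz
    have hz' := h1 z hz
    have a1 := abs_le.1 (le_refl |z.1|)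
    have a2 := abs_le.1 (le_refl |z.2|)
    have q1 : 0 ≤ |z.1| := abs_nonneg _
    have q2 : 0 ≤ |z.2| := abs_nonneg _
    refine ⟨?_, ?_, ?_⟩
    · have : ori (-t ^ 2, -t) (t ^ 2, -t) z = 2 * t ^ 2 * (z.2 + t) := by unfold ori; ring
      rw [this]
      have : 0 < z.2 + t := by linarith
      positivity
    · have : ori (t ^ 2, -t) (t, t ^ 2) z =
          t * (t * (t * t + 1 - (z.1 + z.2)) + (z.2 - z.1)) := by unfold ori; ring
      rw [this]
      have g1 : t ≤ t * t := by nlinarith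
      have g2 : 1 ≤ t * t + 1 - (z.1 + z.2) := by linarith
      have g3 : t * 1 ≤ t * (t * t + 1 - (z.1 + z.2)) := by gcongr
      refine mul_pos (by linarith) (by linarith)
    · have : ori (t, t ^ 2) (-t ^ 2, -t) z = (t * t + t) * (t * (t - 1) + z.1 - z.2) := by
        unfold ori; ring
      rw [this]
      have g1 : t * 1 ≤ t * (t - 1) := by gcongr; linarith
      refine mul_pos (by nlinarith) (by linarith)
  have habc : 0 < ori (-t ^ 2, -t) (t ^ 2, -t) (t, t ^ 2) := by
    have : ori (-t ^ 2, -t) (t ^ 2, -t) (t, t ^ 2) = 2 * t ^ 2 * (t ^ 2 + t) := by unfold ori; ring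
    rw [this]; positivity
  generalize ((-t ^ 2, -t) : Pt) = a at *
  generalize ((t ^ 2, -t) : Pt) = b at *
  generalize ((t, t ^ 2) : Pt) = c at *
  refine ⟨a, b, c, habc, ?_, hins⟩
  have g1 : GP (insert a S) := hS.insert fun x hx y hy hxy => (h2 x hx y hy hxy).1
  have g2 : GP (insert b (insert a S)) := g1.insert fun x hx y hy hxy => by
    rcases Finset.mem_insert.1 hx with rfl | hx' <;>
      rcases Finset.mem_insert.1 hy with rfl | hy'
    · exact absurd rfl hxy
    · rw [ori_swap']; exact (neg_lt_zero.2 (hins y hy').1).ne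
    · rw [← ori_rot]; exact (hins x hx').1.ne'
    · exact (h2 x hx' y hy' hxy).2.1
  refine g2.insert fun x hx y hy hxy => ?_
  simp only [Finset.mem_insert] at hx hy
  rcases hx with rfl | rfl | hx' <;> rcases hy with rfl | rfl | hy'
  · exact absurd rfl hxy
  · rw [ori_swap]; exact (neg_lt_zero.2 habc).ne
  · rw [ori_swap']; exact (neg_lt_zero.2 (hins y hy').2.1).ne
  · exact habc.ne'
  · exact absurd rfl hxy
  · rw [← ori_rot']; exact (hins y hy').2.2.ne'
  · rw [← ori_rot]; exact (hins x hx').2.1.ne'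
  · rw [ori_swap', neg_ne_zero, ori_rot']; exact (hins x hx').2.2.ne'
  · exact (h2 x hx' y hy' hxy).2.2

theorem IsPlaneGraph.planeOn {S : Finset Pt} {G : Finset (Sym2 Pt)} (h : IsPlaneGraph S G) :
    PlaneOn S G where
  mem he := (h.1 _ he).2 _ (Sym2.mem_mk_left _ _)
  ne he := by simpa using (h.1 _ he).1
  not_cross {a b c d} he hf hx := by
    by_cases hef : s(a, b) = s(c, d)
    · exact sym2_cases (P := fun x y => ¬ Cross x y c d) (fun x y h h' => h h'.swap_left) hef
        (not_cross_self c d) hx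
    · exact h.2 _ he _ hf hef hx.edgesCross

theorem clear_of_side {S : Finset Pt} {G : Finset (Sym2 Pt)} (hG : PlaneOn S G) {a b : Pt}
    (h : ∀ z ∈ S, 0 < ori a b z) : Clear G a b := fun c d he hx => by
  have h1 := h c (hG.mem he)
  have h2 := h d (hG.mem (Sym2.eq_swap ▸ he))
  nlinarith [hx.1, mul_pos h1 h2]

theorem PlaneOn.mono_points {V W : Finset Pt} {G : Finset (Sym2 Pt)} (h : PlaneOn V G) (hVW : V ⊆ W) :
    PlaneOn W G :=
  ⟨fun he => hVW (h.mem he), h.ne, h.not_cross⟩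

theorem card_planeGraphs_le {S : Finset Pt} (hS : GenPos S) :
    ((planeGraphs S).card : ℝ) ≤ 172 ^ S.card := by
  obtain ⟨a, b, c, habc, hgp, hin⟩ := exists_frame hS.gp
  have hab : a ≠ b := by rintro rfl; simp [ori] at habc
  have hbc : b ≠ c := by rintro rfl; simp at habc
  have hca : c ≠ a := by rintro rfl; simp at habc
  have haS : a ∉ S := fun h => by simpa using (hin a h).1
  have hbS : b ∉ S := fun h => by simpa using (hin b h).1
  have hcS : c ∉ S := fun h => by simpa using (hin c h).2.1
  set V := insert c (insert b (insert a S)) with hV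
  have hSV : S ⊆ V := fun z hz => by simp [hV, hz]
  have haV : a ∈ V := by simp [hV]
  have hbV : b ∈ V := by simp [hV]
  have hcV : c ∈ V := by simp [hV]
  have hF : Framed a b c V :=
    ⟨hgp, haV, hbV, hcV, hab, hbc, hca, fun z hz hz' => Or.inl (hin z (by
      simp only [hV, Finset.mem_insert] at hz
      simp only [Finset.mem_insert, Finset.mem_singleton] at hz'
      tauto))⟩
  have hVS : V \ {a, b, c} = S := by
    ext z
    simp only [hV, Finset.mem_sdiff, Finset.mem_insert, Finset.mem_singleton]
    constructor
    · tauto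
    · intro hz
      refine ⟨by tauto, ?_⟩
      rintro (rfl | rfl | rfl) <;> contradiction
  have hcard : (planeGraphs S).card ≤ (framedGraphs a b c V).card := by
    refine Finset.card_le_card_of_injOn (· ∪ triEdges a b c) ?_ ?_
    · intro G hG
      have hG := (Finset.mem_filter.1 hG).2.planeOn
      refine mem_framedGraphs.2 ⟨?_, Finset.subset_union_right⟩
      have c1 := clear_of_side hG fun z hz => (hin z hz).1
      have c2 := clear_of_side hG fun z hz => (hin z hz).2.1
      have c3 := clear_of_side hG fun z hz => (hin z hz).2.2
      have p3 := (hG.mono_points hSV).insert_edge hcV haV hca c3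
      have p2 := p3.insert_edge hbV hcV hbc fun x y hxy hx => by
        rcases Finset.mem_insert.1 hxy with he | he
        · refine sym2_cases (P := fun x y => ¬ Cross b c x y) (fun x y h h' => h h'.swap_right)
            he (fun h' => ?_) hx
          simpa using h'.1
        · exact c2 x y he hx
      have p1 := p2.insert_edge haV hbV hab fun x y hxy hx => by
        rcases Finset.mem_insert.1 hxy with he | he
        · refine sym2_cases (P := fun x y => ¬ Cross a b x y) (fun x y h h' => h h'.swap_right)
            he (fun h' => ?_) hx
          simpa using h'.1
        rcases Finset.mem_insert.1 he with he | he
        · refine sym2_cases (P := fun x y => ¬ Cross a b x y) (fun x y h h' => h h'.swap_right)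
            he (fun h' => ?_) hx
          simpa using h'.1
        · exact c1 x y he hx
      convert p1 using 1
      ext e
      simp only [triEdges, Finset.mem_union, Finset.mem_insert, Finset.mem_singleton]
      tauto
    · have hdisj : ∀ G ∈ planeGraphs S, Disjoint G (triEdges a b c) := fun G hG => by
        have hG := (Finset.mem_filter.1 hG).2.planeOn
        refine Finset.disjoint_right.2 fun e he heG => ?_
        simp only [triEdges, Finset.mem_insert, Finset.mem_singleton] at he
        rcases he with rfl | rfl | rfl
        exacts [haS (hG.mem heG), hbS (hG.mem heG), hcS (hG.mem heG)]
      intro G hG H hH hGH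
      rw [← Finset.union_sdiff_cancel_right (hdisj G hG),
        ← Finset.union_sdiff_cancel_right (hdisj H hH)]
      exact congrArg (· \ triEdges a b c) hGH
  calc ((planeGraphs S).card : ℝ) ≤ (framedGraphs a b c V).card := by exact_mod_cast hcard
    _ ≤ 172 ^ (V \ {a, b, c}).card := card_framedGraphs_le hF
    _ = 172 ^ S.card := by rw [hVS]

theorem card_planeGraphsDeg_le {S : Finset Pt} (hS : GenPos S) (i : ℕ) :
    ((planeGraphsDeg S i).card : ℝ) ≤ 172 ^ S.card :=
  le_trans (by exact_mod_cast Finset.card_filter_le _ _) (card_planeGraphs_le hS)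

/-- Lemma 2.11. With `c₁ = 1.978993` and `c₂ = 2.035802`, there
are polynomials `P₁, P₂` such that for every set `S` of `N` points in general
position: (i) either `pg(S,1) ≤ P₁(N) · 186.46 ^ N` or
`ĥv_{x,c₁N}(S,1) > N / 186.46`; and (ii) either `pg(S,2) ≤ P₂(N) · 180.20 ^ N`
or `ĥv_{x,c₂N}(S,2) > N / 180.20`. -/
theorem stmt9 :
    ∃ P₁ P₂ : Polynomial ℝ,
      ∀ (S : Finset Pt) (N : ℕ), S.card = N → GenPos S →
        (((planeGraphsDeg S 1).card : ℝ) ≤ P₁.eval (N : ℝ) * 186.46 ^ N ∨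
          (N : ℝ) / 186.46 < hvxLEDeg S (1.978993 * N) 1) ∧
        (((planeGraphsDeg S 2).card : ℝ) ≤ P₂.eval (N : ℝ) * 180.20 ^ N ∨
          (N : ℝ) / 180.20 < hvxLEDeg S (2.035802 * N) 2) := by
  refine ⟨1, 1, fun S N hN hS => ⟨Or.inl ?_, Or.inl ?_⟩⟩ <;>
    rw [Polynomial.eval_one, one_mul, ← hN]
  · exact (card_planeGraphsDeg_le hS 1).trans (by gcongr; norm_num)
  · exact (card_planeGraphsDeg_le hS 2).trans (by gcongr; norm_num)
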